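/- arXiv:1109.0345 — 4 statements merged into one kernel-verified Lean document; each statement's English description precedes it below -/
import Mathlib

section
/- Every graph admits a smooth 2-Lombardi drawing; moreover the vertices may be placed at any prescribed distinct positions. -/
open Set

noncomputable section

/-- A `Piece` is a parameterized circular arc or line segment in the plane `ℂ`. -/
inductive Piece : Type
  | arc (c : ℂ) (r θ₀ θ₁ : ℝ) : Piece
  | seg (p q : ℂ) : Piece

namespace Piece

/-- The parameterization of a piece over `[0,1]`. -/
def toFun : Piece → ℝ → ℂ
  | arc c r θ₀ θ₁, t => c + (r : ℂ) * Complex.exp (Complex.I * ((θ₀ + t * (θ₁ - θ₀) : ℝ) : ℂ))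
  | seg p q, t => p + (t : ℂ) * (q - p)

/-- Nondegeneracy: the parameterization has nonvanishing velocity. -/
def Nondeg : Piece → Prop
  | arc _ r θ₀ θ₁ => r ≠ 0 ∧ θ₀ ≠ θ₁
  | seg p q => p ≠ q

end Piece

/-- The direction of a vector, as an angle modulo `2π`. -/
def dirAngle (z : ℂ) : Real.Angle := (Complex.arg z : Real.Angle)

/-- `γ`, restricted to `[s,t]`, is an affine reparameterization of a single
nondegenerate circular arc or line segment. -/
def IsArcOn (γ : ℝ → ℂ) (s t : ℝ) : Prop :=
  ∃ P : Piece, P.Nondeg ∧ ∀ u ∈ Set.Icc (0 : ℝ) 1, γ (s + u * (t - s)) = P.toFun u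

/-- The curve `γ : [0,1] → ℂ` consists of at most `k` circular arcs (or segments). -/
def PolyArc (k : ℕ) (γ : ℝ → ℂ) : Prop :=
  ∃ m : ℕ, 0 < m ∧ m ≤ k ∧ ∃ f : ℕ → ℝ, f 0 = 0 ∧ f m = 1 ∧
    (∀ i < m, f i < f (i + 1)) ∧ ∀ i < m, IsArcOn γ (f i) (f (i + 1))

/-- A drawing of a simple graph in the plane: vertices go to distinct points, each edge is a
simple continuous curve between the points of its endpoints (traversed consistently in both
directions), and no edge passes through a vertex other than its endpoints. -/
structure GraphDrawing (V : Type*) (G : SimpleGraph V) where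
  pos : V → ℂ
  inj : Function.Injective pos
  curve : ∀ ⦃u v : V⦄, G.Adj u v → ℝ → ℂ
  cont : ∀ ⦃u v : V⦄ (h : G.Adj u v), ContinuousOn (curve h) (Set.Icc 0 1)
  source_eq : ∀ ⦃u v : V⦄ (h : G.Adj u v), curve h 0 = pos u
  target_eq : ∀ ⦃u v : V⦄ (h : G.Adj u v), curve h 1 = pos v
  symm : ∀ ⦃u v : V⦄ (h : G.Adj u v) (t : ℝ), curve h.symm t = curve h (1 - t)
  simple : ∀ ⦃u v : V⦄ (h : G.Adj u v), Set.InjOn (curve h) (Set.Icc 0 1)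
  vertexFree : ∀ ⦃u v : V⦄ (h : G.Adj u v) (w : V),
    pos w ∈ curve h '' Set.Icc 0 1 → w = u ∨ w = v

namespace GraphDrawing

variable {V : Type*} {G : SimpleGraph V} (D : GraphDrawing V G)

/-- Every edge of the drawing is drawn with at most `k` circular arcs. -/
def KArc (k : ℕ) : Prop := ∀ ⦃u v : V⦄ (h : G.Adj u v), PolyArc k (D.curve h)

/-- Every edge curve is continuously differentiable with nonvanishing derivative
(no sharp bends). -/
def Smooth : Prop := ∀ ⦃u v : V⦄ (h : G.Adj u v),
  ContDiffOn ℝ 1 (D.curve h) (Set.Icc 0 1) ∧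
    ∀ t ∈ Set.Icc (0 : ℝ) 1, derivWithin (D.curve h) (Set.Icc 0 1) t ≠ 0

/-- Perfect angular resolution: at each vertex `v`, the tangent directions of the incident
edge curves at `v` are equally spaced around `v`. -/
def PerfectRes : Prop := ∀ v : V,
  ∃ (θ : ℝ) (e : {u // G.Adj v u} ≃ Fin (Nat.card {u // G.Adj v u})),
    ∀ (u : V) (h : G.Adj v u), ∃ d : ℂ, d ≠ 0 ∧
      HasDerivWithinAt (D.curve h) d (Set.Icc 0 1) 0 ∧
      dirAngle d =
        ((θ + 2 * Real.pi * ((e ⟨u, h⟩ : Fin _) : ℕ) /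
            (Nat.card {u // G.Adj v u}) : ℝ) : Real.Angle)

/-- The drawing is planar (crossing-free): two distinct edges meet only at
common endpoints. -/
def NonCrossing : Prop := ∀ ⦃u v u' v' : V⦄ (h : G.Adj u v) (h' : G.Adj u' v'),
  s(u, v) ≠ s(u', v') →
    (D.curve h '' Set.Icc 0 1) ∩ (D.curve h' '' Set.Icc 0 1) ⊆
      ({D.pos u, D.pos v} ∩ {D.pos u', D.pos v'} : Set ℂ)

end GraphDrawing

/-- `G` has a Lombardi drawing: a drawing with one circular arc (or segment) per edge and
perfect angular resolution at every vertex. -/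
def HasLombardi (V : Type*) (G : SimpleGraph V) : Prop :=
  ∃ D : GraphDrawing V G, D.KArc 1 ∧ D.PerfectRes

/-- Bad parameters: the tangency equation has only finitely many solutions for a fixed `s`. -/
lemma finite_linear (A B : ℝ) (h : ¬ (A = 0 ∧ B = 0)) : {r : ℝ | A + B * r = 0}.Finite := by
  apply Set.Subsingleton.finite
  intro r hr r' hr'
  simp only [Set.mem_ofPred_eq] at hr hr'
  have hB : B ≠ 0 := by
    rintro rfl
    apply h
    constructor
    · linarith
    · rfl
  have : B * (r - r') = 0 := by linarith
  rcases mul_eq_zero.mp this with h1 | h1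
  · exact absurd h1 hB
  · linarith

lemma radii_real (x y c s c' s' : ℝ) (hA : c ^ 2 + s ^ 2 = 1) (hB : c' ^ 2 + s' ^ 2 = 1)
    (H : x * (c - c') + y * (s - s') ≠ 0) (F₁ F₂ : Set ℝ) (h1 : F₁.Finite) (h2 : F₂.Finite) :
    ∃ r₁ r₂ : ℝ, r₁ ∉ F₁ ∧ r₂ ∉ F₂ ∧
      (x - (r₂ * s' - r₁ * s)) ^ 2 + (y + (r₂ * c' - r₁ * c)) ^ 2 = (r₁ - r₂) ^ 2 := by
  set α := -x * s + y * c with hα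
  set β := -x * s' + y * c' with hβ
  set k := 1 - (c * c' + s * s') with hk
  set N := x ^ 2 + y ^ 2 with hN
  have hkpos : k ≠ 0 := by
    intro hk0
    have e : (c - c') ^ 2 + (s - s') ^ 2 = 0 := by nlinarith
    have e1 : c - c' = 0 := by nlinarith [sq_nonneg (c - c'), sq_nonneg (s - s')]
    have e2 : s - s' = 0 := by nlinarith [sq_nonneg (c - c'), sq_nonneg (s - s')]
    apply H
    rw [e1, e2]; ring
  have hkey : N * k + 2 * α * β ≠ 0 := by
    have id : 2 * (N * k + 2 * α * β) =
        (x * (c - c') + y * (s - s')) ^ 2 + (α + β) ^ 2 := by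
      have i1 : N * (c ^ 2 + s ^ 2) = (x * c + y * s) ^ 2 + α ^ 2 := by rw [hN, hα]; ring
      have i2 : N * (c' ^ 2 + s' ^ 2) = (x * c' + y * s') ^ 2 + β ^ 2 := by rw [hN, hβ]; ring
      have i3 : N * (c * c' + s * s') = (x * c + y * s) * (x * c' + y * s') + α * β := by
        rw [hN, hα, hβ]; ring
      rw [hA] at i1
      rw [hB] at i2
      rw [hk]
      linear_combination i1 + i2 - 2 * i3
    have := pow_pos (abs_pos.mpr H) 2
    rw [sq_abs] at this
    nlinarith [sq_nonneg (α + β)]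
  have fin : (F₁ ∪ {r : ℝ | β + k * r = 0} ∪
      ⋃ t ∈ F₂, {r : ℝ | (N + 2 * t * β) + (2 * t * k - 2 * α) * r = 0}).Finite := by
    refine (h1.union (finite_linear _ _ (fun h => hkpos h.2))).union (h2.biUnion ?_)
    intro t _
    apply finite_linear
    rintro ⟨e1, e2⟩
    apply hkey
    linear_combination k * e1 - β * e2
  obtain ⟨r₁, hr⟩ := fin.infinite_compl.nonempty
  simp only [Set.mem_compl_iff, Set.mem_union, Set.mem_ofPred_eq, Set.mem_iUnion, not_or,
    not_exists] at hr
  obtain ⟨⟨hr1, hr2⟩, hr3⟩ := hr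
  have hq : 2 * (β + k * r₁) * ((2 * r₁ * α - N) / (2 * (β + k * r₁))) = 2 * r₁ * α - N := by
    field_simp
  refine ⟨r₁, (2 * r₁ * α - N) / (2 * (β + k * r₁)), hr1, ?_, ?_⟩
  · intro hm
    apply hr3 _ hm
    linear_combination hq
  · generalize (2 * r₁ * α - N) / (2 * (β + k * r₁)) = r₂ at hq
    rw [hβ, hk, hα, hN] at hq
    linear_combination hq + r₁ ^ 2 * hA + r₂ ^ 2 * hB

lemma exists_radii (p q A B : ℂ) (hA : ‖A‖ = 1) (hB : ‖B‖ = 1)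
    (H : (q - p).re * (A.re - B.re) + (q - p).im * (A.im - B.im) ≠ 0)
    (F₁ F₂ : Set ℝ) (h1 : F₁.Finite) (h2 : F₂.Finite) :
    ∃ (r₁ r₂ : ℝ) (M : ℂ), r₁ ∉ F₁ ∧ r₂ ∉ F₂ ∧ r₁ ≠ r₂ ∧ ‖M‖ = 1 ∧ M ≠ A ∧ M ≠ B ∧
      p + Complex.I * r₁ * A - (q + Complex.I * r₂ * B) = Complex.I * (r₁ - r₂) * M := by
  have hA' : A.re ^ 2 + A.im ^ 2 = 1 := by
    have := Complex.sq_norm A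
    rw [hA, Complex.normSq_apply] at this; linarith
  have hB' : B.re ^ 2 + B.im ^ 2 = 1 := by
    have := Complex.sq_norm B
    rw [hB, Complex.normSq_apply] at this; linarith
  obtain ⟨r₁, r₂, hr1, hr2, he⟩ := radii_real _ _ _ _ _ _ hA' hB' H F₁ F₂ h1 h2
  -- the key contradiction
  have key : ∀ r : ℝ, p - q + Complex.I * r * (A - B) ≠ 0 := by
    intro r hr
    have e1 := congrArg Complex.re hr
    have e2 := congrArg Complex.im hr
    simp at e1 e2
    apply H
    simp
    linear_combination (-(A.re - B.re)) * e1 - (A.im - B.im) * e2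
  have hne : r₁ ≠ r₂ := by
    rintro rfl
    apply key r₁
    simp only [sub_self] at he
    have z1 : (q - p).re - (r₁ * B.im - r₁ * A.im) = 0 := by
      nlinarith [sq_nonneg ((q - p).re - (r₁ * B.im - r₁ * A.im)),
        sq_nonneg ((q - p).im + (r₁ * B.re - r₁ * A.re))]
    have z2 : (q - p).im + (r₁ * B.re - r₁ * A.re) = 0 := by
      nlinarith [sq_nonneg ((q - p).re - (r₁ * B.im - r₁ * A.im)),
        sq_nonneg ((q - p).im + (r₁ * B.re - r₁ * A.re))]
    simp at z1 z2
    apply Complex.ext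
    · simp; linarith
    · simp; linarith
  have hne' : (r₁ : ℂ) - r₂ ≠ 0 := by
    rw [sub_ne_zero]; exact_mod_cast hne
  set X := p + Complex.I * r₁ * A - (q + Complex.I * r₂ * B) with hX
  have hXn : ‖X‖ = ‖(r₁ : ℂ) - r₂‖ := by
    have e1 : ‖X‖ ^ 2 = (r₁ - r₂) ^ 2 := by
      rw [Complex.sq_norm, Complex.normSq_apply, ← he, hX]
      simp; ring
    have e2 : ‖(r₁ : ℂ) - r₂‖ ^ 2 = (r₁ - r₂) ^ 2 := by
      rw [← Complex.ofReal_sub, Complex.norm_real, Real.norm_eq_abs, sq_abs]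
    exact (sq_eq_sq₀ (norm_nonneg _) (norm_nonneg _)).mp (e1.trans e2.symm)
  have hM : X = Complex.I * (r₁ - r₂) * (X / (Complex.I * (r₁ - r₂))) := by
    field_simp
  refine ⟨r₁, r₂, X / (Complex.I * (r₁ - r₂)), hr1, hr2, hne, ?_, ?_, ?_, hM⟩
  · rw [norm_div, norm_mul, Complex.norm_I, one_mul, hXn, div_self]
    exact norm_ne_zero_iff.mpr hne'
  · intro h
    rw [h, hX] at hM
    apply key r₂
    linear_combination hM
  · intro h
    rw [h, hX] at hM
    apply key r₁
    linear_combination hM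

/-- The unit vector with angle `x`. -/
def uv (x : ℝ) : ℂ := Complex.exp (Complex.I * (x : ℂ))

lemma norm_uv (x : ℝ) : ‖uv x‖ = 1 := by
  rw [uv, mul_comm]; exact Complex.norm_exp_ofReal_mul_I x

lemma uv_ne_zero (x : ℝ) : uv x ≠ 0 := Complex.exp_ne_zero _

lemma uv_add (x y : ℝ) : uv (x + y) = uv x * uv y := by
  simp only [uv, Complex.ofReal_add, mul_add, Complex.exp_add]

lemma uv_re (x : ℝ) : (uv x).re = Real.cos x := by
  rw [uv, mul_comm]; exact Complex.exp_ofReal_mul_I_re x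

lemma uv_im (x : ℝ) : (uv x).im = Real.sin x := by
  rw [uv, mul_comm]; exact Complex.exp_ofReal_mul_I_im x

lemma uv_neg_pi_div_two : uv (-(Real.pi / 2)) = -Complex.I := by
  apply Complex.ext
  · rw [uv_re]; simp
  · rw [uv_im]; simp

lemma uv_pi : uv Real.pi = -1 := by
  apply Complex.ext
  · rw [uv_re]; simp
  · rw [uv_im]; simp

lemma uv_two_pi : uv (2 * Real.pi) = 1 := by
  apply Complex.ext
  · rw [uv_re]; simp
  · rw [uv_im]; simp

lemma uv_zero : uv 0 = 1 := by simp [uv]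

lemma uv_inj {x y : ℝ} (h : uv x = uv y) (h' : |x - y| < 2 * Real.pi) : x = y := by
  have e : uv (x - y) = 1 := by
    have := uv_add (x - y) y
    rw [sub_add_cancel, h] at this
    exact (mul_eq_right₀ (uv_ne_zero y)).mp this.symm
  have e1 : Real.cos (x - y) = 1 := by rw [← uv_re, e]; simp
  rw [abs_lt] at h'
  have := (Real.cos_eq_one_iff_of_lt_of_lt h'.1 h'.2).mp e1
  linarith

lemma uv_hasDerivAt (x : ℝ) : HasDerivAt uv (Complex.I * uv x) x := by
  have h : HasDerivAt (fun y : ℝ => Complex.I * (y : ℂ)) (Complex.I * 1) x :=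
    (Complex.ofRealCLM.hasDerivAt (x := x)).const_mul Complex.I
  have := h.cexp
  have e : Complex.I * uv x = Complex.exp (Complex.I * ↑x) * (Complex.I * 1) := by
    simp only [uv]; ring
  rw [e]; exact this

lemma exists_turn (r a : ℝ) (M : ℂ) (hr : r ≠ 0) (hM : ‖M‖ = 1) (hne : M ≠ uv a) :
    ∃ s : ℝ, uv (a + s) = M ∧ 0 < r * s ∧ |s| < 2 * Real.pi := by
  set s₀ := Complex.arg (M / uv a) with hs
  have hn : ‖M / uv a‖ = 1 := by rw [norm_div, hM, norm_uv, div_one]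
  have e0 : uv s₀ = M / uv a := by
    have := Complex.norm_mul_exp_arg_mul_I (M / uv a)
    rw [hn, Complex.ofReal_one, one_mul, mul_comm] at this
    exact this
  have e1 : uv (a + s₀) = M := by
    rw [uv_add, e0]; field_simp [uv_ne_zero a]
  have h0 : s₀ ≠ 0 := by
    intro h
    rw [h, add_zero] at e1
    exact hne e1.symm
  have l1 := Complex.neg_pi_lt_arg (M / uv a)
  have l2 := Complex.arg_le_pi (M / uv a)
  rw [← hs] at l1 l2
  have pp := Real.pi_pos
  have e2 : uv (a + (s₀ + 2 * Real.pi)) = M := by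
    rw [← add_assoc, uv_add, uv_two_pi, e1, mul_one]
  have e3 : uv (a + (s₀ - 2 * Real.pi)) = M := by
    have := uv_add (a + (s₀ - 2 * Real.pi)) (2 * Real.pi)
    rw [uv_two_pi, mul_one] at this
    rw [← this, ← e1]; congr 1; ring
  rcases lt_or_gt_of_ne hr with hr | hr <;> rcases lt_or_gt_of_ne h0 with h0 | h0
  · exact ⟨s₀, e1, mul_pos_of_neg_of_neg hr h0, by rw [abs_lt]; constructor <;> linarith⟩
  · exact ⟨s₀ - 2 * Real.pi, e3, mul_pos_of_neg_of_neg hr (by linarith),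
      by rw [abs_lt]; constructor <;> linarith⟩
  · exact ⟨s₀ + 2 * Real.pi, e2, mul_pos hr (by linarith),
      by rw [abs_lt]; constructor <;> linarith⟩
  · exact ⟨s₀, e1, mul_pos hr h0, by rw [abs_lt]; constructor <;> linarith⟩

/-- Unit-speed-scaled circular motion through `p` (at time `t₀`) with direction angle `a` there,
signed radius `r` and speed `L`. -/
def circ (p : ℂ) (r a L t₀ t : ℝ) : ℂ :=
  p - Complex.I * r * (uv (a + (t - t₀) * L / r) - uv a)

lemma circ_hasDerivAt (p : ℂ) (r a L t₀ t : ℝ) (hr : r ≠ 0) :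
    HasDerivAt (circ p r a L t₀) (L * uv (a + (t - t₀) * L / r)) t := by
  have h1 : HasDerivAt (fun t : ℝ => a + (t - t₀) * L / r) (L / r) t := by
    have := ((((hasDerivAt_id t).sub_const t₀).mul_const L).div_const r).const_add a
    simpa using this
  have h2 := (uv_hasDerivAt (a + (t - t₀) * L / r)).scomp t h1
  have h3 := ((h2.sub_const (uv a)).const_mul (Complex.I * r)).const_sub p
  have : (r : ℂ) ≠ 0 := by exact_mod_cast hr
  have e : (L : ℂ) * uv (a + (t - t₀) * L / r) =
      -(Complex.I * r * ((L / r) • (Complex.I * uv (a + (t - t₀) * L / r)))) := by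
    simp only [Complex.real_smul, Complex.ofReal_div]
    have e2 : (r : ℂ) * (L / r) = L := by field_simp
    linear_combination (uv (a + (t - t₀) * L / r) * L) * Complex.I_sq +
      Complex.I ^ 2 * uv (a + (t - t₀) * L / r) * e2
  rw [e]; exact h3

lemma circ_isArcOn (p : ℂ) (r a L t₀ s t : ℝ) (hr : r ≠ 0) (hL : L ≠ 0) (hst : s < t)
    (γ : ℝ → ℂ) (h : ∀ x ∈ Set.Icc s t, γ x = circ p r a L t₀ x) : IsArcOn γ s t := by
  refine ⟨Piece.arc (p + Complex.I * r * uv a) r (a + (s - t₀) * L / r + -(Real.pi / 2))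
    (a + (t - t₀) * L / r + -(Real.pi / 2)), ⟨hr, ?_⟩, ?_⟩
  · intro e
    have : (t - s) * L / r = 0 := by
      have : (t - s) * L / r = (t - t₀) * L / r - (s - t₀) * L / r := by ring
      rw [this]; linarith
    have h2 : (t - s) * L / r ≠ 0 := div_ne_zero (mul_ne_zero (by linarith) hL) hr
    exact h2 this
  · intro u hu
    rw [h _ ⟨by nlinarith [hu.1], by nlinarith [hu.2]⟩]
    simp only [Piece.toFun, circ]
    rw [← uv]
    have : a + (s - t₀) * L / r + -(Real.pi / 2) + u * (a + (t - t₀) * L / r + -(Real.pi / 2) -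
      (a + (s - t₀) * L / r + -(Real.pi / 2))) =
      (a + (s + u * (t - s) - t₀) * L / r) + -(Real.pi / 2) := by ring
    rw [this, uv_add _ (-(Real.pi / 2)), uv_neg_pi_div_two]
    ring

/-- Two tangent circles meet only at the tangency point. -/
lemma tangent_aux (r₁ r₂ : ℝ) (x y M : ℂ) (hx : ‖x‖ = 1) (hy : ‖y‖ = 1) (hM : ‖M‖ = 1)
    (h1 : r₁ ≠ 0) (h2 : r₂ ≠ 0) (h : r₁ ≠ r₂) (e : r₁ * x - r₂ * y = (r₁ - r₂) * M) :
    y = M := by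
  have sq : ∀ z : ℂ, ‖z‖ = 1 → z.re ^ 2 + z.im ^ 2 = 1 := by
    intro z hz
    have := Complex.sq_norm z
    rw [hz, Complex.normSq_apply] at this; linarith
  have sx := sq x hx
  have sy := sq y hy
  have sM := sq M hM
  have e1 := congrArg Complex.re e
  have e2 := congrArg Complex.im e
  simp at e1 e2
  have e3 : r₁ * r₂ * (1 - (x.re * y.re + x.im * y.im)) = 0 := by
    have q1 : (r₁ * x.re - r₂ * y.re) ^ 2 + (r₁ * x.im - r₂ * y.im) ^ 2 =
      (r₁ - r₂) ^ 2 * (M.re ^ 2 + M.im ^ 2) := by rw [e1, e2]; ring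
    rw [sM] at q1
    linear_combination q1 / 2 - r₁ ^ 2 / 2 * sx - r₂ ^ 2 / 2 * sy
  have e4 : 1 - (x.re * y.re + x.im * y.im) = 0 := by
    rcases mul_eq_zero.mp e3 with h' | h'
    · exact absurd h' (mul_ne_zero h1 h2)
    · exact h'
  have xy : x = y := by
    apply Complex.ext
    · nlinarith [sq_nonneg (x.re - y.re), sq_nonneg (x.im - y.im)]
    · nlinarith [sq_nonneg (x.re - y.re), sq_nonneg (x.im - y.im)]
  subst xy
  have hne' : (r₁ : ℂ) - r₂ ≠ 0 := by
    rw [sub_ne_zero]; exact_mod_cast h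
  apply mul_left_cancel₀ hne'
  linear_combination e

/-- A point on the circle through `p` with direction `A` determines the radius. -/
lemma circle_radius (w p A x : ℂ) (r : ℝ) (hA : ‖A‖ = 1) (hx : ‖x‖ = 1) (hw : w ≠ p)
    (h : w = p - Complex.I * r * (x - A)) :
    r = ‖w - p‖ ^ 2 / (2 * ((w - p).im * A.re - (w - p).re * A.im)) := by
  have sq : ∀ z : ℂ, ‖z‖ = 1 → z.re ^ 2 + z.im ^ 2 = 1 := by
    intro z hz
    have := Complex.sq_norm z
    rw [hz, Complex.normSq_apply] at this; linarith
  have sA := sq A hA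
  have sx := sq x hx
  have e0 : w - p = - Complex.I * r * (x - A) := by rw [h]; ring
  have hpos : 0 < ‖w - p‖ ^ 2 := pow_pos (norm_pos_iff.mpr (sub_ne_zero.mpr hw)) 2
  have e : ‖w - p‖ ^ 2 = r * (2 * ((w - p).im * A.re - (w - p).re * A.im)) := by
    rw [Complex.sq_norm, Complex.normSq_apply, e0]
    simp
    linear_combination r ^ 2 * sx - r ^ 2 * sA
  have : 2 * ((w - p).im * A.re - (w - p).re * A.im) ≠ 0 := by
    intro h0
    rw [h0, mul_zero] at e
    linarith
  rw [e, mul_div_assoc, div_self this, mul_one]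

lemma glue_hasDerivAt (f g f' g' : ℝ → ℂ) (τ : ℝ) (hf : ∀ t, HasDerivAt f (f' t) t)
    (hg : ∀ t, HasDerivAt g (g' t) t) (h : f τ = g τ) (h' : f' τ = g' τ) (t : ℝ) :
    HasDerivAt (fun t => if t ≤ τ then f t else g t) (if t ≤ τ then f' t else g' t) t := by
  rcases lt_trichotomy t τ with ht | ht | ht
  · rw [if_pos ht.le]
    apply (hf t).congr_of_eventuallyEq
    filter_upwards [Iio_mem_nhds ht] with x hx
    rw [if_pos (le_of_lt hx)]
  · subst ht
    rw [if_pos le_rfl]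
    have h1 : HasDerivWithinAt (fun x => if x ≤ t then f x else g x) (f' t) (Set.Iic t) t := by
      apply (hf t).hasDerivWithinAt.congr
      · intro x hx; exact if_pos hx
      · exact if_pos le_rfl
    have h2 : HasDerivWithinAt (fun x => if x ≤ t then f x else g x) (f' t) (Set.Ici t) t := by
      rw [h']
      apply (hg t).hasDerivWithinAt.congr
      · intro x hx
        rcases eq_or_lt_of_le (Set.mem_Ici.mp hx) with e | e
        · subst e; rw [if_pos le_rfl, h]
        · exact if_neg (not_le.mpr e)
      · rw [if_pos le_rfl, h]
    have := h1.union h2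
    rw [Set.Iic_union_Ici] at this
    exact this.hasDerivAt Filter.univ_mem
  · rw [if_neg (not_le.mpr ht)]
    apply (hg t).congr_of_eventuallyEq
    filter_upwards [Ioi_mem_nhds ht] with x hx
    rw [if_neg (not_le.mpr hx)]

/-- A smooth two-arc curve from `p` to `q` with direction `A` at `p` and arrival direction `B`
at `q`, avoiding the points of `W` other than `p`, `q`. -/
def GoodCurve (γ : ℝ → ℂ) (p q A B : ℂ) (W : Set ℂ) : Prop :=
  ∃ γ' : ℝ → ℂ, (∀ t, HasDerivAt γ (γ' t) t) ∧ Continuous γ' ∧ (∀ t, γ' t ≠ 0) ∧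
    (∃ L : ℝ, 0 < L ∧ γ' 0 = L * A ∧ γ' 1 = L * B) ∧ γ 0 = p ∧ γ 1 = q ∧
    Set.InjOn γ (Set.Icc 0 1) ∧
    (∀ w ∈ W, w ∈ γ '' Set.Icc 0 1 → w = p ∨ w = q) ∧
    ∃ τ : ℝ, 0 < τ ∧ τ < 1 ∧ IsArcOn γ 0 τ ∧ IsArcOn γ τ 1

lemma circ_inj (p : ℂ) (r a L t₀ t t' s : ℝ) (hr : r ≠ 0) (hL : 0 < L)
    (h : circ p r a L t₀ t = circ p r a L t₀ t') (hs : |s| < 2 * Real.pi)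
    (ht : |(t - t') * L / r| ≤ |s|) : t = t' := by
  have hr' : (r : ℂ) ≠ 0 := by exact_mod_cast hr
  have e : uv (a + (t - t₀) * L / r) = uv (a + (t' - t₀) * L / r) := by
    simp only [circ] at h
    apply mul_left_cancel₀ (mul_ne_zero Complex.I_ne_zero hr')
    linear_combination -h
  have e0 : (a + (t - t₀) * L / r) - (a + (t' - t₀) * L / r) = (t - t') * L / r := by ring
  have e1 := uv_inj e (by rw [e0]; exact lt_of_le_of_lt ht hs)
  have e2 : (t - t') * L / r = 0 := by rw [← e0, e1]; ring
  rw [div_eq_zero_iff, mul_eq_zero] at e2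
  rcases e2 with (e2 | e2) | e2
  · linarith
  · exact absurd e2 hL.ne'
  · exact absurd e2 hr

lemma exists_goodCurve (p q : ℂ) (a b : ℝ)
    (H : (q - p).re * ((uv a).re - (uv b).re) + (q - p).im * ((uv a).im - (uv b).im) ≠ 0)
    (W : Set ℂ) (hW : W.Finite) : ∃ γ, GoodCurve γ p q (uv a) (uv b) W := by
  set F : ℂ → ℂ → Set ℝ := fun p A =>
    insert 0 ((fun w : ℂ => ‖w - p‖ ^ 2 / (2 * ((w - p).im * A.re - (w - p).re * A.im))) '' W)
    with hF
  obtain ⟨r₁, r₂, M, hr₁, hr₂, hne, hM, hMA, hMB, hc⟩ :=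
    exists_radii p q (uv a) (uv b) (norm_uv a) (norm_uv b) H (F p (uv a)) (F q (uv b))
      ((hW.image _).insert 0) ((hW.image _).insert 0)
  have h10 : r₁ ≠ 0 := fun h => hr₁ (h ▸ Set.mem_insert _ _)
  have h20 : r₂ ≠ 0 := fun h => hr₂ (h ▸ Set.mem_insert _ _)
  obtain ⟨s₁, hs1, hp1, hl1⟩ := exists_turn r₁ a M h10 hM hMA
  obtain ⟨s₂', hs2, hp2', hl2⟩ := exists_turn (-r₂) b M (neg_ne_zero.mpr h20) hM hMB
  obtain ⟨s₂, rfl⟩ : ∃ s, s₂' = -s := ⟨-s₂', by ring⟩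
  have hp2 : 0 < r₂ * s₂ := by linarith
  rw [abs_neg] at hl2
  set L := r₁ * s₁ + r₂ * s₂ with hLdef
  have hL : 0 < L := by positivity
  set τ := r₁ * s₁ / L with hτ
  have hτL : τ * L = r₁ * s₁ := by rw [hτ]; field_simp
  have hτ0 : 0 < τ := div_pos hp1 hL
  have hτ1 : τ < 1 := by rw [hτ, div_lt_one hL]; linarith
  have a1 : a + (τ - 0) * L / r₁ = a + s₁ := by
    rw [sub_zero, hτL]; field_simp
  have a2 : b + (τ - 1) * L / r₂ = b + -s₂ := by
    have : (τ - 1) * L = r₂ * -s₂ := by rw [sub_mul, hτL, hLdef]; ring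
    rw [this]; field_simp
  set f := circ p r₁ a L 0 with hf
  set g := circ q r₂ b L 1 with hg
  have hfτ : f τ = p - Complex.I * r₁ * (M - uv a) := by rw [hf, circ, a1, hs1]
  have hgτ : g τ = q - Complex.I * r₂ * (M - uv b) := by rw [hg, circ, a2, hs2]
  have hfg : f τ = g τ := by
    rw [hfτ, hgτ]; linear_combination hc
  set f' : ℝ → ℂ := fun t => L * uv (a + (t - 0) * L / r₁) with hf'
  set g' : ℝ → ℂ := fun t => L * uv (b + (t - 1) * L / r₂) with hg'
  have hfg' : f' τ = g' τ := by
    simp only [hf', hg']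
    rw [a1, a2, hs1, hs2]
  have hLc : (L : ℂ) ≠ 0 := by exact_mod_cast hL.ne'
  have uvc : Continuous uv := continuous_iff_continuousAt.mpr
    (fun x => (uv_hasDerivAt x).continuousAt)
  have hle : ∀ t ∈ Set.Icc 0 τ, (fun t => if t ≤ τ then f t else g t) t = f t :=
    fun t ht => if_pos ht.2
  have hge : ∀ t ∈ Set.Icc τ 1, (fun t => if t ≤ τ then f t else g t) t = g t := by
    intro t ht
    rcases eq_or_lt_of_le ht.1 with e | e
    · subst e; simp only [le_refl, if_true]; exact hfg
    · exact if_neg (not_le.mpr e)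
  have finj : Set.InjOn f (Set.Icc 0 τ) := by
    intro t ht t' ht' h
    apply circ_inj p r₁ a L 0 t t' s₁ h10 hL h hl1
    have : s₁ = τ * L / r₁ := by rw [hτL]; field_simp
    rw [this, abs_div, abs_div, abs_mul, abs_mul]
    have hb : |t - t'| ≤ |τ| := by
      rw [abs_of_pos hτ0, abs_le]
      constructor <;> linarith [ht.1, ht.2, ht'.1, ht'.2]
    exact div_le_div_of_nonneg_right (mul_le_mul_of_nonneg_right hb (abs_nonneg _)) (abs_nonneg _)
  have ginj : Set.InjOn g (Set.Icc τ 1) := by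
    intro t ht t' ht' h
    apply circ_inj q r₂ b L 1 t t' s₂ h20 hL h hl2
    have : s₂ = (1 - τ) * L / r₂ := by
      rw [sub_mul, hτL, hLdef]; field_simp; ring
    rw [this, abs_div, abs_div, abs_mul, abs_mul]
    have hb : |t - t'| ≤ |1 - τ| := by
      rw [abs_of_pos (sub_pos.mpr hτ1), abs_le]
      constructor <;> linarith [ht.1, ht.2, ht'.1, ht'.2]
    exact div_le_div_of_nonneg_right (mul_le_mul_of_nonneg_right hb (abs_nonneg _)) (abs_nonneg _)
  have cross : ∀ t ∈ Set.Icc (0 : ℝ) τ, ∀ t' ∈ Set.Icc τ 1, f t = g t' → t = t' := by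
    intro t ht t' ht' h
    have hy : uv (b + (t' - 1) * L / r₂) = M := by
      refine tangent_aux r₁ r₂ (uv (a + (t - 0) * L / r₁)) _ M (norm_uv _) (norm_uv _) hM
        h10 h20 hne ?_
      simp only [hf, hg, circ] at h
      apply mul_left_cancel₀ Complex.I_ne_zero
      linear_combination hc - h
    have e1 : g t' = g τ := by rw [hgτ, hg, circ, hy]
    have e2 := ginj ht' (Set.left_mem_Icc.mpr hτ1.le) e1
    subst e2
    have e3 : f t = f τ := by rw [hfg]; exact h
    exact finj ht (Set.right_mem_Icc.mpr hτ0.le) e3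
  refine ⟨fun t => if t ≤ τ then f t else g t, fun t => if t ≤ τ then f' t else g' t,
    ?_, ?_, ?_, ?_, ?_, ?_, ?_, ?_, τ, hτ0, hτ1, ?_, ?_⟩
  · exact glue_hasDerivAt f g f' g' τ (fun t => circ_hasDerivAt _ _ _ _ _ _ h10)
      (fun t => circ_hasDerivAt _ _ _ _ _ _ h20) hfg hfg'
  · apply Continuous.if_le
    · simp only [hf']; fun_prop
    · simp only [hg']; fun_prop
    · exact continuous_id
    · exact continuous_const
    · intro x hx; rw [hx]; exact hfg'
  · intro t
    dsimp only
    split_ifs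
    · exact mul_ne_zero hLc (uv_ne_zero _)
    · exact mul_ne_zero hLc (uv_ne_zero _)
  · refine ⟨L, hL, ?_, ?_⟩
    · simp only [if_pos hτ0.le, hf']; simp
    · simp only [if_neg (not_le.mpr hτ1), hg']; simp
  · simp only [if_pos hτ0.le, hf, circ]; simp
  · simp only [if_neg (not_le.mpr hτ1), hg, circ]; simp
  · intro t ht t' ht' h
    rcases le_total t τ with c | c <;> rcases le_total t' τ with c' | c'
    · rw [hle t ⟨ht.1, c⟩, hle t' ⟨ht'.1, c'⟩] at h
      exact finj ⟨ht.1, c⟩ ⟨ht'.1, c'⟩ h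
    · rw [hle t ⟨ht.1, c⟩, hge t' ⟨c', ht'.2⟩] at h
      exact cross t ⟨ht.1, c⟩ t' ⟨c', ht'.2⟩ h
    · rw [hge t ⟨c, ht.2⟩, hle t' ⟨ht'.1, c'⟩] at h
      exact (cross t' ⟨ht'.1, c'⟩ t ⟨c, ht.2⟩ h.symm).symm
    · rw [hge t ⟨c, ht.2⟩, hge t' ⟨c', ht'.2⟩] at h
      exact ginj ⟨c, ht.2⟩ ⟨c', ht'.2⟩ h
  · rintro w hw ⟨t, ht, h⟩
    by_contra hcon
    rw [not_or] at hcon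
    rcases le_total t τ with c | c
    · rw [hle t ⟨ht.1, c⟩] at h
      apply hr₁
      right
      exact ⟨w, hw, (circle_radius w p (uv a) _ r₁ (norm_uv a) (norm_uv _) hcon.1 h.symm).symm⟩
    · rw [hge t ⟨c, ht.2⟩] at h
      apply hr₂
      right
      exact ⟨w, hw, (circle_radius w q (uv b) _ r₂ (norm_uv b) (norm_uv _) hcon.2 h.symm).symm⟩
  · exact circ_isArcOn p r₁ a L 0 0 τ h10 hL.ne' hτ0 _ hle
  · exact circ_isArcOn q r₂ b L 1 τ 1 h20 hL.ne' hτ1 _ hge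

lemma IsArcOn.reverse {γ : ℝ → ℂ} {s t : ℝ} (h : IsArcOn γ s t) :
    IsArcOn (fun x => γ (1 - x)) (1 - t) (1 - s) := by
  obtain ⟨P, hP, hu⟩ := h
  have key : ∀ u ∈ Set.Icc (0 : ℝ) 1,
      γ (1 - (1 - t + u * (1 - s - (1 - t)))) = P.toFun (1 - u) := by
    intro u h
    rw [← hu (1 - u) ⟨by linarith [h.2], by linarith [h.1]⟩]
    congr 1; ring
  cases P with
  | arc c r θ₀ θ₁ =>
    refine ⟨Piece.arc c r θ₁ θ₀, ⟨hP.1, hP.2.symm⟩, fun u h => ?_⟩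
    refine (key u h).trans ?_
    simp only [Piece.toFun]
    congr 5; ring
  | seg p q =>
    refine ⟨Piece.seg q p, Ne.symm hP, fun u h => ?_⟩
    refine (key u h).trans ?_
    simp only [Piece.toFun]
    push_cast; ring

lemma GoodCurve.reverse {γ : ℝ → ℂ} {p q A B : ℂ} {W : Set ℂ} (h : GoodCurve γ p q A B W) :
    GoodCurve (fun x => γ (1 - x)) q p (-B) (-A) W := by
  obtain ⟨γ', h1, h2, h3, ⟨L, hL, h4, h5⟩, h6, h7, h8, h9, τ, t0, t1, a1, a2⟩ := h
  have mem : ∀ t ∈ Set.Icc (0 : ℝ) 1, 1 - t ∈ Set.Icc (0 : ℝ) 1 :=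
    fun t ht => ⟨by linarith [ht.2], by linarith [ht.1]⟩
  refine ⟨fun t => -γ' (1 - t), ?_, ?_, ?_, ⟨L, hL, ?_, ?_⟩, ?_, ?_, ?_, ?_,
    1 - τ, by linarith, by linarith, ?_, ?_⟩
  · intro t
    have := (h1 (1 - t)).scomp t ((hasDerivAt_id t).const_sub 1)
    rw [neg_one_smul] at this
    exact this
  · fun_prop
  · intro t; exact neg_ne_zero.mpr (h3 _)
  · simp [h5]
  · simp [h4]
  · simp [h7]
  · simp [h6]
  · intro t ht t' ht' e
    have := h8 (mem t ht) (mem t' ht') e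
    linarith
  · rintro w hw ⟨t, ht, e⟩
    exact (h9 w hw ⟨1 - t, mem t ht, e⟩).symm
  · simpa using a2.reverse
  · simpa using a1.reverse

lemma GoodCurve.polyArc {γ : ℝ → ℂ} {p q A B : ℂ} {W : Set ℂ} (h : GoodCurve γ p q A B W) :
    PolyArc 2 γ := by
  obtain ⟨γ', h1, h2, h3, ⟨L, hL, h4, h5⟩, h6, h7, h8, h9, τ, t0, t1, a1, a2⟩ := h
  refine ⟨2, by norm_num, le_rfl, fun i => if i = 0 then 0 else if i = 1 then τ else 1,
    by simp, by simp, ?_, ?_⟩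
  · intro i hi
    interval_cases i
    · simpa using t0
    · simpa using t1
  · intro i hi
    interval_cases i
    · simpa using a1
    · simpa using a2

lemma GoodCurve.smooth {γ : ℝ → ℂ} {p q A B : ℂ} {W : Set ℂ} (h : GoodCurve γ p q A B W) :
    ContDiffOn ℝ 1 γ (Set.Icc 0 1) ∧
      ∀ t ∈ Set.Icc (0 : ℝ) 1, derivWithin γ (Set.Icc 0 1) t ≠ 0 := by
  obtain ⟨γ', h1, h2, h3, -⟩ := h
  have e : deriv γ = γ' := funext fun t => (h1 t).deriv
  constructor
  · apply ContDiff.contDiffOn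
    rw [contDiff_one_iff_deriv, e]
    exact ⟨fun t => (h1 t).differentiableAt, h2⟩
  · intro t ht
    rw [(h1 t).hasDerivWithinAt.derivWithin (uniqueDiffOn_Icc zero_lt_one t ht)]
    exact h3 t

lemma dirAngle_uv (L x : ℝ) (hL : 0 < L) : dirAngle (L * uv x) = (x : Real.Angle) := by
  rw [dirAngle, Complex.arg_real_mul _ hL, uv, mul_comm, Complex.arg_exp_mul_I]
  simp

lemma countable_cos_zero (K c : ℝ) (hK : K ≠ 0) :
    {t : ℝ | Real.cos ((t * K + c) / 2) = 0}.Countable := by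
  refine (Set.countable_range (fun k : ℤ => ((2 * k + 1) * Real.pi - c) / K)).mono ?_
  intro t ht
  obtain ⟨k, hk⟩ := Real.cos_eq_zero_iff.mp (show Real.cos ((t * K + c) / 2) = 0 from ht)
  refine ⟨k, ?_⟩
  simp only
  rw [div_eq_iff hK]
  linarith

lemma countable_bad (D : ℂ) (hD : D ≠ 0) (k l x y : ℝ) (h1 : k + l ≠ 0) (h2 : k - l ≠ 0) :
    {t : ℝ | D.re * ((uv (t * k + x)).re + (uv (t * l + y)).re) +
      D.im * ((uv (t * k + x)).im + (uv (t * l + y)).im) = 0}.Countable := by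
  set δ := Complex.arg D
  refine ((countable_cos_zero (k + l) (x + y - 2 * δ) h1).union
    (countable_cos_zero (k - l) (x - y) h2)).mono ?_
  intro t ht
  have ht' : D.re * ((uv (t * k + x)).re + (uv (t * l + y)).re) +
      D.im * ((uv (t * k + x)).im + (uv (t * l + y)).im) = 0 := ht
  simp only [uv_re, uv_im] at ht'
  have r1 : ‖D‖ * Real.cos δ = D.re := Complex.norm_mul_cos_arg D
  have r2 : ‖D‖ * Real.sin δ = D.im := Complex.norm_mul_sin_arg D
  rw [← r1, ← r2] at ht'
  have hn : ‖D‖ ≠ 0 := norm_ne_zero_iff.mpr hD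
  have e : ‖D‖ * (Real.cos (t * k + x - δ) + Real.cos (t * l + y - δ)) = 0 := by
    rw [Real.cos_sub, Real.cos_sub]; linarith
  have e' := (mul_eq_zero.mp e).resolve_left hn
  rw [Real.cos_add_cos] at e'
  rcases mul_eq_zero.mp e' with e' | e'
  · left
    have : Real.cos ((t * (k + l) + (x + y - 2 * δ)) / 2) = 0 := by
      rw [← (mul_eq_zero.mp e').resolve_left two_ne_zero]
      congr 1; ring
    exact this
  · right
    have : Real.cos ((t * (k - l) + (x - y)) / 2) = 0 := by
      rw [← e']
      congr 1; ring
    exact this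

/-- Every (finite) graph admits a smooth 2-Lombardi drawing; moreover, the
vertices may be placed at any prescribed distinct positions. -/
theorem every_graph_has_smooth_two_lombardi
    {V : Type*} [Fintype V] (G : SimpleGraph V)
    (pos : V → ℂ) (hpos : Function.Injective pos) :
    ∃ D : GraphDrawing V G, D.pos = pos ∧ D.KArc 2 ∧ D.Smooth ∧ D.PerfectRes := by
  classical
  let k : V → ℕ := fun v => (Fintype.equivFin V v : ℕ)
  have hk : Function.Injective k := fun u v h =>
    (Fintype.equivFin V).injective (Fin.ext h)
  let e : ∀ v : V, {u // G.Adj v u} ≃ Fin (Nat.card {u // G.Adj v u}) :=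
    fun v => Finite.equivFin _
  -- offset of the direction of the edge `v u` at `v`
  let x : V → V → ℝ := fun v u => if h : G.Adj v u then
    2 * Real.pi * ((e v ⟨u, h⟩ : Fin _) : ℕ) / (Nat.card {u // G.Adj v u}) else 0
  have hcount : (⋃ u : V, ⋃ v : V, ⋃ _ : k u < k v,
      {t : ℝ | (pos v - pos u).re *
          ((uv (t * (k u : ℝ) + x u v)).re + (uv (t * (k v : ℝ) + x v u)).re) +
        (pos v - pos u).im *
          ((uv (t * (k u : ℝ) + x u v)).im + (uv (t * (k v : ℝ) + x v u)).im) = 0}).Countable := by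
    refine Set.countable_iUnion fun u => Set.countable_iUnion fun v =>
      Set.countable_iUnion fun h => ?_
    have hr : (k u : ℝ) < k v := by exact_mod_cast h
    have h0 : (0 : ℝ) ≤ k u := Nat.cast_nonneg _
    apply countable_bad
    · rw [sub_ne_zero]
      intro e
      rw [hpos e] at h
      exact lt_irrefl _ h
    · linarith
    · linarith
  obtain ⟨t, ht⟩ := (hcount.dense_compl ℝ).nonempty
  simp only [Set.mem_compl_iff, Set.mem_iUnion, not_exists] at ht
  let dir : V → V → ℝ := fun v u => t * (k v : ℝ) + x v u
  have hex : ∀ u v : V, k u < k v → ∃ γ, GoodCurve γ (pos u) (pos v) (uv (dir u v))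
      (-uv (dir v u)) (Set.range pos) := by
    intro u v huv
    have e0 : uv (dir v u + Real.pi) = -uv (dir v u) := by rw [uv_add, uv_pi]; ring
    rw [← e0]
    apply exists_goodCurve _ _ _ _ _ _ (Set.finite_range pos)
    rw [e0, Complex.neg_re, Complex.neg_im, sub_neg_eq_add, sub_neg_eq_add]
    exact ht u v huv
  choose! Γ hΓ using hex
  let C : V → V → ℝ → ℂ := fun u v s => if k u < k v then Γ u v s else Γ v u (1 - s)
  have hC : ∀ u v : V, G.Adj u v → GoodCurve (C u v) (pos u) (pos v) (uv (dir u v))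
      (-uv (dir v u)) (Set.range pos) := by
    intro u v h
    by_cases c : k u < k v
    · have : C u v = Γ u v := by funext s; exact if_pos c
      rw [this]; exact hΓ u v c
    · have c' : k v < k u := lt_of_le_of_ne (not_lt.mp c) (fun e => h.ne (hk e).symm)
      have : C u v = fun s => Γ v u (1 - s) := by funext s; exact if_neg c
      rw [this]
      have := (hΓ v u c').reverse
      rwa [neg_neg] at this
  refine ⟨{ pos := pos
            inj := hpos
            curve := fun u v _ => C u v
            cont := fun u v h => (hC u v h).smooth.1.continuousOn
            source_eq := ?_
            target_eq := ?_
            symm := ?_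
            simple := ?_
            vertexFree := ?_ }, rfl, ?_, ?_, ?_⟩
  · intro u v h
    obtain ⟨γ', h1, h2, h3, h4, h6, h7, h8, h9, -⟩ := hC u v h
    exact h6
  · intro u v h
    obtain ⟨γ', h1, h2, h3, h4, h6, h7, h8, h9, -⟩ := hC u v h
    exact h7
  · intro u v h s
    rcases lt_or_gt_of_ne (fun e => h.ne (hk e) : k u ≠ k v) with c | c
    · simp only [C, if_pos c, if_neg (lt_asymm c)]
    · simp only [C, if_pos c, if_neg (lt_asymm c), sub_sub_cancel]
  · intro u v h
    obtain ⟨γ', h1, h2, h3, h4, h6, h7, h8, h9, -⟩ := hC u v h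
    exact h8
  · intro u v h w hw
    obtain ⟨γ', h1, h2, h3, h4, h6, h7, h8, h9, -⟩ := hC u v h
    rcases h9 _ ⟨w, rfl⟩ hw with c | c
    · exact Or.inl (hpos c)
    · exact Or.inr (hpos c)
  · intro u v h
    exact (hC u v h).polyArc
  · intro u v h
    exact (hC u v h).smooth
  · intro v
    refine ⟨t * (k v : ℝ), e v, fun u h => ?_⟩
    obtain ⟨γ', h1, h2, h3, ⟨L, hL, h4, -⟩, -⟩ := hC v u h
    refine ⟨γ' 0, h3 0, (h1 0).hasDerivWithinAt, ?_⟩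
    rw [h4, dirAngle_uv _ _ hL]
    simp only [dir, x, dif_pos h]
end
end

section
/- Let C be a circle and P a set of n points on C, and let n₁, n₂, n₃, n₄ be nonnegative integers summing to n satisfying ⌊n/4⌋ ≤ nᵢ ≤ ⌈n/4⌉ and ⌊n/2⌋ ≤ nᵢ + n_{(i+1) mod 4} ≤ ⌈n/2⌉ for all i. Then there exist two circles A and B, each disjoint from P, such that A, B, and C are pairwise perpendicular and the four arcs of C determined by the intersections with A and B contain exactly n₁, n₂, n₃, n₄ points of P in cyclic order. -/
open Metric
set_option linter.unusedVariables false
set_option linter.unusedTactic false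
set_option linter.unreachableTactic false
set_option linter.unusedSimpArgs false

namespace PerpSplit
open Real

/-- Defect of harmonicity of the four points with angles `a, b, c, d`. -/
noncomputable def EE (a b c d : ℝ) : ℝ :=
  cos ((c - a) / 2) * cos ((d - b) / 2) - cos ((a + c - b - d) / 2)

lemma EE_eq (a b c d : ℝ) : EE a b c d =
    sin ((b - a) / 2) * sin ((d - c) / 2) - sin ((c - b) / 2) * sin ((d - a) / 2) := by
  unfold EE
  have e1 : (c - a) / 2 = c / 2 - a / 2 := by ring
  have e2 : (d - b) / 2 = d / 2 - b / 2 := by ring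
  have e3 : (a + c - b - d) / 2 = (a / 2 + c / 2) - (b / 2 + d / 2) := by ring
  have e4 : (b - a) / 2 = b / 2 - a / 2 := by ring
  have e5 : (d - c) / 2 = d / 2 - c / 2 := by ring
  have e6 : (c - b) / 2 = c / 2 - b / 2 := by ring
  have e7 : (d - a) / 2 = d / 2 - a / 2 := by ring
  rw [e1, e2, e3, e4, e5, e6, e7]
  simp only [cos_sub, sin_sub, cos_add, sin_add]
  ring

lemma EE_shift (a b c d : ℝ) : EE b c d (a + 2 * π) = - EE a b c d := by
  unfold EE
  have e1 : (a + 2 * π - c) / 2 = π - (c - a) / 2 := by ring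
  have e2 : (b + d - c - (a + 2 * π)) / 2 = - ((a + c - b - d) / 2 + π) := by ring
  rw [e1, e2, cos_neg, cos_add_pi, cos_pi_sub]
  ring

lemma EE_a (a a' b c d : ℝ) :
    EE a' b c d * sin ((b - a) / 2) - EE a b c d * sin ((b - a') / 2)
      = - (sin ((c - b) / 2) * sin ((a' - a) / 2) * sin ((d - b) / 2)) := by
  rw [EE_eq, EE_eq]
  have e4 : (b - a) / 2 = b / 2 - a / 2 := by ring
  have e4' : (b - a') / 2 = b / 2 - a' / 2 := by ring
  have e5 : (d - a') / 2 = d / 2 - a' / 2 := by ring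
  have e7 : (d - a) / 2 = d / 2 - a / 2 := by ring
  have e8 : (a' - a) / 2 = a' / 2 - a / 2 := by ring
  have e9 : (d - b) / 2 = d / 2 - b / 2 := by ring
  have key : sin ((d - a') / 2) * sin ((b - a) / 2) - sin ((d - a) / 2) * sin ((b - a') / 2)
      = sin ((a' - a) / 2) * sin ((d - b) / 2) := by
    rw [e4, e4', e5, e7, e8, e9]
    simp only [sin_sub]
    have h1 := sin_sq_add_cos_sq (a / 2)
    ring
  linear_combination (-sin ((c - b) / 2)) * key

lemma sh {x : ℝ} (h0 : 0 < x) (h1 : x < 2 * π) : 0 < sin (x / 2) :=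
  sin_pos_of_pos_of_lt_pi (by linarith) (by linarith)

lemma sh0 {x : ℝ} (h0 : 0 ≤ x) (h1 : x ≤ 2 * π) : 0 ≤ sin (x / 2) :=
  sin_nonneg_of_nonneg_of_le_pi (by linarith) (by linarith)

/-- Moving `a` forward makes `EE` (weakly nonpositive) strictly negative. -/
lemma mono_a {a a' b c d : ℝ} (haa : a < a') (hab : a' ≤ b) (hbc : b < c) (hcd : c < d)
    (hda : d ≤ a + 2 * π) (h : EE a b c d ≤ 0) : EE a' b c d < 0 := by
  have key := EE_a a a' b c d
  have s1 : 0 < sin ((b - a) / 2) := sh (by linarith) (by linarith)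
  have s2 : 0 ≤ sin ((b - a') / 2) := sh0 (by linarith) (by linarith)
  have s3 : 0 < sin ((c - b) / 2) := sh (by linarith) (by linarith)
  have s4 : 0 < sin ((a' - a) / 2) := sh (by linarith) (by linarith)
  have s5 : 0 < sin ((d - b) / 2) := sh (by linarith) (by linarith)
  have s6 := mul_pos (mul_pos s3 s4) s5
  have s7 := mul_nonneg (neg_nonneg.2 h) s2
  by_contra hc
  have s8 := mul_nonneg (not_lt.1 hc) s1.le
  linarith

lemma mono_a' {a a' b c d : ℝ} (haa : a < a') (hab : a' ≤ b) (hbc : b < c) (hcd : c < d)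
    (hda : d ≤ a + 2 * π) (h : 0 ≤ EE a' b c d) : 0 < EE a b c d := by
  by_contra hc
  exact absurd (mono_a haa hab hbc hcd hda (not_lt.1 hc)) (not_lt.2 h)

lemma EE_shift2 (a b c d : ℝ) : EE c d (a + 2 * π) (b + 2 * π) = EE a b c d := by
  rw [EE_shift, EE_shift, neg_neg]

lemma EE_shift3 (a b c d : ℝ) : EE d (a + 2 * π) (b + 2 * π) (c + 2 * π) = - EE a b c d := by
  rw [EE_shift, EE_shift2]

section
variable {a b c d : ℝ}

lemma a_down {x : ℝ} (hab : a < b) (hbc : b < c) (hcd : c < d) (hda : d < a + 2 * π)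
    (hE : EE a b c d = 0) (h : x < a) (h' : d < x + 2 * π) : 0 < EE x b c d :=
  mono_a' h hab.le hbc hcd h'.le hE.ge

lemma a_up {x : ℝ} (hab : a < b) (hbc : b < c) (hcd : c < d) (hda : d < a + 2 * π)
    (hE : EE a b c d = 0) (h : a < x) (h' : x < b) : EE x b c d < 0 :=
  mono_a h h'.le hbc hcd hda.le hE.le

lemma b_down {x : ℝ} (hab : a < b) (hbc : b < c) (hcd : c < d) (hda : d < a + 2 * π)
    (hE : EE a b c d = 0) (h : x < b) (h' : a < x) : EE a x c d < 0 := by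
  have := a_down (x := x) hbc hcd hda (by linarith) (by rw [EE_shift, hE, neg_zero]) h (by linarith)
  rw [EE_shift] at this; linarith

lemma b_up {x : ℝ} (hab : a < b) (hbc : b < c) (hcd : c < d) (hda : d < a + 2 * π)
    (hE : EE a b c d = 0) (h : b < x) (h' : x < c) : 0 < EE a x c d := by
  have := a_up (x := x) hbc hcd hda (by linarith) (by rw [EE_shift, hE, neg_zero]) h (by linarith)
  rw [EE_shift] at this; linarith

lemma c_down {x : ℝ} (hab : a < b) (hbc : b < c) (hcd : c < d) (hda : d < a + 2 * π)
    (hE : EE a b c d = 0) (h : x < c) (h' : b < x) : 0 < EE a b x d := by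
  have := a_down (x := x) hcd hda (by linarith : a + 2 * π < b + 2 * π) (by linarith)
    (by rw [EE_shift2, hE]) h (by linarith)
  rwa [EE_shift2] at this

lemma c_up {x : ℝ} (hab : a < b) (hbc : b < c) (hcd : c < d) (hda : d < a + 2 * π)
    (hE : EE a b c d = 0) (h : c < x) (h' : x < d) : EE a b x d < 0 := by
  have := a_up (x := x) hcd hda (by linarith : a + 2 * π < b + 2 * π) (by linarith)
    (by rw [EE_shift2, hE]) h (by linarith)
  rwa [EE_shift2] at this

lemma d_down {x : ℝ} (hab : a < b) (hbc : b < c) (hcd : c < d) (hda : d < a + 2 * π)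
    (hE : EE a b c d = 0) (h : x < d) (h' : c < x) : EE a b c x < 0 := by
  have := a_down (x := x) hda (by linarith : a + 2 * π < b + 2 * π)
    (by linarith : b + 2 * π < c + 2 * π) (by linarith)
    (by rw [EE_shift3, hE, neg_zero]) h (by linarith)
  rw [EE_shift3] at this; linarith

lemma d_up {x : ℝ} (hab : a < b) (hbc : b < c) (hcd : c < d) (hda : d < a + 2 * π)
    (hE : EE a b c d = 0) (h : d < x) (h' : x < a + 2 * π) : 0 < EE a b c x := by
  have := a_up (x := x) hda (by linarith : a + 2 * π < b + 2 * π)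
    (by linarith : b + 2 * π < c + 2 * π) (by linarith)
    (by rw [EE_shift3, hE, neg_zero]) h h'
  rw [EE_shift3] at this; linarith
end

lemma pair {l1 u1 l3 u3 a c : ℝ} (h1 : l1 < u1) (h3 : l3 < u3) (ha : l1 ≤ a) (ha' : a ≤ u1)
    (hc : l3 ≤ c) (hc' : c ≤ u3) (hf : c - a ≤ π) (H : c - a < π ∨ a < u1 ∨ l3 < c) :
    ∃ a' c', l1 < a' ∧ a' < u1 ∧ l3 < c' ∧ c' < u3 ∧ c' - a' < π := by
  have : l3 - u1 < π := by
    rcases H with H | H | H <;> linarith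
  obtain ⟨t, ht, ht'⟩ := exists_between this
  obtain ⟨a', ha1, ha2⟩ := exists_between (max_lt h1 (by linarith : u1 - (t - (l3 - u1)) / 2 < u1))
  obtain ⟨c', hc1, hc2⟩ := exists_between (lt_min h3 (by linarith : l3 < l3 + (t - (l3 - u1)) / 2))
  refine ⟨a', c', lt_of_le_of_lt (le_max_left _ _) ha1, ha2, hc1,
    lt_of_lt_of_le hc2 (min_le_left _ _), ?_⟩
  have := lt_of_le_of_lt (le_max_right _ _) ha1
  have := lt_of_lt_of_le hc2 (min_le_right _ _)
  linarith

/-- The open polytope of admissible cuts. -/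
def U (l1 u1 l2 u2 l3 u3 l4 u4 a b c d : ℝ) : Prop :=
  (l1 < a ∧ a < u1) ∧ (l2 < b ∧ b < u2) ∧ (l3 < c ∧ c < u3) ∧ (l4 < d ∧ d < u4) ∧
  (a < b ∧ b < c ∧ c < d ∧ d < a + 2 * π) ∧ c - a < π ∧ d - b < π

lemma conv_lt {p q s x y : ℝ} (hs : 0 < s) (hs1 : s ≤ 1) (h : p ≤ x) (h' : q < y) :
    (1 - s) * p + s * q < (1 - s) * x + s * y := by
  have := mul_le_mul_of_nonneg_left h (by linarith : 0 ≤ 1 - s)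
  have := mul_lt_mul_of_pos_left h' hs
  linarith

lemma conv_lt_l {q s x y : ℝ} (hs : 0 < s) (hs1 : s ≤ 1) (h : q ≤ x) (h' : q < y) :
    q < (1 - s) * x + s * y := by
  have := conv_lt hs hs1 h h'
  linarith

lemma conv_lt_r {q s x y : ℝ} (hs : 0 < s) (hs1 : s ≤ 1) (h : x ≤ q) (h' : y < q) :
    (1 - s) * x + s * y < q := by
  have := conv_lt hs hs1 h h'
  linarith

lemma push {l1 u1 l2 u2 l3 u3 l4 u4 a b c d a' b' c' d' σ : ℝ}
    (ha : l1 ≤ a) (ha' : a ≤ u1) (hb : l2 ≤ b) (hb' : b ≤ u2)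
    (hc : l3 ≤ c) (hc' : c ≤ u3) (hd : l4 ≤ d) (hd' : d ≤ u4)
    (hab : a < b) (hbc : b < c) (hcd : c < d) (hda : d < a + 2 * π)
    (hf : c - a ≤ π) (hh : d - b ≤ π) (hE : 0 < σ * EE a b c d)
    (ka : l1 < a') (ka' : a' < u1) (kb : l2 < b') (kb' : b' < u2)
    (kc : l3 < c') (kc' : c' < u3) (kd : l4 < d') (kd' : d' < u4)
    (kf : c' - a' < π) (kh : d' - b' < π) :
    ∃ x y z w, U l1 u1 l2 u2 l3 u3 l4 u4 x y z w ∧ 0 < σ * EE x y z w := by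
  let A : ℝ → ℝ := fun s => (1 - s) * a + s * a'
  let B : ℝ → ℝ := fun s => (1 - s) * b + s * b'
  let C : ℝ → ℝ := fun s => (1 - s) * c + s * c'
  let D : ℝ → ℝ := fun s => (1 - s) * d + s * d'
  have cA : Continuous A := by fun_prop
  have cB : Continuous B := by fun_prop
  have cC : Continuous C := by fun_prop
  have cD : Continuous D := by fun_prop
  have A0 : A 0 = a := by simp [A]
  have B0 : B 0 = b := by simp [B]
  have C0 : C 0 = c := by simp [C]
  have D0 : D 0 = d := by simp [D]
  have e1 : ∀ᶠ s in nhds (0 : ℝ), A s < B s :=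
    cA.continuousAt.eventually_lt cB.continuousAt (by rw [A0, B0]; exact hab)
  have e2 : ∀ᶠ s in nhds (0 : ℝ), B s < C s :=
    cB.continuousAt.eventually_lt cC.continuousAt (by rw [C0, B0]; exact hbc)
  have e3 : ∀ᶠ s in nhds (0 : ℝ), C s < D s :=
    cC.continuousAt.eventually_lt cD.continuousAt (by rw [C0, D0]; exact hcd)
  have e4 : ∀ᶠ s in nhds (0 : ℝ), D s < A s + 2 * π :=
    cD.continuousAt.eventually_lt (cA.add continuous_const).continuousAt
      (by rw [A0, D0]; exact hda)
  have cE : Continuous fun s => σ * EE (A s) (B s) (C s) (D s) := by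
    unfold EE; fun_prop
  have e5 : ∀ᶠ s in nhds (0 : ℝ), 0 < σ * EE (A s) (B s) (C s) (D s) :=
    (continuous_const (y := (0:ℝ))).continuousAt.eventually_lt cE.continuousAt
      (by rw [A0, B0, C0, D0]; exact hE)
  have e6 := (e1.and (e2.and (e3.and (e4.and e5))))
  rw [Metric.eventually_nhds_iff] at e6
  obtain ⟨ε, hε, H⟩ := e6
  set s := min (ε / 2) 1 with hs
  have s0 : 0 < s := lt_min (by linarith) one_pos
  have s1 : s ≤ 1 := min_le_right _ _
  have s2 : s ≤ ε / 2 := min_le_left _ _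
  obtain ⟨h1, h2, h3, h4, h5⟩ := H (y := s) (by rw [Real.dist_eq, sub_zero, abs_of_pos s0]; linarith)
  refine ⟨A s, B s, C s, D s, ⟨⟨conv_lt_l s0 s1 ha ka, conv_lt_r s0 s1 ha' ka'⟩,
    ⟨conv_lt_l s0 s1 hb kb, conv_lt_r s0 s1 hb' kb'⟩,
    ⟨conv_lt_l s0 s1 hc kc, conv_lt_r s0 s1 hc' kc'⟩,
    ⟨conv_lt_l s0 s1 hd kd, conv_lt_r s0 s1 hd' kd'⟩, ⟨h1, h2, h3, h4⟩, ?_, ?_⟩, h5⟩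
  · have := conv_lt_r s0 s1 hf kf
    simp only [A, C]; linarith
  · have := conv_lt_r s0 s1 hh kh
    simp only [B, D]; linarith

lemma join {l1 u1 l2 u2 l3 u3 l4 u4 x y z w x' y' z' w' : ℝ}
    (h : U l1 u1 l2 u2 l3 u3 l4 u4 x y z w) (h' : U l1 u1 l2 u2 l3 u3 l4 u4 x' y' z' w')
    (hE : EE x y z w < 0) (hE' : 0 < EE x' y' z' w') :
    ∃ a b c d, U l1 u1 l2 u2 l3 u3 l4 u4 a b c d ∧ EE a b c d = 0 := by
  have cE : Continuous fun s : ℝ => EE ((1 - s) * x + s * x') ((1 - s) * y + s * y')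
      ((1 - s) * z + s * z') ((1 - s) * w + s * w') := by
    unfold EE; fun_prop
  have := intermediate_value_Icc (zero_le_one (α := ℝ)) cE.continuousOn
  obtain ⟨s, ⟨hs0, hs1⟩, hs⟩ := this (show (0 : ℝ) ∈ _ by constructor <;> simp <;> linarith)
  have hs : EE ((1 - s) * x + s * x') ((1 - s) * y + s * y')
      ((1 - s) * z + s * z') ((1 - s) * w + s * w') = 0 := hs
  rcases hs0.eq_or_lt with rfl | hs0
  · simp at hs; linarith
  refine ⟨_, _, _, _, ?_, hs⟩
  obtain ⟨⟨p1, p2⟩, ⟨p3, p4⟩, ⟨p5, p6⟩, ⟨p7, p8⟩, ⟨p9, p10, p11, p12⟩, p13, p14⟩ := h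
  obtain ⟨⟨q1, q2⟩, ⟨q3, q4⟩, ⟨q5, q6⟩, ⟨q7, q8⟩, ⟨q9, q10, q11, q12⟩, q13, q14⟩ := h'
  refine ⟨⟨conv_lt_l hs0 hs1 p1.le q1, conv_lt_r hs0 hs1 p2.le q2⟩,
    ⟨conv_lt_l hs0 hs1 p3.le q3, conv_lt_r hs0 hs1 p4.le q4⟩,
    ⟨conv_lt_l hs0 hs1 p5.le q5, conv_lt_r hs0 hs1 p6.le q6⟩,
    ⟨conv_lt_l hs0 hs1 p7.le q7, conv_lt_r hs0 hs1 p8.le q8⟩,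
    ⟨conv_lt hs0 hs1 p9.le q9, conv_lt hs0 hs1 p10.le q10, conv_lt hs0 hs1 p11.le q11, ?_⟩, ?_, ?_⟩
  · have := conv_lt hs0 hs1 p12.le q12
    linarith
  · have := conv_lt_r hs0 hs1 p13.le q13
    linarith
  · have := conv_lt_r hs0 hs1 p14.le q14
    linarith

lemma core {l1 u1 l2 u2 l3 u3 l4 u4 a b c d : ℝ}
    (h1 : l1 < u1) (h2 : l2 < u2) (h3 : l3 < u3) (h4 : l4 < u4)
    (ha : l1 ≤ a) (ha' : a ≤ u1) (hb : l2 ≤ b) (hb' : b ≤ u2)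
    (hc : l3 ≤ c) (hc' : c ≤ u3) (hd : l4 ≤ d) (hd' : d ≤ u4)
    (hab : a < b) (hbc : b < c) (hcd : c < d) (hda : d < a + 2 * π)
    (hf : c - a ≤ π) (hh : d - b ≤ π) (hE : EE a b c d = 0)
    (i1 : c - a < π ∨ a < u1 ∨ l3 < c) (i2 : d - b < π ∨ b < u2 ∨ l4 < d)
    (X : l3 < c ∨ b < u2 ∨ (l1 < a ∧ c - a < π) ∨ (d < u4 ∧ d - b < π))
    (Y : a < u1 ∨ l4 < d ∨ (c < u3 ∧ c - a < π) ∨ (l2 < b ∧ d - b < π)) :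
    ∃ a b c d, U l1 u1 l2 u2 l3 u3 l4 u4 a b c d ∧ EE a b c d = 0 := by
  obtain ⟨a', c', ka, ka', kc, kc', kf⟩ := pair h1 h3 ha ha' hc hc' hf i1
  obtain ⟨b', d', kb, kb', kd, kd', kh⟩ := pair h2 h4 hb hb' hd hd' hh i2
  have hx : ∃ x y z w, U l1 u1 l2 u2 l3 u3 l4 u4 x y z w ∧ 0 < (1 : ℝ) * EE x y z w := by
    rcases X with X | X | ⟨X, X'⟩ | ⟨X, X'⟩
    · obtain ⟨t, ht, ht'⟩ := exists_between (max_lt X hbc)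
      obtain ⟨t1, t2⟩ := max_lt_iff.1 ht
      exact push ha ha' hb hb' t1.le (by linarith) hd hd' hab t2 (by linarith) hda (by linarith)
        hh (by rw [one_mul]; exact c_down hab hbc hcd hda hE ht' t2) ka ka' kb kb' kc kc' kd kd' kf kh
    · obtain ⟨t, ht, ht'⟩ := exists_between (lt_min X hbc)
      obtain ⟨t1, t2⟩ := lt_min_iff.1 ht'
      exact push ha ha' (by linarith) t1.le hc hc' hd hd' (by linarith) t2 hcd hda hf
        (by linarith) (by rw [one_mul]; exact b_up hab hbc hcd hda hE ht t2)
        ka ka' kb kb' kc kc' kd kd' kf kh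
    · obtain ⟨t, ht, ht'⟩ := exists_between
        (max_lt (max_lt X (by linarith : c - π < a)) (by linarith : d - 2 * π < a))
      obtain ⟨t1, t2⟩ := max_lt_iff.1 ht
      obtain ⟨t1, t3⟩ := max_lt_iff.1 t1
      exact push t1.le (by linarith) hb hb' hc hc' hd hd' (by linarith) hbc hcd (by linarith)
        (by linarith) hh (by rw [one_mul]; exact a_down hab hbc hcd hda hE ht' (by linarith))
        ka ka' kb kb' kc kc' kd kd' kf kh
    · obtain ⟨t, ht, ht'⟩ := exists_between
        (lt_min (lt_min X (by linarith : d < b + π)) hda)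
      obtain ⟨t1, t2⟩ := lt_min_iff.1 ht'
      obtain ⟨t1, t3⟩ := lt_min_iff.1 t1
      exact push ha ha' hb hb' hc hc' (by linarith) t1.le hab hbc (by linarith) t2
        hf (by linarith) (by rw [one_mul]; exact d_up hab hbc hcd hda hE ht t2)
        ka ka' kb kb' kc kc' kd kd' kf kh
  have hy : ∃ x y z w, U l1 u1 l2 u2 l3 u3 l4 u4 x y z w ∧ 0 < (-1 : ℝ) * EE x y z w := by
    rcases Y with X | X | ⟨X, X'⟩ | ⟨X, X'⟩
    · obtain ⟨t, ht, ht'⟩ := exists_between (lt_min X hab)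
      obtain ⟨t1, t2⟩ := lt_min_iff.1 ht'
      have := a_up hab hbc hcd hda hE ht t2
      exact push (by linarith) t1.le hb hb' hc hc' hd hd' t2 hbc hcd (by linarith) (by linarith)
        hh (by linarith) ka ka' kb kb' kc kc' kd kd' kf kh
    · obtain ⟨t, ht, ht'⟩ := exists_between (max_lt X hcd)
      obtain ⟨t1, t2⟩ := max_lt_iff.1 ht
      have := d_down hab hbc hcd hda hE ht' t2
      exact push ha ha' hb hb' hc hc' t1.le (by linarith) hab hbc t2 (by linarith) hf
        (by linarith) (by linarith) ka ka' kb kb' kc kc' kd kd' kf kh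
    · obtain ⟨t, ht, ht'⟩ := exists_between
        (lt_min (lt_min X (by linarith : c < a + π)) hcd)
      obtain ⟨t1, t2⟩ := lt_min_iff.1 ht'
      obtain ⟨t1, t3⟩ := lt_min_iff.1 t1
      have := c_up hab hbc hcd hda hE ht t2
      exact push ha ha' hb hb' (by linarith) t1.le hd hd' hab (by linarith) t2 hda
        (by linarith) hh (by linarith) ka ka' kb kb' kc kc' kd kd' kf kh
    · obtain ⟨t, ht, ht'⟩ := exists_between
        (max_lt (max_lt X (by linarith : d - π < b)) hab)
      obtain ⟨t1, t2⟩ := max_lt_iff.1 ht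
      obtain ⟨t1, t3⟩ := max_lt_iff.1 t1
      have := b_down hab hbc hcd hda hE ht' t2
      exact push ha ha' t1.le (by linarith) hc hc' hd hd' t2 (by linarith) hcd hda
        hf (by linarith) (by linarith) ka ka' kb kb' kc kc' kd kd' kf kh
  obtain ⟨x, y, z, w, hU, hp⟩ := hx
  obtain ⟨x', y', z', w', hU', hp'⟩ := hy
  exact join hU' hU (by linarith) (by linarith)

end PerpSplit

namespace PerpSplit
open Real

/-- `x` lies between the marks: `s` is the largest index with `θ s < x`, `t` the smallest with
`x < θ t`. -/
def Loc (θ : ℤ → ℝ) (x : ℝ) (s t : ℤ) : Prop :=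
  (∀ g ≤ s, θ g < x) ∧ (∀ g < t, θ g ≤ x) ∧ (∀ g ≥ t, x < θ g) ∧ (∀ g > s, x ≤ θ g)

lemma Loc.pt {θ : ℤ → ℝ} (hθ : StrictMono θ) (i : ℤ) : Loc θ (θ i) (i - 1) (i + 1) :=
  ⟨fun g hg => hθ (by omega), fun g hg => hθ.monotone (by omega), fun g hg => hθ (by omega),
    fun g hg => hθ.monotone (by omega)⟩

lemma Loc.mid {θ : ℤ → ℝ} (hθ : StrictMono θ) {i : ℤ} {x : ℝ} (h : θ i < x) (h' : x < θ (i + 1)) :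
    Loc θ x i (i + 1) :=
  ⟨fun g hg => lt_of_le_of_lt (hθ.monotone hg) h,
   fun g hg => (lt_of_le_of_lt (hθ.monotone (by omega)) h).le,
   fun g hg => lt_of_lt_of_le h' (hθ.monotone hg),
   fun g hg => (lt_of_lt_of_le h' (hθ.monotone (by omega))).le⟩

lemma Loc.shift {θ : ℤ → ℝ} {n : ℤ} (hper : ∀ j, θ (j + n) = θ j + 2 * π) {x : ℝ} {s t : ℤ}
    (h : Loc θ x s t) : Loc θ (x + 2 * π) (s + n) (t + n) := by
  have key : ∀ g, θ g = θ (g - n) + 2 * π := fun g => by rw [← hper]; congr 1; ring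
  obtain ⟨h1, h2, h3, h4⟩ := h
  refine ⟨fun g hg => ?_, fun g hg => ?_, fun g hg => ?_, fun g hg => ?_⟩ <;> rw [key g]
  · have := h1 (g - n) (by omega); linarith
  · have := h2 (g - n) (by omega); linarith
  · have := h3 (g - n) (by omega); linarith
  · have := h4 (g - n) (by omega); linarith

/-- There is a harmonic quadruple whose cuts are in prescribed gaps. -/
def Sol (θ : ℤ → ℝ) (m1 m2 m3 : ℤ) : Prop :=
  ∃ (g : ℤ) (a b c d : ℝ), U (θ g) (θ (g + 1)) (θ (g + m1)) (θ (g + m1 + 1))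
    (θ (g + m1 + m2)) (θ (g + m1 + m2 + 1)) (θ (g + m1 + m2 + m3)) (θ (g + m1 + m2 + m3 + 1))
    a b c d ∧ EE a b c d = 0

/-- The combinatorial condition. -/
def K (m1 m2 m3 sa ta sb tb sc tc sd td ε η g : ℤ) : Prop :=
  sa ≤ g ∧ g < ta ∧ sb ≤ g + m1 ∧ g + m1 < tb ∧ sc ≤ g + m1 + m2 ∧ g + m1 + m2 < tc ∧
  sd ≤ g + m1 + m2 + m3 ∧ g + m1 + m2 + m3 < td ∧
  (ε ≠ 1 ∨ ta ≤ g + 1 ∨ g + m1 + m2 ≤ sc) ∧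
  (η ≠ 1 ∨ tb ≤ g + m1 + 1 ∨ g + m1 + m2 + m3 ≤ sd) ∧
  (g + m1 + m2 ≤ sc ∨ tb ≤ g + m1 + 1 ∨ (g ≤ sa ∧ ε ≠ 1) ∨
    (td ≤ g + m1 + m2 + m3 + 1 ∧ η ≠ 1)) ∧
  (ta ≤ g + 1 ∨ g + m1 + m2 + m3 ≤ sd ∨ (tc ≤ g + m1 + m2 + 1 ∧ ε ≠ 1) ∨
    (g + m1 ≤ sb ∧ η ≠ 1))

lemma solInt {θ : ℤ → ℝ} (hθ : StrictMono θ) {a b c d : ℝ} {sa ta sb tb sc tc sd td : ℤ}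
    (ha : Loc θ a sa ta) (hb : Loc θ b sb tb) (hc : Loc θ c sc tc) (hd : Loc θ d sd td)
    (hab : a < b) (hbc : b < c) (hcd : c < d) (hda : d < a + 2 * π) (hE : EE a b c d = 0)
    {ε η : ℤ} (hf : c - a < π ∨ (c - a = π ∧ ε = 1)) (hh : d - b < π ∨ (d - b = π ∧ η = 1))
    {m1 m2 m3 : ℤ} (hK : ∃ g, K m1 m2 m3 sa ta sb tb sc tc sd td ε η g) : Sol θ m1 m2 m3 := by
  obtain ⟨g, k1, k2, k3, k4, k5, k6, k7, k8, k9, k10, k11, k12⟩ := hK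
  obtain ⟨a1, a2, a3, a4⟩ := ha
  obtain ⟨b1, b2, b3, b4⟩ := hb
  obtain ⟨c1, c2, c3, c4⟩ := hc
  obtain ⟨d1, d2, d3, d4⟩ := hd
  have ff : ε ≠ 1 → c - a < π := fun h => hf.resolve_right fun h' => h h'.2
  have fh : η ≠ 1 → d - b < π := fun h => hh.resolve_right fun h' => h h'.2
  have hf' : c - a ≤ π := by rcases hf with h | h <;> linarith [h]
  have hh' : d - b ≤ π := by rcases hh with h | h <;> linarith [h]
  refine ⟨g, core (hθ (by omega)) (hθ (by omega)) (hθ (by omega)) (hθ (by omega))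
    (a2 _ (by omega)) (a4 _ (by omega)) (b2 _ (by omega)) (b4 _ (by omega))
    (c2 _ (by omega)) (c4 _ (by omega)) (d2 _ (by omega)) (d4 _ (by omega))
    hab hbc hcd hda hf' hh' hE ?_ ?_ ?_ ?_⟩
  · exact k9.imp ff (Or.imp (fun h => a3 _ (by omega)) (fun h => c1 _ (by omega)))
  · exact k10.imp fh (Or.imp (fun h => b3 _ (by omega)) (fun h => d1 _ (by omega)))
  · exact k11.imp (fun h => c1 _ (by omega)) (Or.imp (fun h => b3 _ (by omega))
      (Or.imp (fun h => ⟨a1 _ (by omega), ff h.2⟩) (fun h => ⟨d3 _ (by omega), fh h.2⟩)))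
  · exact k12.imp (fun h => a3 _ (by omega)) (Or.imp (fun h => d1 _ (by omega))
      (Or.imp (fun h => ⟨c3 _ (by omega), ff h.2⟩) (fun h => ⟨b1 _ (by omega), fh h.2⟩)))

/-- Given a closed harmonic quadruple, one of its four relabellings can be perturbed. -/
lemma comb {θ : ℤ → ℝ} (hθ : StrictMono θ) {n : ℤ} (hper : ∀ j, θ (j + n) = θ j + 2 * π)
    {x0 x1 x2 x3 : ℝ} {s0 t0 s1 t1 s2 t2 s3 t3 : ℤ}
    (h0 : Loc θ x0 s0 t0) (h1 : Loc θ x1 s1 t1) (h2 : Loc θ x2 s2 t2) (h3 : Loc θ x3 s3 t3)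
    (h01 : x0 < x1) (h12 : x1 < x2) (h23 : x2 < x3) (h30 : x3 < x0 + 2 * π)
    (hE : EE x0 x1 x2 x3 = 0) {m1 m2 m3 : ℤ}
    (A0 : ∃ g, K m1 m2 m3 s0 t0 s1 t1 s2 t2 s3 t3 0 0 g)
    (A1 : ∃ g, K m1 m2 m3 s1 t1 s2 t2 s3 t3 (s0 + n) (t0 + n) 0 0 g)
    (A2 : ∃ g, K m1 m2 m3 s2 t2 s3 t3 (s0 + n) (t0 + n) (s1 + n) (t1 + n) 0 0 g)
    (A3 : ∃ g, K m1 m2 m3 s3 t3 (s0 + n) (t0 + n) (s1 + n) (t1 + n) (s2 + n) (t2 + n) 0 0 g)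
    (B1 : (∃ g, K m1 m2 m3 s0 t0 s1 t1 s2 t2 s3 t3 1 0 g) ∨
      (∃ g, K m1 m2 m3 s1 t1 s2 t2 s3 t3 (s0 + n) (t0 + n) 0 1 g))
    (B2 : (∃ g, K m1 m2 m3 s2 t2 s3 t3 (s0 + n) (t0 + n) (s1 + n) (t1 + n) 1 0 g) ∨
      (∃ g, K m1 m2 m3 s3 t3 (s0 + n) (t0 + n) (s1 + n) (t1 + n) (s2 + n) (t2 + n) 0 1 g))
    (B3 : (∃ g, K m1 m2 m3 s0 t0 s1 t1 s2 t2 s3 t3 0 1 g) ∨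
      (∃ g, K m1 m2 m3 s3 t3 (s0 + n) (t0 + n) (s1 + n) (t1 + n) (s2 + n) (t2 + n) 1 0 g))
    (B4 : (∃ g, K m1 m2 m3 s1 t1 s2 t2 s3 t3 (s0 + n) (t0 + n) 1 0 g) ∨
      (∃ g, K m1 m2 m3 s2 t2 s3 t3 (s0 + n) (t0 + n) (s1 + n) (t1 + n) 0 1 g))
    (C : (∃ g, K m1 m2 m3 s0 t0 s1 t1 s2 t2 s3 t3 1 1 g) ∨
      (∃ g, K m1 m2 m3 s1 t1 s2 t2 s3 t3 (s0 + n) (t0 + n) 1 1 g) ∨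
      (∃ g, K m1 m2 m3 s2 t2 s3 t3 (s0 + n) (t0 + n) (s1 + n) (t1 + n) 1 1 g) ∨
      (∃ g, K m1 m2 m3 s3 t3 (s0 + n) (t0 + n) (s1 + n) (t1 + n) (s2 + n) (t2 + n) 1 1 g)) :
    Sol θ m1 m2 m3 := by
  have h4 := h0.shift hper
  have h5 := h1.shift hper
  have h6 := h2.shift hper
  have E1 : EE x1 x2 x3 (x0 + 2 * π) = 0 := by rw [EE_shift, hE, neg_zero]
  have E2 : EE x2 x3 (x0 + 2 * π) (x1 + 2 * π) = 0 := by rw [EE_shift2, hE]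
  have E3 : EE x3 (x0 + 2 * π) (x1 + 2 * π) (x2 + 2 * π) = 0 := by rw [EE_shift3, hE, neg_zero]
  have L0 := fun ε η => solInt hθ h0 h1 h2 h3 h01 h12 h23 h30 hE (ε := ε) (η := η)
    (m1 := m1) (m2 := m2) (m3 := m3)
  have L1 := fun ε η => solInt hθ h1 h2 h3 h4 h12 h23 h30 (by linarith) E1 (ε := ε) (η := η)
    (m1 := m1) (m2 := m2) (m3 := m3)
  have L2 := fun ε η => solInt hθ h2 h3 h4 h5 h23 h30 (by linarith) (by linarith) E2
    (ε := ε) (η := η) (m1 := m1) (m2 := m2) (m3 := m3)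
  have L3 := fun ε η => solInt hθ h3 h4 h5 h6 h30 (by linarith) (by linarith) (by linarith) E3
    (ε := ε) (η := η) (m1 := m1) (m2 := m2) (m3 := m3)
  rcases lt_trichotomy (x2 - x0) π with f | f | f <;>
    rcases lt_trichotomy (x3 - x1) π with h | h | h
  · exact L0 _ _ (Or.inl f) (Or.inl h) A0
  · rcases B3 with B | B
    · exact L0 _ _ (Or.inl f) (Or.inr ⟨h, rfl⟩) B
    · exact L3 _ _ (Or.inr ⟨by linarith, rfl⟩) (Or.inl (by linarith)) B
  · exact L3 _ _ (Or.inl (by linarith)) (Or.inl (by linarith)) A3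
  · rcases B1 with B | B
    · exact L0 _ _ (Or.inr ⟨f, rfl⟩) (Or.inl h) B
    · exact L1 _ _ (Or.inl (by linarith)) (Or.inr ⟨by linarith, rfl⟩) B
  · rcases C with B | B | B | B
    · exact L0 _ _ (Or.inr ⟨f, rfl⟩) (Or.inr ⟨h, rfl⟩) B
    · exact L1 _ _ (Or.inr ⟨by linarith, rfl⟩) (Or.inr ⟨by linarith, rfl⟩) B
    · exact L2 _ _ (Or.inr ⟨by linarith, rfl⟩) (Or.inr ⟨by linarith, rfl⟩) B
    · exact L3 _ _ (Or.inr ⟨by linarith, rfl⟩) (Or.inr ⟨by linarith, rfl⟩) B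
  · rcases B2 with B | B
    · exact L2 _ _ (Or.inr ⟨by linarith, rfl⟩) (Or.inl (by linarith)) B
    · exact L3 _ _ (Or.inl (by linarith)) (Or.inr ⟨by linarith, rfl⟩) B
  · exact L1 _ _ (Or.inl (by linarith)) (Or.inl (by linarith)) A1
  · rcases B4 with B | B
    · exact L1 _ _ (Or.inr ⟨by linarith, rfl⟩) (Or.inl (by linarith)) B
    · exact L2 _ _ (Or.inl (by linarith)) (Or.inr ⟨by linarith, rfl⟩) B
  · exact L2 _ _ (Or.inl (by linarith)) (Or.inl (by linarith)) A2

/-- Balanced splitting vectors. -/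
def Bal (n m1 m2 m3 m4 : ℤ) : Prop :=
  m1 + m2 + m3 + m4 = n ∧ n / 4 ≤ m1 ∧ m1 ≤ (n + 3) / 4 ∧ n / 4 ≤ m2 ∧ m2 ≤ (n + 3) / 4 ∧
  n / 4 ≤ m3 ∧ m3 ≤ (n + 3) / 4 ∧ n / 4 ≤ m4 ∧ m4 ≤ (n + 3) / 4 ∧
  n / 2 ≤ m1 + m2 ∧ m1 + m2 ≤ (n + 1) / 2 ∧ n / 2 ≤ m2 + m3 ∧ m2 + m3 ≤ (n + 1) / 2

lemma exl {p q : ℤ → Prop} (g : ℤ) (h : p g) : (∃ g, p g) ∨ (∃ g, q g) := Or.inl ⟨g, h⟩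
lemma exr {p q : ℤ → Prop} (g : ℤ) (h : q g) : (∃ g, p g) ∨ (∃ g, q g) := Or.inr ⟨g, h⟩

lemma comb0 {θ : ℤ → ℝ} (hθ : StrictMono θ) {n k j e : ℤ} (hn : n = 4 * k) (he : e = 0 ∨ e = 1) (hk : 0 ≤ k)
    (hper : ∀ j, θ (j + n) = θ j + 2 * π)
    {x0 x1 x2 x3 : ℝ} 
    (h0 : Loc θ x0 (j - e) (j + 1)) (h1 : Loc θ x1 (j + k - e) (j + k + 1))
    (h2 : Loc θ x2 (j + 2 * k - e) (j + 2 * k + 1)) (h3 : Loc θ x3 (j + 3 * k - e) (j + 3 * k + 1))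
    (h01 : x0 < x1) (h12 : x1 < x2) (h23 : x2 < x3) (h30 : x3 < x0 + 2 * π)
    (hE : EE x0 x1 x2 x3 = 0) {m1 m2 m3 m4 : ℤ} (hB : Bal n m1 m2 m3 m4) : Sol θ m1 m2 m3 := by
  obtain ⟨b1, b2, b3, b4, b5, b6, b7, b8, b9, b10, b11, b12, b13⟩ := hB
  have d1 : n / 4 = k := by omega
  have d2 : (n + 3) / 4 = k := by omega
  rw [d1] at *
  rw [d2] at *
  have : m1 = k ∧ m2 = k ∧ m3 = k := by omega
  clear b1 b2 b3 b4 b5 b6 b7 b8 b9 b10 b11 b12 b13 d1 d2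
  apply comb hθ hper h0 h1 h2 h3 h01 h12 h23 h30 hE <;> unfold K <;>
    obtain ⟨e1, e2, e3⟩ := this
  all_goals first
    | ((first
        | exact ⟨j, by omega⟩
        | exact ⟨j + k, by omega⟩
        | exact ⟨j + 2 * k, by omega⟩
        | exact ⟨j + 3 * k, by omega⟩))
    | (left; (first
        | exact ⟨j, by omega⟩
        | exact ⟨j + k, by omega⟩
        | exact ⟨j + 2 * k, by omega⟩
        | exact ⟨j + 3 * k, by omega⟩))
    | (right; (first
        | exact ⟨j, by omega⟩
        | exact ⟨j + k, by omega⟩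
        | exact ⟨j + 2 * k, by omega⟩
        | exact ⟨j + 3 * k, by omega⟩))
    | (right; left; (first
        | exact ⟨j, by omega⟩
        | exact ⟨j + k, by omega⟩
        | exact ⟨j + 2 * k, by omega⟩
        | exact ⟨j + 3 * k, by omega⟩))
    | (right; right; left; (first
        | exact ⟨j, by omega⟩
        | exact ⟨j + k, by omega⟩
        | exact ⟨j + 2 * k, by omega⟩
        | exact ⟨j + 3 * k, by omega⟩))
    | (right; right; right; (first
        | exact ⟨j, by omega⟩
        | exact ⟨j + k, by omega⟩
        | exact ⟨j + 2 * k, by omega⟩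
        | exact ⟨j + 3 * k, by omega⟩))

lemma comb1 {θ : ℤ → ℝ} (hθ : StrictMono θ) {n k j : ℤ} (hn : n = 4 * k + 1) (hk : 0 ≤ k)
    (hper : ∀ j, θ (j + n) = θ j + 2 * π)
    {x0 x1 x2 x3 : ℝ} 
    (h0 : Loc θ x0 j (j + 1)) (h1 : Loc θ x1 (j + k) (j + k + 2))
    (h2 : Loc θ x2 (j + 2 * k) (j + 2 * k + 2)) (h3 : Loc θ x3 (j + 3 * k) (j + 3 * k + 2))
    (h01 : x0 < x1) (h12 : x1 < x2) (h23 : x2 < x3) (h30 : x3 < x0 + 2 * π)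
    (hE : EE x0 x1 x2 x3 = 0) {m1 m2 m3 m4 : ℤ} (hB : Bal n m1 m2 m3 m4) : Sol θ m1 m2 m3 := by
  obtain ⟨b1, b2, b3, b4, b5, b6, b7, b8, b9, b10, b11, b12, b13⟩ := hB
  have d1 : n / 4 = k := by omega
  have d2 : (n + 3) / 4 = k + 1 := by omega
  rw [d1] at *
  rw [d2] at *
  have : (m1 = k + 1 ∧ m2 = k ∧ m3 = k) ∨ (m1 = k ∧ m2 = k + 1 ∧ m3 = k) ∨
      (m1 = k ∧ m2 = k ∧ m3 = k + 1) ∨ (m1 = k ∧ m2 = k ∧ m3 = k) := by omega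
  clear b1 b2 b3 b4 b5 b6 b7 b8 b9 b10 b11 b12 b13 d1 d2
  apply comb hθ hper h0 h1 h2 h3 h01 h12 h23 h30 hE <;> unfold K <;>
    rcases this with ⟨e1, e2, e3⟩ | ⟨e1, e2, e3⟩ | ⟨e1, e2, e3⟩ | ⟨e1, e2, e3⟩
  all_goals first
    | ((first
        | exact ⟨j, by omega⟩
        | exact ⟨j + k, by omega⟩
        | exact ⟨j + k + 1, by omega⟩
        | exact ⟨j + 2 * k, by omega⟩
        | exact ⟨j + 2 * k + 1, by omega⟩
        | exact ⟨j + 3 * k, by omega⟩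
        | exact ⟨j + 3 * k + 1, by omega⟩))
    | (left; (first
        | exact ⟨j, by omega⟩
        | exact ⟨j + k, by omega⟩
        | exact ⟨j + k + 1, by omega⟩
        | exact ⟨j + 2 * k, by omega⟩
        | exact ⟨j + 2 * k + 1, by omega⟩
        | exact ⟨j + 3 * k, by omega⟩
        | exact ⟨j + 3 * k + 1, by omega⟩))
    | (right; (first
        | exact ⟨j, by omega⟩
        | exact ⟨j + k, by omega⟩
        | exact ⟨j + k + 1, by omega⟩
        | exact ⟨j + 2 * k, by omega⟩
        | exact ⟨j + 2 * k + 1, by omega⟩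
        | exact ⟨j + 3 * k, by omega⟩
        | exact ⟨j + 3 * k + 1, by omega⟩))
    | (right; left; (first
        | exact ⟨j, by omega⟩
        | exact ⟨j + k, by omega⟩
        | exact ⟨j + k + 1, by omega⟩
        | exact ⟨j + 2 * k, by omega⟩
        | exact ⟨j + 2 * k + 1, by omega⟩
        | exact ⟨j + 3 * k, by omega⟩
        | exact ⟨j + 3 * k + 1, by omega⟩))
    | (right; right; left; (first
        | exact ⟨j, by omega⟩
        | exact ⟨j + k, by omega⟩
        | exact ⟨j + k + 1, by omega⟩
        | exact ⟨j + 2 * k, by omega⟩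
        | exact ⟨j + 2 * k + 1, by omega⟩
        | exact ⟨j + 3 * k, by omega⟩
        | exact ⟨j + 3 * k + 1, by omega⟩))
    | (right; right; right; (first
        | exact ⟨j, by omega⟩
        | exact ⟨j + k, by omega⟩
        | exact ⟨j + k + 1, by omega⟩
        | exact ⟨j + 2 * k, by omega⟩
        | exact ⟨j + 2 * k + 1, by omega⟩
        | exact ⟨j + 3 * k, by omega⟩
        | exact ⟨j + 3 * k + 1, by omega⟩))

lemma comb2 {θ : ℤ → ℝ} (hθ : StrictMono θ) {n k j : ℤ} (hn : n = 4 * k + 2) (hk : 0 ≤ k)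
    (hper : ∀ j, θ (j + n) = θ j + 2 * π)
    {x0 x1 x2 x3 : ℝ} 
    (h0 : Loc θ x0 j (j + 1)) (h1 : Loc θ x1 (j + k) (j + k + 2))
    (h2 : Loc θ x2 (j + 2 * k + 1) (j + 2 * k + 2))
    (h3 : Loc θ x3 (j + 3 * k + 1) (j + 3 * k + 3))
    (h01 : x0 < x1) (h12 : x1 < x2) (h23 : x2 < x3) (h30 : x3 < x0 + 2 * π)
    (hE : EE x0 x1 x2 x3 = 0) {m1 m2 m3 m4 : ℤ} (hB : Bal n m1 m2 m3 m4) : Sol θ m1 m2 m3 := by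
  obtain ⟨b1, b2, b3, b4, b5, b6, b7, b8, b9, b10, b11, b12, b13⟩ := hB
  have d1 : n / 4 = k := by omega
  have d2 : (n + 3) / 4 = k + 1 := by omega
  rw [d1] at *
  rw [d2] at *
  have : (m1 = k ∧ m2 = k + 1 ∧ m3 = k) ∨ (m1 = k + 1 ∧ m2 = k ∧ m3 = k + 1) := by omega
  clear b1 b2 b3 b4 b5 b6 b7 b8 b9 b10 b11 b12 b13 d1 d2
  apply comb hθ hper h0 h1 h2 h3 h01 h12 h23 h30 hE <;> unfold K <;>
    rcases this with ⟨e1, e2, e3⟩ | ⟨e1, e2, e3⟩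
  all_goals first
    | ((first
        | exact ⟨j, by omega⟩
        | exact ⟨j + k, by omega⟩
        | exact ⟨j + k + 1, by omega⟩
        | exact ⟨j + 2 * k + 1, by omega⟩
        | exact ⟨j + 3 * k + 1, by omega⟩
        | exact ⟨j + 3 * k + 2, by omega⟩))
    | (left; (first
        | exact ⟨j, by omega⟩
        | exact ⟨j + k, by omega⟩
        | exact ⟨j + k + 1, by omega⟩
        | exact ⟨j + 2 * k + 1, by omega⟩
        | exact ⟨j + 3 * k + 1, by omega⟩
        | exact ⟨j + 3 * k + 2, by omega⟩))
    | (right; (first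
        | exact ⟨j, by omega⟩
        | exact ⟨j + k, by omega⟩
        | exact ⟨j + k + 1, by omega⟩
        | exact ⟨j + 2 * k + 1, by omega⟩
        | exact ⟨j + 3 * k + 1, by omega⟩
        | exact ⟨j + 3 * k + 2, by omega⟩))
    | (right; left; (first
        | exact ⟨j, by omega⟩
        | exact ⟨j + k, by omega⟩
        | exact ⟨j + k + 1, by omega⟩
        | exact ⟨j + 2 * k + 1, by omega⟩
        | exact ⟨j + 3 * k + 1, by omega⟩
        | exact ⟨j + 3 * k + 2, by omega⟩))
    | (right; right; left; (first
        | exact ⟨j, by omega⟩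
        | exact ⟨j + k, by omega⟩
        | exact ⟨j + k + 1, by omega⟩
        | exact ⟨j + 2 * k + 1, by omega⟩
        | exact ⟨j + 3 * k + 1, by omega⟩
        | exact ⟨j + 3 * k + 2, by omega⟩))
    | (right; right; right; (first
        | exact ⟨j, by omega⟩
        | exact ⟨j + k, by omega⟩
        | exact ⟨j + k + 1, by omega⟩
        | exact ⟨j + 2 * k + 1, by omega⟩
        | exact ⟨j + 3 * k + 1, by omega⟩
        | exact ⟨j + 3 * k + 2, by omega⟩))

lemma comb3 {θ : ℤ → ℝ} (hθ : StrictMono θ) {n k j : ℤ} (hn : n = 4 * k + 3) (hk : 0 ≤ k)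
    (hper : ∀ j, θ (j + n) = θ j + 2 * π)
    {x0 x1 x2 x3 : ℝ} 
    (h0 : Loc θ x0 j (j + 1)) (h1 : Loc θ x1 (j + k) (j + k + 2))
    (h2 : Loc θ x2 (j + 2 * k + 1) (j + 2 * k + 3))
    (h3 : Loc θ x3 (j + 3 * k + 2) (j + 3 * k + 4))
    (h01 : x0 < x1) (h12 : x1 < x2) (h23 : x2 < x3) (h30 : x3 < x0 + 2 * π)
    (hE : EE x0 x1 x2 x3 = 0) {m1 m2 m3 m4 : ℤ} (hB : Bal n m1 m2 m3 m4) : Sol θ m1 m2 m3 := by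
  obtain ⟨b1, b2, b3, b4, b5, b6, b7, b8, b9, b10, b11, b12, b13⟩ := hB
  have d1 : n / 4 = k := by omega
  have d2 : (n + 3) / 4 = k + 1 := by omega
  rw [d1] at *
  rw [d2] at *
  have : (m1 = k ∧ m2 = k + 1 ∧ m3 = k + 1) ∨ (m1 = k + 1 ∧ m2 = k ∧ m3 = k + 1) ∨
      (m1 = k + 1 ∧ m2 = k + 1 ∧ m3 = k) ∨ (m1 = k + 1 ∧ m2 = k + 1 ∧ m3 = k + 1) := by omega
  clear b1 b2 b3 b4 b5 b6 b7 b8 b9 b10 b11 b12 b13 d1 d2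
  apply comb hθ hper h0 h1 h2 h3 h01 h12 h23 h30 hE <;> unfold K <;>
    rcases this with ⟨e1, e2, e3⟩ | ⟨e1, e2, e3⟩ | ⟨e1, e2, e3⟩ | ⟨e1, e2, e3⟩
  all_goals first
    | ((first
        | exact ⟨j, by omega⟩
        | exact ⟨j + k, by omega⟩
        | exact ⟨j + k + 1, by omega⟩
        | exact ⟨j + 2 * k + 1, by omega⟩
        | exact ⟨j + 2 * k + 2, by omega⟩
        | exact ⟨j + 3 * k + 2, by omega⟩
        | exact ⟨j + 3 * k + 3, by omega⟩))
    | (left; (first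
        | exact ⟨j, by omega⟩
        | exact ⟨j + k, by omega⟩
        | exact ⟨j + k + 1, by omega⟩
        | exact ⟨j + 2 * k + 1, by omega⟩
        | exact ⟨j + 2 * k + 2, by omega⟩
        | exact ⟨j + 3 * k + 2, by omega⟩
        | exact ⟨j + 3 * k + 3, by omega⟩))
    | (right; (first
        | exact ⟨j, by omega⟩
        | exact ⟨j + k, by omega⟩
        | exact ⟨j + k + 1, by omega⟩
        | exact ⟨j + 2 * k + 1, by omega⟩
        | exact ⟨j + 2 * k + 2, by omega⟩
        | exact ⟨j + 3 * k + 2, by omega⟩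
        | exact ⟨j + 3 * k + 3, by omega⟩))
    | (right; left; (first
        | exact ⟨j, by omega⟩
        | exact ⟨j + k, by omega⟩
        | exact ⟨j + k + 1, by omega⟩
        | exact ⟨j + 2 * k + 1, by omega⟩
        | exact ⟨j + 2 * k + 2, by omega⟩
        | exact ⟨j + 3 * k + 2, by omega⟩
        | exact ⟨j + 3 * k + 3, by omega⟩))
    | (right; right; left; (first
        | exact ⟨j, by omega⟩
        | exact ⟨j + k, by omega⟩
        | exact ⟨j + k + 1, by omega⟩
        | exact ⟨j + 2 * k + 1, by omega⟩
        | exact ⟨j + 2 * k + 2, by omega⟩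
        | exact ⟨j + 3 * k + 2, by omega⟩
        | exact ⟨j + 3 * k + 3, by omega⟩))
    | (right; right; right; (first
        | exact ⟨j, by omega⟩
        | exact ⟨j + k, by omega⟩
        | exact ⟨j + k + 1, by omega⟩
        | exact ⟨j + 2 * k + 1, by omega⟩
        | exact ⟨j + 2 * k + 2, by omega⟩
        | exact ⟨j + 3 * k + 2, by omega⟩
        | exact ⟨j + 3 * k + 3, by omega⟩))

end PerpSplit

namespace PerpSplit
open Real

lemma signs {s : ℤ → ℝ} {N : ℕ} (hN : N % 2 = 1) (hs : ∀ m, s (m + N) = - s m)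
    (D : ∀ m, m % 2 = 1 → s m ≤ 0 → s (m + 1) < 0)
    (V : ∀ m, m % 2 = 0 → 0 ≤ s m → 0 < s (m + 1)) : ∃ m, s m * s (m + 1) < 0 := by
  by_contra hc
  push Not at hc
  have hN0 := hs 0
  obtain ⟨t, rfl⟩ : ∃ t, N = 2 * t + 1 := ⟨N / 2, by omega⟩
  rcases le_or_gt 0 (s 0) with h0 | h0
  · have : ∀ i : ℕ, 0 ≤ s (2 * i) := by
      intro i
      induction i with
      | zero => simpa using h0
      | succ i ih =>
        have h1 := V (2 * i) (by omega) ih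
        have h2 := hc (2 * i + 1)
        have h3 := nonneg_of_mul_nonneg_right h2 h1
        rw [show (2 * ((i + 1 : ℕ) : ℤ)) = 2 * i + 1 + 1 by push_cast; ring]
        exact h3
    have h1 := V (2 * t) (by omega) (this t)
    rw [zero_add] at hN0
    push_cast at hN0
    linarith
  · have : ∀ i : ℕ, s (2 * i) < 0 := by
      intro i
      induction i with
      | zero => simpa using h0
      | succ i ih =>
        have h2 := hc (2 * i)
        have h1 : s (2 * i + 1) ≤ 0 := by
          by_contra h; exact absurd (mul_neg_of_neg_of_pos ih (not_le.1 h)) (not_lt.2 h2)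
        have h3 := D (2 * i + 1) (by omega) h1
        rw [show (2 * ((i + 1 : ℕ) : ℤ)) = 2 * i + 1 + 1 by push_cast; ring]
        exact h3
    have h2 := hc (2 * t)
    have h1 : s (2 * t + 1) ≤ 0 := by
      by_contra h; exact absurd (mul_neg_of_neg_of_pos (this t) (not_le.1 h)) (not_lt.2 h2)
    rw [zero_add] at hN0
    push_cast at hN0
    linarith

lemma signs0 {s : ℤ → ℝ} {N : ℕ} (hs : ∀ m, s (m + N) = - s m) :
    ∃ m, s m = 0 ∨ s m * s (m + 1) < 0 := by
  by_contra hc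
  push Not at hc
  have : ∀ i : ℕ, 0 < s 0 * s i := by
    intro i
    induction i with
    | zero => simpa using hc 0 |>.1
    | succ i ih =>
      have h1 := (hc i).2
      have h2 := (hc (i + 1)).1
      have h3 := (hc i).1
      have h4 : 0 < s i * s (i + 1) := lt_of_le_of_ne h1 (mul_ne_zero h3 h2).symm
      push_cast
      have h5 := mul_pos ih h4
      have h6 : 0 < s i * s i := mul_self_pos.2 h3
      have h7 : 0 < (s i * s i) * (s 0 * s (i + 1)) := by linarith
      exact (pos_iff_pos_of_mul_pos h7).1 h6
  have h := this N
  have h' := hs 0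
  rw [zero_add] at h'
  rw [h'] at h
  nlinarith [mul_self_nonneg (s 0)]

lemma interp {x y z w x' y' z' w' : ℝ} (h : EE x y z w * EE x' y' z' w' < 0) :
    ∃ s : ℝ, 0 < s ∧ s < 1 ∧ EE ((1 - s) * x + s * x') ((1 - s) * y + s * y')
      ((1 - s) * z + s * z') ((1 - s) * w + s * w') = 0 := by
  have cE : Continuous fun s : ℝ => EE ((1 - s) * x + s * x') ((1 - s) * y + s * y')
      ((1 - s) * z + s * z') ((1 - s) * w + s * w') := by
    unfold EE; fun_prop
  have hne : EE x y z w ≠ 0 ∧ EE x' y' z' w' ≠ 0 := by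
    constructor <;> intro h0 <;> simp [h0] at h
  have : ∃ s ∈ Set.Icc (0 : ℝ) 1, EE ((1 - s) * x + s * x') ((1 - s) * y + s * y')
      ((1 - s) * z + s * z') ((1 - s) * w + s * w') = 0 := by
    rcases mul_neg_iff.1 h with ⟨h1, h2⟩ | ⟨h1, h2⟩
    · exact intermediate_value_Icc' (zero_le_one (α := ℝ)) cE.continuousOn
        (show (0 : ℝ) ∈ _ by constructor <;> simp <;> linarith)
    · exact intermediate_value_Icc (zero_le_one (α := ℝ)) cE.continuousOn
        (show (0 : ℝ) ∈ _ by constructor <;> simp <;> linarith)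
  obtain ⟨s, ⟨hs0, hs1⟩, hs⟩ := this
  refine ⟨s, lt_of_le_of_ne hs0 ?_, lt_of_le_of_ne hs1 ?_, hs⟩
  · rintro rfl; simp at hs; exact hne.1 hs
  · rintro rfl; simp at hs; exact hne.2 hs

lemma conv_in {s p q : ℝ} (h0 : 0 < s) (h1 : s < 1) (h : p < q) :
    p < (1 - s) * p + s * q ∧ (1 - s) * p + s * q < q := by
  have e1 := mul_pos h0 (sub_pos.2 h)
  have e2 := mul_pos (sub_pos.2 h1) (sub_pos.2 h)
  constructor <;> nlinarith

/-- Corner sequence. -/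
noncomputable def cs (θ : ℤ → ℝ) (n m : ℤ) : ℝ :=
  EE (θ (m / 4)) (θ ((m + n) / 4)) (θ ((m + 2 * n) / 4)) (θ ((m + 3 * n) / 4))

lemma cs_shift {θ : ℤ → ℝ} {n : ℤ} (hper : ∀ j, θ (j + n) = θ j + 2 * π) (m : ℤ) :
    cs θ n (m + n) = - cs θ n m := by
  unfold cs
  rw [← EE_shift, ← hper]
  congr 2 <;> omega

lemma sol_odd {θ : ℤ → ℝ} (hθ : StrictMono θ) {n : ℤ} (hper : ∀ j, θ (j + n) = θ j + 2 * π)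
    (hn : 3 ≤ n) (ho : n % 2 = 1) {m1 m2 m3 m4 : ℤ} (hB : Bal n m1 m2 m3 m4) :
    Sol θ m1 m2 m3 := by
  have S1 := cs_shift hper
  have S2 : ∀ m, cs θ n (m + 2 * n) = cs θ n m := fun m => by
    rw [show m + 2 * n = m + n + n by ring, S1, S1, neg_neg]
  have S3 : ∀ m, cs θ n (m + 3 * n) = - cs θ n m := fun m => by
    rw [show m + 3 * n = m + 2 * n + n by ring, S1, S2]
  have e0 : ∀ j : ℤ, cs θ n (4 * j + 3) = EE (θ j) (θ ((4 * j + 4 + n) / 4))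
      (θ ((4 * j + 4 + 2 * n) / 4)) (θ ((4 * j + 4 + 3 * n) / 4)) := fun j => by
    unfold cs; congr 2 <;> omega
  have e1 : ∀ j : ℤ, cs θ n (4 * j + 3 + 1) = EE (θ (j + 1)) (θ ((4 * j + 4 + n) / 4))
      (θ ((4 * j + 4 + 2 * n) / 4)) (θ ((4 * j + 4 + 3 * n) / 4)) := fun j => by
    unfold cs; congr 2 <;> omega
  have D : ∀ j : ℤ, cs θ n (4 * j + 3) ≤ 0 → cs θ n (4 * j + 3 + 1) < 0 := by
    intro j h
    rw [e0] at h
    rw [e1]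
    refine mono_a (hθ (by omega)) (hθ.monotone (by omega)) (hθ (by omega)) (hθ (by omega)) ?_ h
    rw [← hper]; exact hθ.monotone (by omega)
  have key : ∃ j : ℤ, cs θ n (4 * j + 3) * cs θ n (4 * j + 3 + 1) < 0 := by
    have norm : ∀ m : ℤ, ∃ j : ℤ, (m % 2 = 1 ∧ cs θ n m = cs θ n (4 * j + 3) ∧
        cs θ n (m + 1) = cs θ n (4 * j + 3 + 1)) ∨
        (m % 2 = 0 ∧ cs θ n m = - cs θ n (4 * j + 3) ∧
        cs θ n (m + 1) = - cs θ n (4 * j + 3 + 1)) := by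
      intro m
      have hn4 : n % 4 = 1 ∨ n % 4 = 3 := by omega
      have hm4 : m % 4 = 0 ∨ m % 4 = 1 ∨ m % 4 = 2 ∨ m % 4 = 3 := by omega
      have : (m % 4 = 3) ∨ ((m + n) % 4 = 3) ∨ ((m + 2 * n) % 4 = 3) ∨ ((m + 3 * n) % 4 = 3) := by
        rcases hn4 with h | h <;> rcases hm4 with h' | h' | h' | h' <;> omega
      rcases this with h | h | h | h
      · refine ⟨m / 4, Or.inl ⟨by omega, ?_, ?_⟩⟩ <;> congr 1 <;> omega
      · refine ⟨(m + n) / 4, Or.inr ⟨by omega, ?_, ?_⟩⟩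
        · rw [show 4 * ((m + n) / 4) + 3 = m + n by omega, S1, neg_neg]
        · rw [show 4 * ((m + n) / 4) + 3 + 1 = m + 1 + n by omega, S1, neg_neg]
      · refine ⟨(m + 2 * n) / 4, Or.inl ⟨by omega, ?_, ?_⟩⟩
        · rw [show 4 * ((m + 2 * n) / 4) + 3 = m + 2 * n by omega, S2]
        · rw [show 4 * ((m + 2 * n) / 4) + 3 + 1 = m + 1 + 2 * n by omega, S2]
      · refine ⟨(m + 3 * n) / 4, Or.inr ⟨by omega, ?_, ?_⟩⟩
        · rw [show 4 * ((m + 3 * n) / 4) + 3 = m + 3 * n by omega, S3, neg_neg]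
        · rw [show 4 * ((m + 3 * n) / 4) + 3 + 1 = m + 1 + 3 * n by omega, S3, neg_neg]
    obtain ⟨m, hm⟩ := signs (s := cs θ n) (N := n.toNat) (by omega)
      (fun m => by rw [Int.toNat_of_nonneg (by omega)]; exact S1 m)
      (fun m hm h => by
        obtain ⟨j, ⟨_, h1, h2⟩ | ⟨h0, _⟩⟩ := norm m
        · rw [h2]; exact D j (by rwa [← h1])
        · omega)
      (fun m hm h => by
        obtain ⟨j, ⟨h0, _⟩ | ⟨_, h1, h2⟩⟩ := norm m
        · omega
        · rw [h2]; have := D j (by linarith); linarith)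
    obtain ⟨j, ⟨_, h1, h2⟩ | ⟨_, h1, h2⟩⟩ := norm m
    · exact ⟨j, by rwa [← h1, ← h2]⟩
    · refine ⟨j, ?_⟩
      rw [h1, h2] at hm; linarith
  obtain ⟨j, hj⟩ := key
  rw [e0, e1] at hj
  obtain ⟨s, s0, s1, hs⟩ := interp hj
  have tr : ∀ x : ℝ, (1 - s) * x + s * x = x := fun x => by ring
  rw [tr, tr, tr] at hs
  obtain ⟨l, u⟩ := conv_in s0 s1 (hθ (show j < j + 1 by omega))
  set x0 := (1 - s) * θ j + s * θ (j + 1)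
  have L0 := Loc.mid hθ l u
  have L1 := Loc.pt hθ ((4 * j + 4 + n) / 4)
  have L2 := Loc.pt hθ ((4 * j + 4 + 2 * n) / 4)
  have L3 := Loc.pt hθ ((4 * j + 4 + 3 * n) / 4)
  have o1 : x0 < θ ((4 * j + 4 + n) / 4) := lt_of_lt_of_le u (hθ.monotone (by omega))
  have o2 : θ ((4 * j + 4 + n) / 4) < θ ((4 * j + 4 + 2 * n) / 4) := hθ (by omega)
  have o3 : θ ((4 * j + 4 + 2 * n) / 4) < θ ((4 * j + 4 + 3 * n) / 4) := hθ (by omega)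
  have o4 : θ ((4 * j + 4 + 3 * n) / 4) < x0 + 2 * π := by
    have : θ ((4 * j + 4 + 3 * n) / 4) ≤ θ (j + n) := hθ.monotone (by omega)
    rw [hper] at this; linarith
  rcases (show n % 4 = 1 ∨ n % 4 = 3 by omega) with h | h
  · refine comb1 hθ (n := n) (k := n / 4) (j := j) (by omega) (by omega) hper L0 ?_ ?_ ?_
      o1 o2 o3 o4 hs hB
    · convert L1 using 1 <;> omega
    · convert L2 using 1 <;> omega
    · convert L3 using 1 <;> omega
  · refine comb3 hθ (n := n) (k := n / 4) (j := j) (by omega) (by omega) hper L0 ?_ ?_ ?_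
      o1 o2 o3 o4 hs hB
    · convert L1 using 1 <;> omega
    · convert L2 using 1 <;> omega
    · convert L3 using 1 <;> omega

lemma sol_two {θ : ℤ → ℝ} (hθ : StrictMono θ) {n k : ℤ} (hper : ∀ j, θ (j + n) = θ j + 2 * π)
    (hk : 0 ≤ k) (hn : n = 4 * k + 2) {m1 m2 m3 m4 : ℤ} (hB : Bal n m1 m2 m3 m4) :
    Sol θ m1 m2 m3 := by
  have S1 := cs_shift hper
  have e0 : ∀ j : ℤ, cs θ n (4 * j + 2) = EE (θ j) (θ (j + k + 1))
      (θ (j + 2 * k + 1)) (θ (j + 3 * k + 2)) := fun j => by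
    unfold cs; congr 2 <;> omega
  have e1 : ∀ j : ℤ, cs θ n (4 * j + 2 + 2) = EE (θ (j + 1)) (θ (j + k + 1))
      (θ (j + 2 * k + 1 + 1)) (θ (j + 3 * k + 2)) := fun j => by
    unfold cs; congr 2 <;> omega
  have D : ∀ j : ℤ, cs θ n (4 * j + 2) ≤ 0 → cs θ n (4 * j + 2 + 2) < 0 := by
    intro j h
    rw [e0] at h
    rw [e1]
    have p0 : θ (j + 1 + n) = θ (j + 1) + 2 * π := hper _
    have p1 : θ (j + k + 1 + n) = θ (j + k + 1) + 2 * π := hper _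
    rcases hk.eq_or_lt with rfl | hk
    · rw [EE_eq]
      have q1 : θ (j + 1) < θ (j + 2) := hθ (by omega)
      have q2 : θ (j + 2) < θ (j + 1 + n) := hθ (by omega)
      have := sh (x := θ (j + 2) - θ (j + 1)) (by linarith) (by linarith)
      simp only [mul_zero, add_zero, sub_self, zero_div, sin_zero, zero_mul, zero_sub,
        show j + 1 + 1 = j + 2 by ring]
      have := mul_pos this this
      linarith
    · have h1 := mono_a (a' := θ (j + 1)) (hθ (by omega)) (hθ.monotone (by omega)) (hθ (by omega))
        (hθ (by omega)) (by rw [← hper]; exact hθ.monotone (by omega)) h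
      rw [← EE_shift2] at h1 ⊢
      rw [← p0, ← p1] at h1 ⊢
      refine mono_a (hθ (by omega)) (hθ.monotone (by omega)) (hθ (by omega)) (hθ (by omega)) ?_ h1.le
      rw [← hper]; exact hθ.monotone (by omega)
  have norm : ∀ m : ℤ, ∃ j : ℤ, (m % 2 = 1 ∧ cs θ n (2 * m) = cs θ n (4 * j + 2) ∧
      cs θ n (2 * (m + 1)) = cs θ n (4 * j + 2 + 2)) ∨
      (m % 2 = 0 ∧ cs θ n (2 * m) = - cs θ n (4 * j + 2) ∧
      cs θ n (2 * (m + 1)) = - cs θ n (4 * j + 2 + 2)) := by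
    intro m
    rcases (show m % 2 = 1 ∨ m % 2 = 0 by omega) with h | h
    · refine ⟨m / 2, Or.inl ⟨by omega, ?_, ?_⟩⟩ <;> congr 1 <;> omega
    · refine ⟨(2 * m + n) / 4, Or.inr ⟨by omega, ?_, ?_⟩⟩
      · rw [show 4 * ((2 * m + n) / 4) + 2 = 2 * m + n by omega, S1, neg_neg]
      · rw [show 4 * ((2 * m + n) / 4) + 2 + 2 = 2 * (m + 1) + n by omega, S1, neg_neg]
  have key : ∃ j : ℤ, cs θ n (4 * j + 2) * cs θ n (4 * j + 2 + 2) < 0 := by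
    obtain ⟨m, hm⟩ := signs (s := fun m => cs θ n (2 * m)) (N := (2 * k + 1).toNat) (by omega)
      (fun m => by
        rw [Int.toNat_of_nonneg (by omega), ← S1]; congr 1; rw [hn]; ring)
      (fun m hm h => by
        obtain ⟨j, ⟨_, h1, h2⟩ | ⟨h0, _⟩⟩ := norm m
        · show cs θ n (2 * (m + 1)) < 0
          rw [h2]; exact D j (by rwa [← h1])
        · omega)
      (fun m hm h => by
        obtain ⟨j, ⟨h0, _⟩ | ⟨_, h1, h2⟩⟩ := norm m
        · omega
        · show 0 < cs θ n (2 * (m + 1))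
          have h : 0 ≤ cs θ n (2 * m) := h
          rw [h2]; have := D j (by linarith); linarith)
    have hm : cs θ n (2 * m) * cs θ n (2 * (m + 1)) < 0 := hm
    obtain ⟨j, ⟨_, h1, h2⟩ | ⟨_, h1, h2⟩⟩ := norm m
    · exact ⟨j, by rwa [← h1, ← h2]⟩
    · refine ⟨j, ?_⟩
      rw [h1, h2] at hm; linarith
  obtain ⟨j, hj⟩ := key
  rw [e0, e1] at hj
  obtain ⟨s, s0, s1, hs⟩ := interp hj
  have tr : ∀ x : ℝ, (1 - s) * x + s * x = x := fun x => by ring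
  rw [tr, tr] at hs
  obtain ⟨l, u⟩ := conv_in s0 s1 (hθ (show j < j + 1 by omega))
  obtain ⟨l', u'⟩ := conv_in s0 s1 (hθ (show j + 2 * k + 1 < j + 2 * k + 1 + 1 by omega))
  set x0 := (1 - s) * θ j + s * θ (j + 1)
  set x2 := (1 - s) * θ (j + 2 * k + 1) + s * θ (j + 2 * k + 1 + 1)
  have L0 := Loc.mid hθ l u
  have L1 := Loc.pt hθ (j + k + 1)
  have L2 := Loc.mid hθ l' u'
  have L3 := Loc.pt hθ (j + 3 * k + 2)
  have o1 : x0 < θ (j + k + 1) := lt_of_lt_of_le u (hθ.monotone (by omega))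
  have o2 : θ (j + k + 1) < x2 := lt_of_le_of_lt (hθ.monotone (by omega)) l'
  have o3 : x2 < θ (j + 3 * k + 2) := lt_of_lt_of_le u' (hθ.monotone (by omega))
  have o4 : θ (j + 3 * k + 2) < x0 + 2 * π := by
    have : θ (j + 3 * k + 2) ≤ θ (j + n) := hθ.monotone (by omega)
    rw [hper] at this; linarith
  refine comb2 hθ (n := n) (k := k) (j := j) (by omega) (by omega) hper L0 ?_ ?_ ?_
    o1 o2 o3 o4 hs hB
  · convert L1 using 1 <;> omega
  · convert L2 using 1 <;> omega
  · convert L3 using 1 <;> omega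

lemma sol_four {θ : ℤ → ℝ} (hθ : StrictMono θ) {n k : ℤ} (hper : ∀ j, θ (j + n) = θ j + 2 * π)
    (hk : 1 ≤ k) (hn : n = 4 * k) {m1 m2 m3 m4 : ℤ} (hB : Bal n m1 m2 m3 m4) :
    Sol θ m1 m2 m3 := by
  have S1 := cs_shift hper
  have e0 : ∀ j : ℤ, cs θ n (4 * j) = EE (θ j) (θ (j + k))
      (θ (j + 2 * k)) (θ (j + 3 * k)) := fun j => by
    unfold cs; congr 2 <;> omega
  obtain ⟨j, hj⟩ := signs0 (s := fun m => cs θ n (4 * m)) (N := k.toNat)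
      (fun m => by
        rw [Int.toNat_of_nonneg (by omega), ← S1]; congr 1; rw [hn]; ring)
  have hj : cs θ n (4 * j) = 0 ∨ cs θ n (4 * j) * cs θ n (4 * (j + 1)) < 0 := hj
  rw [e0, e0] at hj
  have q1 : θ j < θ (j + k) := hθ (by omega)
  have q2 : θ (j + k) < θ (j + 2 * k) := hθ (by omega)
  have q3 : θ (j + 2 * k) < θ (j + 3 * k) := hθ (by omega)
  have q4 : θ (j + 3 * k) < θ j + 2 * π := by rw [← hper]; exact hθ (by omega)
  rcases hj with hj | hj
  · exact comb0 hθ (n := n) (k := k) (j := j) (e := 1) (by omega) (by omega) (by omega) hper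
      (Loc.pt hθ _) (Loc.pt hθ _) (Loc.pt hθ _) (Loc.pt hθ _) q1 q2 q3 q4 hj hB
  · obtain ⟨s, s0, s1, hs⟩ := interp hj
    have r1 : θ (j + 1) < θ (j + 1 + k) := hθ (by omega)
    have r2 : θ (j + 1 + k) < θ (j + 1 + 2 * k) := hθ (by omega)
    have r3 : θ (j + 1 + 2 * k) < θ (j + 1 + 3 * k) := hθ (by omega)
    have r4 : θ (j + 1 + 3 * k) < θ (j + 1) + 2 * π := by rw [← hper]; exact hθ (by omega)
    obtain ⟨l0, u0⟩ := conv_in s0 s1 (hθ (show j < j + 1 by omega))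
    obtain ⟨l1, u1⟩ := conv_in s0 s1 (hθ (show j + k < j + 1 + k by omega))
    obtain ⟨l2, u2⟩ := conv_in s0 s1 (hθ (show j + 2 * k < j + 1 + 2 * k by omega))
    obtain ⟨l3, u3⟩ := conv_in s0 s1 (hθ (show j + 3 * k < j + 1 + 3 * k by omega))
    have M : ∀ {i i' : ℤ} {x : ℝ}, i' = i + 1 → θ i < x → x < θ i' → Loc θ x (i - 0) (i + 1) := by
      rintro i i' x rfl h h'
      rw [sub_zero]; exact Loc.mid hθ h h'
    refine comb0 hθ (n := n) (k := k) (j := j) (e := 0) (by omega) (by omega) (by omega) hper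
      (M (by omega) l0 u0) (M (by omega) l1 u1) (M (by omega) l2 u2) (M (by omega) l3 u3)
      (conv_lt s0 s1.le q1.le r1) (conv_lt s0 s1.le q2.le r2) (conv_lt s0 s1.le q3.le r3) ?_ hs hB
    have := conv_lt s0 s1.le q4.le r4
    linarith

lemma exists_sol {θ : ℤ → ℝ} (hθ : StrictMono θ) {n : ℤ} (hper : ∀ j, θ (j + n) = θ j + 2 * π)
    (hn : 2 ≤ n) {m1 m2 m3 m4 : ℤ} (hB : Bal n m1 m2 m3 m4) : Sol θ m1 m2 m3 := by
  rcases (show n % 2 = 1 ∨ n % 4 = 2 ∨ n % 4 = 0 by omega) with h | h | h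
  · exact sol_odd hθ hper (by omega) h hB
  · exact sol_two hθ (k := n / 4) hper (by omega) (by omega) hB
  · exact sol_four hθ (k := n / 4) hper (by omega) (by omega) hB

end PerpSplit

namespace PerpSplit
open Real

lemma EE_std (s : ℝ) : EE (s - 3 * (π / 12)) (s + π / 12) (s + 3 * (π / 12)) (s + 7 * (π / 12)) = 0 := by
  unfold EE
  rw [show (s + 3 * (π / 12) - (s - 3 * (π / 12))) / 2 = π / 4 by ring,
    show (s + 7 * (π / 12) - (s + π / 12)) / 2 = π / 4 by ring,
    show (s - 3 * (π / 12) + (s + 3 * (π / 12)) - (s + π / 12) - (s + 7 * (π / 12))) / 2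
      = - (π / 3) by ring, cos_neg, cos_pi_div_three, cos_pi_div_four]
  have : √2 * √2 = 2 := mul_self_sqrt (by norm_num)
  linarith

lemma sol_one {θ : ℤ → ℝ} (hper : ∀ j, θ (j + 1) = θ j + 2 * π)
    {m1 m2 m3 m4 : ℤ} (hB : Bal 1 m1 m2 m3 m4) : Sol θ m1 m2 m3 := by
  obtain ⟨b1, b2, b3, b4, b5, b6, b7, b8, b9, b10, b11, b12, b13⟩ := hB
  have : (m1 = 1 ∧ m2 = 0 ∧ m3 = 0) ∨ (m1 = 0 ∧ m2 = 1 ∧ m3 = 0) ∨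
      (m1 = 0 ∧ m2 = 0 ∧ m3 = 1) ∨ (m1 = 0 ∧ m2 = 0 ∧ m3 = 0) := by omega
  have t0 : θ 1 = θ 0 + 2 * π := by simpa using hper 0
  have t1 : θ (1 + 1) = θ 0 + 2 * π + 2 * π := by rw [hper 1, t0]
  have hpi := pi_pos
  rcases this with ⟨rfl, rfl, rfl⟩ | ⟨rfl, rfl, rfl⟩ | ⟨rfl, rfl, rfl⟩ | ⟨rfl, rfl, rfl⟩
  · refine ⟨0, _, _, _, _, ?_, EE_std (θ 0 + 2 * π)⟩
    unfold U; simp only [zero_add, add_zero, t0, t1]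
    refine ⟨⟨?_, ?_⟩, ⟨?_, ?_⟩, ⟨?_, ?_⟩, ⟨?_, ?_⟩, ⟨?_, ?_, ?_, ?_⟩, ?_, ?_⟩ <;> linarith
  · refine ⟨0, _, _, _, _, ?_, EE_std (θ 0 + 2 * π - 2 * (π / 12))⟩
    unfold U; simp only [zero_add, add_zero, t0, t1]
    refine ⟨⟨?_, ?_⟩, ⟨?_, ?_⟩, ⟨?_, ?_⟩, ⟨?_, ?_⟩, ⟨?_, ?_, ?_, ?_⟩, ?_, ?_⟩ <;> linarith
  · refine ⟨0, _, _, _, _, ?_, EE_std (θ 0 + 2 * π - 5 * (π / 12))⟩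
    unfold U; simp only [zero_add, add_zero, t0, t1]
    refine ⟨⟨?_, ?_⟩, ⟨?_, ?_⟩, ⟨?_, ?_⟩, ⟨?_, ?_⟩, ⟨?_, ?_, ?_, ?_⟩, ?_, ?_⟩ <;> linarith
  · refine ⟨0, _, _, _, _, ?_, EE_std (θ 0 + 2 * π - 8 * (π / 12))⟩
    unfold U; simp only [zero_add, add_zero, t0, t1]
    refine ⟨⟨?_, ?_⟩, ⟨?_, ?_⟩, ⟨?_, ?_⟩, ⟨?_, ?_⟩, ⟨?_, ?_, ?_, ?_⟩, ?_, ?_⟩ <;> linarith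

/-- Polar parametrisation around `o`. -/
noncomputable def F (o : ℂ) (r t : ℝ) : ℂ := ⟨o.re + r * cos t, o.im + r * sin t⟩

lemma F_dist (o : ℂ) (r r' s t : ℝ) :
    dist (F o r s) (F o r' t) ^ 2 = r ^ 2 + r' ^ 2 - 2 * r * r' * cos (s - t) := by
  rw [Complex.dist_eq, Complex.sq_norm, Complex.normSq_apply, cos_sub]
  simp only [F, Complex.sub_re, Complex.sub_im]
  linear_combination r ^ 2 * sin_sq_add_cos_sq s + r' ^ 2 * sin_sq_add_cos_sq t

lemma F_dist_o (o : ℂ) (r s : ℝ) : dist (F o r s) o ^ 2 = r ^ 2 := by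
  rw [Complex.dist_eq, Complex.sq_norm, Complex.normSq_apply]
  simp only [F, Complex.sub_re, Complex.sub_im]
  linear_combination r ^ 2 * sin_sq_add_cos_sq s

/-- Center of the circle perpendicular to `C` through the points with angles `x`, `y`. -/
noncomputable def cen (o : ℂ) (R x y : ℝ) : ℂ := F o (R / cos ((y - x) / 2)) ((x + y) / 2)
/-- Its radius. -/
noncomputable def rad (R x y : ℝ) : ℝ := R * sin ((y - x) / 2) / cos ((y - x) / 2)

section
variable {o : ℂ} {R x y : ℝ}

lemma cpos (hxy : x < y) (hf : y - x < π) : 0 < cos ((y - x) / 2) :=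
  cos_pos_of_mem_Ioo ⟨by linarith [pi_pos], by linarith⟩

lemma rad_pos (hR : 0 < R) (hxy : x < y) (hf : y - x < π) : 0 < rad R x y := by
  have h1 := cpos hxy hf
  have h2 : 0 < sin ((y - x) / 2) := sh (by linarith) (by linarith [pi_pos])
  unfold rad; positivity

lemma cen_o (hxy : x < y) (hf : y - x < π) : dist (cen o R x y) o ^ 2 = rad R x y ^ 2 + R ^ 2 := by
  have h1 := cpos hxy hf
  unfold cen rad
  rw [F_dist_o]
  field_simp
  linear_combination - R ^ 2 * sin_sq_add_cos_sq ((y - x) / 2)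

lemma cen_cen {a b c d : ℝ} (hac : a < c) (hf : c - a < π) (hbd : b < d) (hh : d - b < π)
    (hE : EE a b c d = 0) :
    dist (cen o R a c) (cen o R b d) ^ 2 = rad R a c ^ 2 + rad R b d ^ 2 := by
  have h1 := cpos hac hf
  have h2 := cpos hbd hh
  unfold cen rad
  rw [F_dist]
  unfold EE at hE
  rw [show (a + c) / 2 - (b + d) / 2 = (a + c - b - d) / 2 by ring,
    show cos ((a + c - b - d) / 2) = cos ((c - a) / 2) * cos ((d - b) / 2) by linarith]
  field_simp
  have e1 := sin_sq_add_cos_sq ((c - a) / 2)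
  have e2 := sin_sq_add_cos_sq ((d - b) / 2)
  rw [show sin ((c - a) / 2) ^ 2 = 1 - cos ((c - a) / 2) ^ 2 by linarith,
    show sin ((d - b) / 2) ^ 2 = 1 - cos ((d - b) / 2) ^ 2 by linarith]
  ring

lemma side_eq {t : ℝ} (hxy : x < y) (hf : y - x < π) :
    dist (F o R t) (cen o R x y) ^ 2 - rad R x y ^ 2 =
      4 * R ^ 2 / cos ((y - x) / 2) * (sin ((t - x) / 2) * sin ((t - y) / 2)) := by
  have h1 := cpos hxy hf
  unfold cen rad
  rw [F_dist]
  have e1 := sin_sq_add_cos_sq ((y - x) / 2)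
  have e3 : cos (t - (x + y) / 2) = cos ((y - x) / 2) -
      2 * (sin ((t - x) / 2) * sin ((t - y) / 2)) := by
    rw [show t - (x + y) / 2 = (t - x) / 2 + (t - y) / 2 by ring,
      show (y - x) / 2 = (t - x) / 2 - (t - y) / 2 by ring, cos_add, cos_sub]
    ring
  rw [e3]
  field_simp
  rw [show sin ((y - x) / 2) ^ 2 = 1 - cos ((y - x) / 2) ^ 2 by linarith]
  ring

lemma side_in {t : ℝ} (hR : 0 < R) (hxy : x < y) (hf : y - x < π) (h1 : x < t) (h2 : t < y) :
    dist (F o R t) (cen o R x y) < rad R x y := by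
  have e := side_eq (o := o) (R := R) (t := t) hxy hf
  have c := cpos hxy hf
  have s1 : 0 < sin ((t - x) / 2) := sh (by linarith) (by linarith [pi_pos])
  have s2 : 0 < sin ((y - t) / 2) := sh (by linarith) (by linarith [pi_pos])
  rw [show (t - y) / 2 = - ((y - t) / 2) by ring, sin_neg] at e
  have := mul_pos s1 s2
  have q : 0 < 4 * R ^ 2 / cos ((y - x) / 2) := by positivity
  have := mul_pos q this
  apply lt_of_pow_lt_pow_left₀ 2 (rad_pos hR hxy hf).le
  linarith

lemma side_out {t : ℝ} (hR : 0 < R) (hxy : x < y) (hf : y - x < π) (h1 : y - 2 * π < t)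
    (h2 : t < x + 2 * π) (h : t < x ∨ y < t) :
    rad R x y < dist (F o R t) (cen o R x y) := by
  have e := side_eq (o := o) (R := R) (t := t) hxy hf
  have c := cpos hxy hf
  have : 0 < sin ((t - x) / 2) * sin ((t - y) / 2) := by
    rcases h with h | h
    · have s1 : 0 < sin ((x - t) / 2) := sh (by linarith) (by linarith [pi_pos])
      have s2 : 0 < sin ((y - t) / 2) := sh (by linarith) (by linarith [pi_pos])
      rw [show (t - y) / 2 = - ((y - t) / 2) by ring, show (t - x) / 2 = - ((x - t) / 2) by ring,
        sin_neg, sin_neg, neg_mul_neg]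
      exact mul_pos s1 s2
    · exact mul_pos (sh (by linarith) (by linarith [pi_pos])) (sh (by linarith) (by linarith [pi_pos]))
  have q : 0 < 4 * R ^ 2 / cos ((y - x) / 2) := by positivity
  have := mul_pos q this
  apply lt_of_pow_lt_pow_left₀ 2 dist_nonneg
  linarith
end

lemma F_arg {o p : ℂ} {R : ℝ} (h : dist p o = R) : F o R (Complex.arg (p - o)) = p := by
  rw [Complex.dist_eq] at h
  unfold F
  rw [← h, Complex.norm_mul_cos_arg, Complex.norm_mul_sin_arg]
  apply Complex.ext <;> simp

lemma F_int (o : ℂ) (R t : ℝ) (q : ℤ) : F o R (t + 2 * π * q) = F o R t := by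
  unfold F
  rw [show t + 2 * π * q = t + q * (2 * π) by ring, cos_add_int_mul_two_pi, sin_add_int_mul_two_pi]

lemma F_inj {o : ℂ} {R s t : ℝ} (hR : 0 < R) (h : F o R s = F o R t) (hst : |s - t| < 2 * π) :
    s = t := by
  have h1 := F_dist o R R s t
  rw [h, dist_self] at h1
  have h2 : cos (s - t) = 1 := by
    have : R ^ 2 * (cos (s - t) - 1) = 0 := by linarith
    rcases mul_eq_zero.1 this with h | h
    · exact absurd h (by positivity)
    · linarith
  rw [abs_lt] at hst
  have := (cos_eq_one_iff_of_lt_of_lt hst.1 hst.2).1 h2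
  linarith

lemma enum {o : ℂ} {R : ℝ} (hR : 0 < R) {P : Finset ℂ} (hP : ∀ p ∈ P, dist p o = R)
    {n : ℕ} (hn : P.card = n) (hn1 : 1 ≤ n) :
    ∃ θ : ℤ → ℝ, StrictMono θ ∧ (∀ j, θ (j + n) = θ j + 2 * π) ∧ (∀ j, F o R (θ j) ∈ P) ∧
      ∀ g : ℤ, ∀ p ∈ P, ∃ j : ℤ, g < j ∧ j ≤ g + n ∧ F o R (θ j) = p := by
  have hn0 : (0 : ℤ) < n := by omega
  set S : Finset ℝ := P.image fun p => Complex.arg (p - o) with hS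
  have hSc : S.card = n := by
    rw [hS, Finset.card_image_of_injOn, hn]
    intro p hp q hq h
    have h : Complex.arg (p - o) = Complex.arg (q - o) := h
    rw [← F_arg (hP p hp), ← F_arg (hP q hq), h]
  set e := S.orderEmbOfFin hSc with he
  have heS : ∀ i, e i ∈ S := fun i => S.orderEmbOfFin_mem hSc i
  have hSr : ∀ x ∈ S, -π < x ∧ x ≤ π ∧ F o R x ∈ P := by
    intro x hx
    rw [hS, Finset.mem_image] at hx
    obtain ⟨p, hp, rfl⟩ := hx
    exact ⟨Complex.neg_pi_lt_arg _, Complex.arg_le_pi _, by rwa [F_arg (hP p hp)]⟩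
  let r : ℤ → Fin n := fun j => ⟨(j % n).toNat, by
    have := Int.emod_lt_of_pos j hn0
    have := Int.emod_nonneg j hn0.ne'
    omega⟩
  have hper : ∀ (j q : ℤ), e (r (j + n * q)) + 2 * π * ((j + n * q) / n : ℤ) =
      e (r j) + 2 * π * (j / n : ℤ) + 2 * π * q := by
    intro j q
    have h1 : r (j + n * q) = r j := by
      apply Fin.ext; simp only [r]; rw [Int.add_mul_emod_self_left]
    rw [h1, Int.add_mul_ediv_left _ _ hn0.ne']
    push_cast; ring
  refine ⟨fun j => e (r j) + 2 * π * (j / n : ℤ), ?_, ?_, ?_, ?_⟩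
  · apply strictMono_int_of_lt_succ
    intro j
    have m0 := Int.emod_nonneg j hn0.ne'
    have m1 := Int.emod_lt_of_pos j hn0
    have m2 := Int.emod_add_mul_ediv j n
    rcases lt_or_ge (j % n + 1) n with h | h
    · have hd : (j + 1) / (n : ℤ) = j / n ∧ (j + 1) % (n : ℤ) = j % n + 1 :=
        (Int.ediv_emod_unique hn0).2 ⟨by linarith, by omega, h⟩
      have : r j < r (j + 1) := by
        rw [Fin.lt_def]; simp only [r]; rw [hd.2]; omega
      have := e.strictMono this
      simp only [hd.1]
      linarith
    · have hd : (j + 1) / (n : ℤ) = j / n + 1 ∧ (j + 1) % (n : ℤ) = 0 :=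
        (Int.ediv_emod_unique hn0).2 ⟨by
          have : j % (n : ℤ) = n - 1 := by omega
          rw [mul_add]; linarith, by omega, by omega⟩
      have h1 := hSr _ (heS (r j))
      have h2 := hSr _ (heS (r (j + 1)))
      simp only [hd.1]
      push_cast
      linarith [h1.2.1, h2.1]
  · intro j
    have := hper j 1
    simpa using this
  · intro j
    simp only [F_int]
    exact (hSr _ (heS _)).2.2
  · intro g p hp
    have : Complex.arg (p - o) ∈ Set.range e := by
      rw [he, Finset.range_orderEmbOfFin]
      simp only [hS, Finset.coe_image]
      exact ⟨p, hp, rfl⟩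
    obtain ⟨i, hi⟩ := this
    have m0 := Int.emod_nonneg ((i : ℤ) - g - 1) hn0.ne'
    have m1 := Int.emod_lt_of_pos ((i : ℤ) - g - 1) hn0
    have m2 := Int.emod_add_mul_ediv ((i : ℤ) - g - 1) n
    refine ⟨(i : ℤ) + n * (-(((i : ℤ) - g - 1) / n)), by linarith, by linarith, ?_⟩
    have hri : r i = i := by
      apply Fin.ext
      simp only [r]
      rw [Int.emod_eq_of_lt (by omega) (by have := i.2; omega)]
      omega
    simp only [hper, F_int, hri, hi]
    exact F_arg (hP p hp)

lemma count {o : ℂ} {R : ℝ} (hR : 0 < R) {P : Finset ℂ} {θ : ℤ → ℝ} (hθ : StrictMono θ) {n : ℤ}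
    (hper : ∀ j, θ (j + n) = θ j + 2 * π) (h1 : ∀ j, F o R (θ j) ∈ P) {g : ℤ}
    (h2 : ∀ p ∈ P, ∃ j, g < j ∧ j ≤ g + n ∧ F o R (θ j) = p) {u v : ℤ} (hu : g ≤ u) (hv : v ≤ g + n)
    {Q : ℂ → Prop} (hQ : ∀ j, g < j → j ≤ g + n → (Q (F o R (θ j)) ↔ u < j ∧ j ≤ v)) {m : ℕ}
    (hm : v = u + m) : {p | p ∈ P ∧ Q p}.ncard = m := by
  have : {p | p ∈ P ∧ Q p} = (fun j => F o R (θ j)) '' (Set.Ioc u v) := by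
    ext p
    constructor
    · rintro ⟨hp, hq⟩
      obtain ⟨j, j1, j2, rfl⟩ := h2 p hp
      exact ⟨j, (hQ j j1 j2).1 hq, rfl⟩
    · rintro ⟨j, ⟨j1, j2⟩, rfl⟩
      exact ⟨h1 j, (hQ j (by omega) (by omega)).2 ⟨j1, j2⟩⟩
  rw [this, Set.ncard_image_of_injOn, ← Finset.coe_Ioc, Set.ncard_coe_finset, Int.card_Ioc]
  · omega
  · rintro i ⟨i1, i2⟩ j ⟨j1, j2⟩ h
    apply hθ.injective
    apply F_inj hR h
    have a1 : θ i < θ (j + n) := hθ (by omega)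
    have a2 : θ j < θ (i + n) := hθ (by omega)
    rw [hper] at a1 a2
    rw [abs_lt]; constructor <;> linarith

lemma main (o : ℂ) (R : ℝ) (hR : 0 < R) (P : Finset ℂ)
    (hP : ∀ p ∈ P, dist p o = R) (n₁ n₂ n₃ n₄ : ℕ)
    (hB : Bal P.card n₂ n₁ n₄ n₃) :
    ∃ (A B : ℂ) (rA rB : ℝ), 0 < rA ∧ 0 < rB ∧
      dist A o ^ 2 = rA ^ 2 + R ^ 2 ∧
      dist B o ^ 2 = rB ^ 2 + R ^ 2 ∧
      dist A B ^ 2 = rA ^ 2 + rB ^ 2 ∧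
      (∀ p ∈ P, dist p A ≠ rA ∧ dist p B ≠ rB) ∧
      {p | p ∈ P ∧ p ∈ Metric.ball A rA ∧ p ∈ Metric.ball B rB}.ncard = n₁ ∧
      {p | p ∈ P ∧ p ∈ Metric.ball A rA ∧ p ∉ Metric.closedBall B rB}.ncard = n₂ ∧
      {p | p ∈ P ∧ p ∉ Metric.closedBall A rA ∧ p ∉ Metric.closedBall B rB}.ncard = n₃ ∧
      {p | p ∈ P ∧ p ∉ Metric.closedBall A rA ∧ p ∈ Metric.ball B rB}.ncard = n₄ := by
  rcases Nat.eq_zero_or_pos P.card with h0 | h0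
  · have hP0 : P = ∅ := Finset.card_eq_zero.1 h0
    have hz : n₁ = 0 ∧ n₂ = 0 ∧ n₃ = 0 ∧ n₄ = 0 := by
      have := hB.1
      omega
    obtain ⟨rfl, rfl, rfl, rfl⟩ := hz
    have hpi := pi_pos
    have hE := EE_std 0
    refine ⟨cen o R _ _, cen o R _ _, rad R _ _, rad R _ _, rad_pos hR ?_ ?_, rad_pos hR ?_ ?_,
      cen_o ?_ ?_, cen_o ?_ ?_, cen_cen ?_ ?_ ?_ ?_ hE, ?_⟩
    all_goals first | linarith | simp [hP0]
  · obtain ⟨θ, hθ, hper, hF, hs⟩ := enum hR hP rfl h0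
    have hSol : Sol θ n₂ n₁ n₄ := by
      rcases Nat.lt_or_ge 1 P.card with h | h
      · exact exists_sol hθ hper (by omega) hB
      · have : (P.card : ℤ) = 1 := by omega
        rw [this] at hper hB
        exact sol_one hper hB
    obtain ⟨g, a, b, c, d, ⟨⟨u1, u2⟩, ⟨u3, u4⟩, ⟨u5, u6⟩, ⟨u7, u8⟩, ⟨o1, o2, o3, o4⟩, hf, hh⟩, hE⟩ :=
      hSol
    have hsum := hB.1
    have hac : a < c := by linarith
    have hbd : b < d := by linarith
    have A1 : ∀ j, g < j → a < θ j := fun j h => lt_of_lt_of_le u2 (hθ.monotone (by omega))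
    have A2 : ∀ j, j ≤ g + P.card → θ j < a + 2 * π := fun j h => by
      have := hθ.monotone h
      rw [hper] at this; linarith
    have B1 : ∀ j, g + n₂ < j → b < θ j := fun j h => lt_of_lt_of_le u4 (hθ.monotone (by omega))
    have B2 : ∀ j, j ≤ g + n₂ → θ j < b := fun j h => lt_of_le_of_lt (hθ.monotone h) u3
    have C1 : ∀ j, g + n₂ + n₁ < j → c < θ j := fun j h =>
      lt_of_lt_of_le u6 (hθ.monotone (by omega))
    have C2 : ∀ j, j ≤ g + n₂ + n₁ → θ j < c := fun j h => lt_of_le_of_lt (hθ.monotone h) u5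
    have D1 : ∀ j, g + n₂ + n₁ + n₄ < j → d < θ j := fun j h =>
      lt_of_lt_of_le u8 (hθ.monotone (by omega))
    have D2 : ∀ j, j ≤ g + n₂ + n₁ + n₄ → θ j < d := fun j h => lt_of_le_of_lt (hθ.monotone h) u7
    -- position of the points relative to the two circles
    have PA : ∀ j, g < j → j ≤ g + P.card →
        (j ≤ g + n₂ + n₁ ∧ dist (F o R (θ j)) (cen o R a c) < rad R a c) ∨
        (g + n₂ + n₁ < j ∧ rad R a c < dist (F o R (θ j)) (cen o R a c)) := by
      intro j j1 j2
      have := A1 j j1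
      have := A2 j j2
      rcases le_or_gt j (g + n₂ + n₁) with h | h
      · exact Or.inl ⟨h, side_in hR hac hf (A1 j j1) (C2 j h)⟩
      · exact Or.inr ⟨h, side_out hR hac hf (by linarith) (by linarith) (Or.inr (C1 j h))⟩
    have PB : ∀ j, g < j → j ≤ g + P.card →
        ((g + n₂ < j ∧ j ≤ g + n₂ + n₁ + n₄) ∧ dist (F o R (θ j)) (cen o R b d) < rad R b d) ∨
        ((j ≤ g + n₂ ∨ g + n₂ + n₁ + n₄ < j) ∧
          rad R b d < dist (F o R (θ j)) (cen o R b d)) := by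
      intro j j1 j2
      have := A1 j j1
      have := A2 j j2
      rcases le_or_gt j (g + n₂) with h | h
      · exact Or.inr ⟨Or.inl h, side_out hR hbd hh (by linarith) (by linarith) (Or.inl (B2 j h))⟩
      rcases le_or_gt j (g + n₂ + n₁ + n₄) with h' | h'
      · exact Or.inl ⟨⟨h, h'⟩, side_in hR hbd hh (B1 j h) (D2 j h')⟩
      · exact Or.inr ⟨Or.inr h', side_out hR hbd hh (by linarith) (by linarith) (Or.inr (D1 j h'))⟩
    refine ⟨cen o R a c, cen o R b d, rad R a c, rad R b d, rad_pos hR hac hf, rad_pos hR hbd hh,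
      cen_o hac hf, cen_o hbd hh, cen_cen hac hf hbd hh hE, ?_, ?_, ?_, ?_, ?_⟩
    · intro p hp
      obtain ⟨j, j1, j2, rfl⟩ := hs g p hp
      refine ⟨?_, ?_⟩
      · rcases PA j j1 j2 with h | h
        · exact h.2.ne
        · exact h.2.ne'
      · rcases PB j j1 j2 with h | h
        · exact h.2.ne
        · exact h.2.ne'
    · refine count hR hθ hper hF (hs g) (u := g + n₂) (v := g + n₂ + n₁) (by omega) (by omega)
        (fun j j1 j2 => ?_) (by omega)
      simp only [Metric.mem_ball, Metric.mem_closedBall, not_le]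
      rcases PA j j1 j2 with ⟨h1, h2⟩ | ⟨h1, h2⟩ <;> rcases PB j j1 j2 with ⟨h3, h4⟩ | ⟨h3, h4⟩ <;>
        simp only [h2, h4, not_lt_of_gt h2, not_lt_of_gt h4] <;> simp <;> omega
    · refine count hR hθ hper hF (hs g) (u := g) (v := g + n₂) (by omega) (by omega)
        (fun j j1 j2 => ?_) (by omega)
      simp only [Metric.mem_ball, Metric.mem_closedBall, not_le]
      rcases PA j j1 j2 with ⟨h1, h2⟩ | ⟨h1, h2⟩ <;> rcases PB j j1 j2 with ⟨h3, h4⟩ | ⟨h3, h4⟩ <;>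
        simp only [h2, h4, not_lt_of_gt h2, not_lt_of_gt h4] <;> simp <;> omega
    · refine count hR hθ hper hF (hs g) (u := g + n₂ + n₁ + n₄) (v := g + P.card)
        (by omega) (by omega) (fun j j1 j2 => ?_) (by omega)
      simp only [Metric.mem_ball, Metric.mem_closedBall, not_le]
      rcases PA j j1 j2 with ⟨h1, h2⟩ | ⟨h1, h2⟩ <;> rcases PB j j1 j2 with ⟨h3, h4⟩ | ⟨h3, h4⟩ <;>
        simp only [h2, h4, not_lt_of_gt h2, not_lt_of_gt h4] <;> simp <;> omega
    · refine count hR hθ hper hF (hs g) (u := g + n₂ + n₁) (v := g + n₂ + n₁ + n₄)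
        (by omega) (by omega) (fun j j1 j2 => ?_) (by omega)
      simp only [Metric.mem_ball, Metric.mem_closedBall, not_le]
      rcases PA j j1 j2 with ⟨h1, h2⟩ | ⟨h1, h2⟩ <;> rcases PB j j1 j2 with ⟨h3, h4⟩ | ⟨h3, h4⟩ <;>
        simp only [h2, h4, not_lt_of_gt h2, not_lt_of_gt h4] <;> simp <;> omega

end PerpSplit



/-- Let `C` be a circle (center `o`, radius `R`) and `P` a set of `n` points
on `C`, and let `n₁, n₂, n₃, n₄` be nonnegative integers summing to `n` with
`⌊n/4⌋ ≤ nᵢ ≤ ⌈n/4⌉` and `⌊n/2⌋ ≤ nᵢ + n_{(i+1) mod 4} ≤ ⌈n/2⌉` for all `i`.  Then there are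
two circles `A` and `B`, disjoint from `P`, such that `A`, `B`, `C` are pairwise perpendicular
and the four arcs of `C` determined by the intersections with `A` and `B` (equivalently, the
four quadrants cut out by `A` and `B`) contain exactly `n₁, n₂, n₃, n₄` points of `P` in
cyclic order. -/
theorem exists_perpendicular_splitting_circles
    (o : ℂ) (R : ℝ) (hR : 0 < R) (P : Finset ℂ)
    (hP : ∀ p ∈ P, dist p o = R)
    (n₁ n₂ n₃ n₄ : ℕ) (hsum : n₁ + n₂ + n₃ + n₄ = P.card)
    (hl₁ : P.card / 4 ≤ n₁) (hu₁ : n₁ ≤ (P.card + 3) / 4)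
    (hl₂ : P.card / 4 ≤ n₂) (hu₂ : n₂ ≤ (P.card + 3) / 4)
    (hl₃ : P.card / 4 ≤ n₃) (hu₃ : n₃ ≤ (P.card + 3) / 4)
    (hl₄ : P.card / 4 ≤ n₄) (hu₄ : n₄ ≤ (P.card + 3) / 4)
    (hl₁₂ : P.card / 2 ≤ n₁ + n₂) (hu₁₂ : n₁ + n₂ ≤ (P.card + 1) / 2)
    (hl₂₃ : P.card / 2 ≤ n₂ + n₃) (hu₂₃ : n₂ + n₃ ≤ (P.card + 1) / 2)
    (hl₃₄ : P.card / 2 ≤ n₃ + n₄) (hu₃₄ : n₃ + n₄ ≤ (P.card + 1) / 2)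
    (hl₄₁ : P.card / 2 ≤ n₄ + n₁) (hu₄₁ : n₄ + n₁ ≤ (P.card + 1) / 2) :
    ∃ (A B : ℂ) (rA rB : ℝ), 0 < rA ∧ 0 < rB ∧
      dist A o ^ 2 = rA ^ 2 + R ^ 2 ∧
      dist B o ^ 2 = rB ^ 2 + R ^ 2 ∧
      dist A B ^ 2 = rA ^ 2 + rB ^ 2 ∧
      (∀ p ∈ P, dist p A ≠ rA ∧ dist p B ≠ rB) ∧
      {p | p ∈ P ∧ p ∈ Metric.ball A rA ∧ p ∈ Metric.ball B rB}.ncard = n₁ ∧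
      {p | p ∈ P ∧ p ∈ Metric.ball A rA ∧ p ∉ Metric.closedBall B rB}.ncard = n₂ ∧
      {p | p ∈ P ∧ p ∉ Metric.closedBall A rA ∧ p ∉ Metric.closedBall B rB}.ncard = n₃ ∧
      {p | p ∈ P ∧ p ∉ Metric.closedBall A rA ∧ p ∈ Metric.ball B rB}.ncard = n₄ := by
  apply PerpSplit.main o R hR P hP
  refine ⟨?_, ?_, ?_, ?_, ?_, ?_, ?_, ?_, ?_, ?_, ?_, ?_, ?_⟩ <;> omega
end

section
/- Let C be a circle and let A, B be two circles perpendicular to C and to each other, with their intersection point p inside C, dividing the disk into four 'quadrants'. Within any one quadrant there exists a circular arc tangent to C at the point where the quadrant boundary arc of C meets B, and tangent to A at p. -/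
open Set Metric

noncomputable section

namespace Piece

/-- The velocity (tangent) vector of a piece at parameter `t`. -/
def tangent : Piece → ℝ → ℂ
  | arc c r θ₀ θ₁, t =>
      (r : ℂ) * ((θ₁ - θ₀ : ℝ) : ℂ) * Complex.I *
        Complex.exp (Complex.I * ((θ₀ + t * (θ₁ - θ₀) : ℝ) : ℂ))
  | seg p q, _ => q - p

/-- Starting point. -/
def source (P : Piece) : ℂ := P.toFun 0

/-- Ending point. -/
def target (P : Piece) : ℂ := P.toFun 1

/-- The trace of the piece in the plane. -/
def image (P : Piece) : Set ℂ := P.toFun '' Set.Icc 0 1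

end Piece

/-- The unsigned angle in `[0, π]` between two vectors of the plane `ℂ`. -/
def vecAngle (u v : ℂ) : ℝ := Real.arccos (((starRingEnd ℂ) u * v).re / (‖u‖ * ‖v‖))

/-- The angle in `[0, π/2]` between the two *lines* spanned by `u` and `v`. -/
def lineAngle (u v : ℂ) : ℝ := Real.arccos (|((starRingEnd ℂ) u * v).re| / (‖u‖ * ‖v‖))

/-- One of the four "quadrants" into which the closed disk bounded by the circle `C`
(center `o`, radius `R`) is divided by two circles `A` (center `A`, radius `rA`) and `B`
(center `B`, radius `rB`) perpendicular to `C` and to each other; the booleans `sA`, `sB`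
select the side of `A` resp. `B`. -/
def quadrant (o A B : ℂ) (R rA rB : ℝ) (sA sB : Bool) : Set ℂ :=
  Metric.closedBall o R ∩
    (if sA then Metric.closedBall A rA else (Metric.ball A rA)ᶜ) ∩
    (if sB then Metric.closedBall B rB else (Metric.ball B rB)ᶜ)

lemma lineAngle_real_mul (c : ℝ) (v : ℂ) (hc : c ≠ 0) (hv : v ≠ 0) :
    lineAngle ((c : ℂ) * v) v = 0 := by
  have h1 : ((starRingEnd ℂ) ((c : ℂ) * v) * v).re = c * ‖v‖ ^ 2 := by
    rw [Complex.sq_norm, Complex.normSq_apply]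
    simp
    ring
  have hv' : 0 < ‖v‖ := norm_pos_iff.mpr hv
  have hc' : 0 < |c| := abs_pos.mpr hc
  unfold lineAngle
  rw [h1, abs_mul, abs_of_nonneg (sq_nonneg ‖v‖), norm_mul, Complex.norm_real, Real.norm_eq_abs,
    Real.arccos_eq_zero]
  apply le_of_eq
  field_simp

lemma sin_chord (x y : ℝ) :
    Real.sin (2 * x + 2 * y) - Real.sin (2 * x) - Real.sin (2 * y)
      = -4 * (Real.sin x * Real.sin y * Real.sin (x + y)) := by
  rw [Real.sin_add, Real.sin_add, Real.sin_two_mul, Real.sin_two_mul, Real.cos_two_mul,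
    Real.cos_two_mul]
  have hx := Real.sin_sq_add_cos_sq x
  have hy := Real.sin_sq_add_cos_sq y
  have hx' : Real.cos x ^ 2 = 1 - Real.sin x ^ 2 := by linarith
  have hy' : Real.cos y ^ 2 = 1 - Real.sin y ^ 2 := by linarith
  rw [hx', hy']
  ring

lemma chord_im (d : ℂ) (r α δ t : ℝ) :
    ((starRingEnd ℂ) ((Piece.arc d r α (α + δ)).toFun 1 - (Piece.arc d r α (α + δ)).toFun 0) *
      ((Piece.arc d r α (α + δ)).toFun t - (Piece.arc d r α (α + δ)).toFun 0)).im
      = -4 * r ^ 2 * (Real.sin (t * δ / 2) * Real.sin ((1 - t) * δ / 2) * Real.sin (δ / 2)) := by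
  have key := sin_chord (t * δ / 2) ((1 - t) * δ / 2)
  have e1 : 2 * (t * δ / 2) + 2 * ((1 - t) * δ / 2) = δ := by ring
  have e2 : t * δ / 2 + (1 - t) * δ / 2 = δ / 2 := by ring
  have e3 : 2 * (t * δ / 2) = t * δ := by ring
  have e4 : 2 * ((1 - t) * δ / 2) = δ - t * δ := by ring
  rw [e1, e2, e3, e4, Real.sin_sub] at key
  have hexp : ∀ s : ℝ, Complex.exp (Complex.I * ((s : ℝ) : ℂ)) =
      ⟨Real.cos s, Real.sin s⟩ := by
    intro s
    rw [mul_comm, Complex.exp_mul_I, ← Complex.ofReal_cos, ← Complex.ofReal_sin]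
    apply Complex.ext <;> simp [-Complex.ofReal_cos, -Complex.ofReal_sin]
  simp only [Piece.toFun, hexp]
  have a1 : α + 1 * (α + δ - α) = α + δ := by ring
  have a2 : α + 0 * (α + δ - α) = α := by ring
  have a3 : α + t * (α + δ - α) = α + t * δ := by ring
  rw [a1, a2, a3]
  simp only [Complex.mul_im, Complex.conj_re, Complex.conj_im, Complex.sub_re, Complex.sub_im,
    Complex.add_re, Complex.add_im, Complex.mul_re, Complex.ofReal_re, Complex.ofReal_im,
    Real.sin_add α, Real.cos_add α]
  have h := Real.sin_sq_add_cos_sq α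
  have hh : Real.cos α ^ 2 = 1 - Real.sin α ^ 2 := by linarith
  linear_combination (r ^ 2) * key + r ^ 2 * (Real.cos δ * Real.sin (t * δ)
    - Real.sin δ * Real.cos (t * δ) + Real.sin δ - Real.sin (t * δ)) * h

lemma arc_exists (p q d : ℂ) (r m : ℝ) (hr : 0 < r) (hp : ‖p - d‖ = r) (hq : ‖q - d‖ = r)
    (hpq : p ≠ q) :
    ∃ α δ : ℝ, δ ≠ 0 ∧ (Piece.arc d r α (α + δ)).toFun 0 = p ∧
      (Piece.arc d r α (α + δ)).toFun 1 = q ∧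
      ∀ t ∈ Set.Icc (0 : ℝ) 1, ‖(Piece.arc d r α (α + δ)).toFun t - d‖ = r ∧
        m * ((starRingEnd ℂ) (q - p) * ((Piece.arc d r α (α + δ)).toFun t - p)).im ≤ 0 := by
  have hpd : p - d ≠ 0 := by
    rw [← norm_pos_iff, hp]; exact hr
  set w := (q - d) / (p - d) with hw
  have hwn : ‖w‖ = 1 := by rw [hw, norm_div, hp, hq, div_self hr.ne']
  have hwexp : Complex.exp (Complex.I * (w.arg : ℂ)) = w := by
    have := Complex.norm_mul_exp_arg_mul_I w
    rw [hwn] at this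
    rw [mul_comm]; simpa using this
  have hpexp : (r : ℂ) * Complex.exp (Complex.I * ((p - d).arg : ℂ)) = p - d := by
    have := Complex.norm_mul_exp_arg_mul_I (p - d)
    rw [hp] at this
    rw [mul_comm Complex.I]; exact this
  have hw0 : w.arg ≠ 0 := by
    intro h
    rw [h] at hwexp
    have h1 : w = 1 := by rw [← hwexp]; simp
    rw [hw, div_eq_one_iff_eq hpd] at h1
    exact hpq (sub_left_injective h1).symm
  have hexists : ∃ δ : ℝ, δ ≠ 0 ∧ Complex.exp (Complex.I * (δ : ℂ)) = w ∧
      ((0 ≤ m ∧ 0 < δ ∧ δ < 2 * Real.pi) ∨ (m ≤ 0 ∧ δ < 0 ∧ -(2 * Real.pi) < δ)) := by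
    have hpi := Real.pi_pos
    have l1 := Complex.neg_pi_lt_arg w
    have l2 := Complex.arg_le_pi w
    have hplus : Complex.exp (Complex.I * ((w.arg + 2 * Real.pi : ℝ) : ℂ)) = w := by
      push_cast
      rw [mul_add, Complex.exp_add, mul_comm Complex.I (2 * _), Complex.exp_two_pi_mul_I, hwexp,
        mul_one]
    have hminus : Complex.exp (Complex.I * ((w.arg - 2 * Real.pi : ℝ) : ℂ)) = w := by
      push_cast
      rw [mul_sub, Complex.exp_sub, mul_comm Complex.I (2 * _), Complex.exp_two_pi_mul_I, hwexp,
        div_one]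
    rcases le_total 0 m with hm | hm <;> rcases lt_or_gt_of_ne hw0 with h | h
    · exact ⟨_, by linarith, hplus, Or.inl ⟨hm, by linarith, by linarith⟩⟩
    · exact ⟨_, hw0, hwexp, Or.inl ⟨hm, by linarith, by linarith⟩⟩
    · exact ⟨_, hw0, hwexp, Or.inr ⟨hm, by linarith, by linarith⟩⟩
    · exact ⟨_, by linarith, hminus, Or.inr ⟨hm, by linarith, by linarith⟩⟩
  obtain ⟨δ, hδ0, hδw, hδ⟩ := hexists
  have h0 : (Piece.arc d r (p - d).arg ((p - d).arg + δ)).toFun 0 = p := by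
    simp only [Piece.toFun, zero_mul, add_zero]
    rw [hpexp]; ring
  have h1 : (Piece.arc d r (p - d).arg ((p - d).arg + δ)).toFun 1 = q := by
    simp only [Piece.toFun, one_mul, add_sub_cancel_left]
    push_cast
    rw [mul_add, Complex.exp_add, ← mul_assoc, hpexp, hδw, hw, mul_div_cancel₀ _ hpd]
    ring
  refine ⟨(p - d).arg, δ, hδ0, h0, h1, ?_⟩
  intro t ht
  constructor
  · simp only [Piece.toFun, add_sub_cancel_left]
    rw [norm_mul, mul_comm Complex.I, Complex.norm_exp_ofReal_mul_I, Complex.norm_real,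
      Real.norm_eq_abs, abs_of_pos hr, mul_one]
  · have hc := chord_im d r (p - d).arg δ t
    rw [h0, h1] at hc
    rw [hc]
    have r2 : 0 ≤ r ^ 2 := sq_nonneg r
    obtain ⟨ht0, ht1⟩ := ht
    rcases hδ with ⟨hm, ha, hb⟩ | ⟨hm, ha, hb⟩
    · have s1 : 0 ≤ Real.sin (t * δ / 2) :=
        Real.sin_nonneg_of_nonneg_of_le_pi (by positivity) (by nlinarith)
      have s2 : 0 ≤ Real.sin ((1 - t) * δ / 2) :=
        Real.sin_nonneg_of_nonneg_of_le_pi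
          (by have : 0 ≤ 1 - t := by linarith
              positivity) (by nlinarith)
      have s3 : 0 ≤ Real.sin (δ / 2) :=
        Real.sin_nonneg_of_nonneg_of_le_pi (by positivity) (by linarith)
      have : 0 ≤ m * (r ^ 2 * (Real.sin (t * δ / 2) * Real.sin ((1 - t) * δ / 2) *
        Real.sin (δ / 2))) := by positivity
      linarith
    · have s1 : 0 ≤ -Real.sin (t * δ / 2) := by
        rw [← Real.sin_neg]
        exact Real.sin_nonneg_of_nonneg_of_le_pi (by nlinarith) (by nlinarith)
      have s2 : 0 ≤ -Real.sin ((1 - t) * δ / 2) := by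
        rw [← Real.sin_neg]
        exact Real.sin_nonneg_of_nonneg_of_le_pi (by nlinarith) (by nlinarith)
      have s3 : 0 ≤ -Real.sin (δ / 2) := by
        rw [← Real.sin_neg]
        exact Real.sin_nonneg_of_nonneg_of_le_pi (by linarith) (by linarith)
      have hm' : 0 ≤ -m := by linarith
      have := mul_nonneg hm' (mul_nonneg r2 (mul_nonneg (mul_nonneg s1 s2) s3))
      linarith

lemma dist_sq_coord (x y : ℂ) : dist x y ^ 2 = (x.re - y.re) ^ 2 + (x.im - y.im) ^ 2 := by
  rw [Complex.dist_eq, Complex.sq_norm, Complex.normSq_apply]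
  simp only [Complex.sub_re, Complex.sub_im]
  ring

set_option maxHeartbeats 2000000

/-- Let `C` be a circle and `A`, `B` two circles perpendicular to `C` and to
each other, crossing at a point `p` inside `C`.  Within any one quadrant there is a circular
arc tangent to `C` at the point `q` where the quadrant's boundary arc of `C` meets `B`, and
tangent to `A` at `p`. -/
theorem exists_doubly_tangent_arc_in_quadrant
    (o A B p : ℂ) (R rA rB : ℝ) (hR : 0 < R) (hrA : 0 < rA) (hrB : 0 < rB)
    (hAC : dist A o ^ 2 = rA ^ 2 + R ^ 2)
    (hBC : dist B o ^ 2 = rB ^ 2 + R ^ 2)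
    (hAB : dist A B ^ 2 = rA ^ 2 + rB ^ 2)
    (hpA : dist p A = rA) (hpB : dist p B = rB) (hpo : dist p o < R)
    (sA sB : Bool)
    (q : ℂ) (hqC : dist q o = R) (hqB : dist q B = rB)
    (hqside : q ∈ (if sA then Metric.closedBall A rA else (Metric.ball A rA)ᶜ)) :
    ∃ (d : ℂ) (rd θ₀ θ₁ : ℝ), 0 < rd ∧
      (Piece.arc d rd θ₀ θ₁).Nondeg ∧
      (Piece.arc d rd θ₀ θ₁).source = p ∧
      (Piece.arc d rd θ₀ θ₁).target = q ∧
      (Piece.arc d rd θ₀ θ₁).image ⊆ quadrant o A B R rA rB sA sB ∧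
      lineAngle ((Piece.arc d rd θ₀ θ₁).tangent 1) (Complex.I * (q - o)) = 0 ∧
      lineAngle ((Piece.arc d rd θ₀ θ₁).tangent 0) (Complex.I * (p - A)) = 0 := by
  have hqpo : p ≠ q := by
    rintro rfl
    linarith
  have HAC := dist_sq_coord A o
  have HBC := dist_sq_coord B o
  have HAB := dist_sq_coord A B
  have HpA := dist_sq_coord p A
  have HpB := dist_sq_coord p B
  have Hpo := dist_sq_coord p o
  have HqC := dist_sq_coord q o
  have HqB := dist_sq_coord q B
  have Hqp := dist_sq_coord q p
  have HqA := dist_sq_coord q A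
  have hpo2 : dist p o ^ 2 < R ^ 2 :=
    pow_lt_pow_left₀ hpo dist_nonneg two_ne_zero
  have hqp0 : 0 < dist q p ^ 2 := by
    have := dist_pos.mpr hqpo.symm
    positivity
  rw [hAC] at HAC
  rw [hBC] at HBC
  rw [hAB] at HAB
  rw [hpA] at HpA
  rw [hpB] at HpB
  rw [hqC] at HqC
  rw [hqB] at HqB
  rw [Hpo] at hpo2
  rw [Hqp] at hqp0
  -- the radius ratio
  obtain ⟨N, hN⟩ : ∃ N : ℝ, N = (q.re - p.re) ^ 2 + (q.im - p.im) ^ 2 := ⟨_, rfl⟩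
  rw [← hN] at hqp0 Hqp
  obtain ⟨M, hM⟩ : ∃ M : ℝ,
      M = 2 * ((q.re - p.re) * (q.re - o.re) + (q.im - p.im) * (q.im - o.im)) := ⟨_, rfl⟩
  have hNM : N < M := by
    rw [hN, hM]; linear_combination hpo2 + HqC
  have hM0 : 0 < M := lt_trans hqp0 hNM
  obtain ⟨ρ, hρM, hρ0, hρ1⟩ : ∃ ρ : ℝ, ρ * M = N ∧ 0 < ρ ∧ ρ < 1 :=
    ⟨N / M, div_mul_cancel₀ _ hM0.ne', div_pos hqp0 hM0, (div_lt_one hM0).mpr hNM⟩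
  obtain ⟨d, hd⟩ : ∃ d : ℂ, d = q + (ρ : ℂ) * (o - q) := ⟨_, rfl⟩
  have hdre : d.re = q.re + ρ * (o.re - q.re) := by rw [hd]; simp
  have hdim : d.im = q.im + ρ * (o.im - q.im) := by rw [hd]; simp
  have hrd : 0 < ρ * R := mul_pos hρ0 hR
  have Hdq : dist q d ^ 2 = (ρ * R) ^ 2 := by
    rw [dist_sq_coord, hdre, hdim, mul_pow, HqC]; ring
  have Hdp : dist p d ^ 2 = (ρ * R) ^ 2 := by
    rw [dist_sq_coord, hdre, hdim, mul_pow, HqC]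
    rw [hN, hM] at hρM
    linear_combination -hρM
  have hdq : dist q d = ρ * R := by
    rwa [sq_eq_sq₀ dist_nonneg hrd.le] at Hdq
  have hdp : dist p d = ρ * R := by
    rwa [sq_eq_sq₀ dist_nonneg hrd.le] at Hdp
  have hdo : dist d o = (1 - ρ) * R := by
    have : dist d o ^ 2 = ((1 - ρ) * R) ^ 2 := by
      rw [dist_sq_coord, hdre, hdim, mul_pow, HqC]; ring
    rwa [sq_eq_sq₀ dist_nonneg (mul_nonneg (by linarith) hR.le)] at this
  rw [dist_sq_coord] at Hdq Hdp
  -- `d` lies on the tangents of `B` at `p` and `q`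
  have hqperp : (q.re - o.re) * (q.re - B.re) + (q.im - o.im) * (q.im - B.im) = 0 := by
    linear_combination (HBC - HqC - HqB) / 2
  have hqd : (q.re - d.re) * (q.re - B.re) + (q.im - d.im) * (q.im - B.im) = 0 := by
    rw [hdre, hdim]; linear_combination ρ * hqperp
  have hpd : (d.re - p.re) * (B.re - p.re) + (d.im - p.im) * (B.im - p.im) = 0 := by
    linear_combination (Hdp - Hdq) / 2 - (HpB - HqB) / 2 + hqd
  have hpAB : (A.re - p.re) * (B.re - p.re) + (A.im - p.im) * (B.im - p.im) = 0 := by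
    linear_combination (HAB - HpA - HpB) / 2
  have hB0 : 0 < rB ^ 2 := by positivity
  have hA0 : 0 < rA ^ 2 := by positivity
  have hcross : (d.re - p.re) * (A.im - p.im) - (d.im - p.im) * (A.re - p.re) = 0 := by
    have : rB ^ 2 * ((d.re - p.re) * (A.im - p.im) - (d.im - p.im) * (A.re - p.re)) = 0 := by
      rw [HpB]
      linear_combination ((B.re - p.re) * (A.im - p.im) - (B.im - p.im) * (A.re - p.re)) * hpd
        + ((B.im - p.im) * (d.re - p.re) - (B.re - p.re) * (d.im - p.im)) * hpAB
    exact (mul_eq_zero.mp this).resolve_left hB0.ne'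
  obtain ⟨k, hkre, hkim⟩ : ∃ k : ℝ, d.re - p.re = k * (A.re - p.re) ∧
      d.im - p.im = k * (A.im - p.im) := by
    refine ⟨((d.re - p.re) * (A.re - p.re) + (d.im - p.im) * (A.im - p.im)) / rA ^ 2, ?_, ?_⟩
    · field_simp
      rw [HpA]; linear_combination (A.im - p.im) * hcross
    · field_simp
      rw [HpA]; linear_combination -(A.re - p.re) * hcross
  have hk0 : k ≠ 0 := by
    rintro rfl
    have : (ρ * R) ^ 2 = 0 := by
      rw [← Hdp]; linear_combination (d.re - p.re) * hkre + (d.im - p.im) * hkim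
    have : 0 < (ρ * R) ^ 2 := by positivity
    linarith
  -- sides of `A`
  have hsideA : ∀ z : ℂ, dist z d = ρ * R →
      k * (dist z A ^ 2 - rA ^ 2) = (k - 1) * dist z p ^ 2 := by
    intro z hz
    have Hz := dist_sq_coord z d
    rw [hz] at Hz
    have e1 : d.re = p.re + k * (A.re - p.re) := by linarith
    have e2 : d.im = p.im + k * (A.im - p.im) := by linarith
    rw [dist_sq_coord, dist_sq_coord, HpA]
    rw [e1, e2] at Hz Hdp
    linear_combination -Hdp - Hz
  have hqside' := hsideA q hdq
  -- sides of `B`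
  have hperpB : (d.re - B.re) * (q.re - p.re) + (d.im - B.im) * (q.im - p.im) = 0 := by
    linear_combination (Hdp - Hdq) / 2 + (HpB - HqB) / 2
  obtain ⟨μ, hμ⟩ : ∃ μ : ℝ,
      μ = (q.re - p.re) * (d.im - B.im) - (q.im - p.im) * (d.re - B.re) := ⟨_, rfl⟩
  have hsideB : ∀ z : ℂ, dist z d = ρ * R →
      N * (dist z B ^ 2 - rB ^ 2) =
        2 * (μ * ((starRingEnd ℂ) (q - p) * (z - p)).im) := by
    intro z hz
    have Hz := dist_sq_coord z d
    rw [hz] at Hz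
    have : dist z B ^ 2 - rB ^ 2 =
        2 * ((d.re - B.re) * (z.re - p.re) + (d.im - B.im) * (z.im - p.im)) := by
      rw [dist_sq_coord]
      linear_combination -HpB - Hdp - Hz
    rw [this, hN, hμ]
    simp only [Complex.mul_im, Complex.conj_re, Complex.conj_im, Complex.sub_re, Complex.sub_im]
    linear_combination 2 * ((z.re - p.re) * (q.re - p.re) + (z.im - p.im) * (q.im - p.im)) * hperpB
  obtain ⟨α, δ, hδ0, hs, ht, himg⟩ := arc_exists p q d (ρ * R) (if sB then μ else -μ) hrd
    (by rw [← Complex.dist_eq]; exact hdp) (by rw [← Complex.dist_eq]; exact hdq) hqpo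
  refine ⟨d, ρ * R, α, α + δ, hrd, ⟨hrd.ne', ?_⟩, hs, ht, ?_, ?_, ?_⟩
  · intro h; apply hδ0; linarith
  · rintro _ ⟨t, htt, rfl⟩
    obtain ⟨hz, hzm⟩ := himg t htt
    generalize (Piece.arc d (ρ * R) α (α + δ)).toFun t = z at hz hzm ⊢
    rw [← Complex.dist_eq] at hz
    have hzA := hsideA z hz
    have hzB := hsideB z hz
    have hzpos : 0 ≤ dist z p ^ 2 := sq_nonneg _
    have hqpos : 0 < dist q p ^ 2 := by rw [Hqp]; exact hqp0
    have hrel : (dist z A ^ 2 - rA ^ 2) * dist q p ^ 2 =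
        (dist q A ^ 2 - rA ^ 2) * dist z p ^ 2 := by
      apply mul_left_cancel₀ hk0
      linear_combination dist q p ^ 2 * hzA - dist z p ^ 2 * hqside'
    refine ⟨⟨?_, ?_⟩, ?_⟩
    · rw [Metric.mem_closedBall]
      have := dist_triangle z d o
      rw [hz, hdo] at this
      linarith
    · cases sA
      · simp only [Bool.false_eq_true, if_false, Set.mem_compl_iff, Metric.mem_ball,
          not_lt] at hqside ⊢
        have h1 : 0 ≤ dist q A ^ 2 - rA ^ 2 :=
          sub_nonneg.mpr (pow_le_pow_left₀ hrA.le hqside 2)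
        have h2 : 0 ≤ dist z A ^ 2 - rA ^ 2 := by
          refine nonneg_of_mul_nonneg_left ?_ hqpos
          rw [hrel]; exact mul_nonneg h1 hzpos
        exact (sq_le_sq₀ hrA.le dist_nonneg).mp (by linarith)
      · simp only [if_true, Metric.mem_closedBall] at hqside ⊢
        have h0 := dist_nonneg (x := q) (y := A)
        have h1 : 0 ≤ rA ^ 2 - dist q A ^ 2 :=
          sub_nonneg.mpr (pow_le_pow_left₀ dist_nonneg hqside 2)
        have h2 : 0 ≤ rA ^ 2 - dist z A ^ 2 := by
          refine nonneg_of_mul_nonneg_left ?_ hqpos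
          have := mul_nonneg h1 hzpos
          linarith
        exact (sq_le_sq₀ dist_nonneg hrA.le).mp (by linarith)
    · cases sB
      · simp only [Bool.false_eq_true, if_false, Set.mem_compl_iff, Metric.mem_ball,
          not_lt] at hzm ⊢
        have h2 : 0 ≤ dist z B ^ 2 - rB ^ 2 := by
          refine nonneg_of_mul_nonneg_right ?_ hqp0
          rw [hzB]; linarith
        exact (sq_le_sq₀ hrB.le dist_nonneg).mp (by linarith)
      · simp only [if_true, Metric.mem_closedBall] at hzm ⊢
        have h2 : 0 ≤ rB ^ 2 - dist z B ^ 2 := by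
          refine nonneg_of_mul_nonneg_right ?_ hqp0
          linarith
        exact (sq_le_sq₀ dist_nonneg hrB.le).mp (by linarith)
  · have e : (Piece.arc d (ρ * R) α (α + δ)).tangent 1 =
        ((δ * ρ : ℝ) : ℂ) * (Complex.I * (q - o)) := by
      have e1 : (Piece.arc d (ρ * R) α (α + δ)).tangent 1 = (δ : ℂ) * Complex.I *
          ((Piece.arc d (ρ * R) α (α + δ)).toFun 1 - d) := by
        simp only [Piece.tangent, Piece.toFun, add_sub_cancel_left]; ring
      rw [e1, ht, hd]
      push_cast; ring
    rw [e]
    apply lineAngle_real_mul _ _ (mul_ne_zero hδ0 hρ0.ne')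
    apply mul_ne_zero Complex.I_ne_zero
    rw [sub_ne_zero]
    rintro rfl
    simp at hqC
    linarith
  · have e : (Piece.arc d (ρ * R) α (α + δ)).tangent 0 =
        ((δ * k : ℝ) : ℂ) * (Complex.I * (p - A)) := by
      have e1 : (Piece.arc d (ρ * R) α (α + δ)).tangent 0 = (δ : ℂ) * Complex.I *
          ((Piece.arc d (ρ * R) α (α + δ)).toFun 0 - d) := by
        simp only [Piece.tangent, Piece.toFun, add_sub_cancel_left]; ring
      have e2 : p - d = (k : ℂ) * (p - A) := by
        apply Complex.ext
        · simp; linarith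
        · simp; linarith
      rw [e1, hs, e2]
      push_cast; ring
    rw [e]
    apply lineAngle_real_mul _ _ (mul_ne_zero hδ0 hk0)
    apply mul_ne_zero Complex.I_ne_zero
    rw [sub_ne_zero]
    rintro rfl
    simp at hpA
    linarith
end
end

section
/- Given a circle C, a point p inside C, a point q on C in the same quadrant configuration (p and q separated by perpendicular circles A and B through p, both perpendicular to C), and a prescribed tangent direction at p lying strictly within the quadrant, there is a unique circular arc from p to q whose tangent direction at p is the prescribed one and which lies entirely within the closed quadrant. -/
open Set Metric

noncomputable section

/-- Real inner product in coordinates. -/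
def ipc (z w : ℂ) : ℝ := z.re * w.re + z.im * w.im

/-- Sign attached to a side. -/
def sgb (s : Bool) : ℝ := if s then 1 else -1

lemma dist_sq_ipc (z w : ℂ) : dist z w ^ 2 = ipc (z - w) (z - w) := by
  rw [Complex.dist_eq, ← Complex.normSq_eq_norm_sq, Complex.normSq_apply]; rfl

lemma norm_sq_ipc (z : ℂ) : ‖z‖ ^ 2 = ipc z z := by
  rw [← Complex.normSq_eq_norm_sq, Complex.normSq_apply]; rfl

lemma dist_sq_rel (z p A : ℂ) : dist z A ^ 2 - dist p A ^ 2 =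
    ipc (z - p) (z - p) - 2 * ipc (z - p) (A - p) := by
  simp only [dist_sq_ipc, ipc, Complex.sub_re, Complex.sub_im]; ring

lemma side_mem (z p A : ℂ) (r : ℝ) (hr : 0 < r) (hp : dist p A = r) (s : Bool) :
    z ∈ (if s then Metric.closedBall A r else (Metric.ball A r)ᶜ) ↔
      sgb s * (ipc (z - p) (z - p) - 2 * ipc (z - p) (A - p)) ≤ 0 := by
  rw [← dist_sq_rel, hp]
  have h0 : 0 ≤ dist z A := dist_nonneg
  cases s
  · simp only [sgb, Bool.false_eq_true, if_false, mem_compl_iff, Metric.mem_ball, not_lt]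
    constructor
    · intro h; nlinarith
    · intro h; nlinarith
  · simp only [sgb, if_true, Metric.mem_closedBall]
    constructor
    · intro h; nlinarith
    · intro h; nlinarith

lemma side_mem_strict (z p A : ℂ) (r : ℝ) (hr : 0 < r) (hp : dist p A = r) (s : Bool)
    (h : z ∈ (if s then Metric.ball A r else (Metric.closedBall A r)ᶜ)) :
      sgb s * (ipc (z - p) (z - p) - 2 * ipc (z - p) (A - p)) ≤ 0 := by
  rw [← side_mem z p A r hr hp]
  cases s
  · simp at h ⊢; exact h.le
  · simp at h ⊢; exact h.le

lemma lim_le (h : ℝ → ℝ) (hc : Continuous h) (ε : ℝ) (hε : 0 < ε)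
    (hh : ∀ t ∈ Set.Ioo 0 ε, h t ≤ 0) : h 0 ≤ 0 := by
  have h1 : Filter.Tendsto h (nhdsWithin 0 (Set.Ioi 0)) (nhds (h 0)) :=
    hc.continuousAt.tendsto.mono_left nhdsWithin_le_nhds
  refine le_of_tendsto h1 ?_
  filter_upwards [Ioo_mem_nhdsGT hε] with t ht using hh t ht

lemma parseval (a b x y : ℂ) (hab : ipc a b = 0) :
    ipc x y * (ipc a a * ipc b b) =
      ipc x a * ipc y a * ipc b b + ipc x b * ipc y b * ipc a a := by
  by_cases ha : ipc a a = 0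
  · have h1 : a.re = 0 := by
      simp only [ipc] at ha; nlinarith [sq_nonneg a.re, sq_nonneg a.im]
    have h2 : a.im = 0 := by
      simp only [ipc] at ha; nlinarith [sq_nonneg a.re, sq_nonneg a.im]
    simp [ipc, h1, h2]
  · obtain ⟨c, hc1, hc2⟩ : ∃ c : ℝ, b.re = -c * a.im ∧ b.im = c * a.re := by
      refine ⟨(a.re * b.im - a.im * b.re) / ipc a a, ?_, ?_⟩
      · field_simp
        simp only [ipc] at *
        linear_combination a.re * hab
      · field_simp
        simp only [ipc] at *
        linear_combination a.im * hab
    simp only [ipc, hc1, hc2]; ring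

/-- Key nonnegativity. -/
lemma key_nonneg (a b o q u : ℂ) (k ea eb : ℝ) (hk : 0 < k)
    (hea : ea * ea = 1) (heb : eb * eb = 1)
    (hab : ipc a b = 0) (ha : 0 < ipc a a) (hb : 0 < ipc b b)
    (hao : 2 * ipc o a = -k) (hbo : 2 * ipc o b = -k)
    (hqa : ea * (ipc q q - 2 * ipc q a) ≤ 0) (hqb : eb * (ipc q q - 2 * ipc q b) ≤ 0)
    (hua : 0 ≤ ea * ipc u a) (hub : 0 ≤ eb * ipc u b) :
    0 ≤ k * ipc q u + ipc q q * ipc u o := by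
  have h1 := parseval a b q u hab
  have h2 := parseval a b u o hab
  have h3 : 0 ≤ (2 * ipc q a - ipc q q) * ipc u a := by
    have : (2 * ipc q a - ipc q q) * ipc u a =
      (-(ea * (ipc q q - 2 * ipc q a))) * (ea * ipc u a) := by
      linear_combination (-(2 * ipc q a - ipc q q) * ipc u a) * hea
    rw [this]; exact mul_nonneg (by linarith) hua
  have h4 : 0 ≤ (2 * ipc q b - ipc q q) * ipc u b := by
    have : (2 * ipc q b - ipc q q) * ipc u b =
      (-(eb * (ipc q q - 2 * ipc q b))) * (eb * ipc u b) := by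
      linear_combination (-(2 * ipc q b - ipc q q) * ipc u b) * heb
    rw [this]; exact mul_nonneg (by linarith) hub
  have h5 : 2 * ((k * ipc q u + ipc q q * ipc u o) * (ipc a a * ipc b b)) =
      k * (ipc b b * ((2 * ipc q a - ipc q q) * ipc u a)
        + ipc a a * ((2 * ipc q b - ipc q q) * ipc u b)) := by
    linear_combination 2 * k * h1 + 2 * ipc q q * h2 + ipc q q * ipc u a * ipc b b * hao
      + ipc q q * ipc u b * ipc a a * hbo
  have h6 : 0 ≤ (k * ipc q u + ipc q q * ipc u o) * (ipc a a * ipc b b) := by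
    have : 0 ≤ k * (ipc b b * ((2 * ipc q a - ipc q q) * ipc u a)
        + ipc a a * ((2 * ipc q b - ipc q q) * ipc u b)) := by positivity
    linarith
  exact nonneg_of_mul_nonneg_left h6 (by positivity)

lemma ipc_comb (l m : ℝ) (q u a : ℂ) :
    ipc ((l : ℂ) * q + (m : ℂ) * u) a = l * ipc q a + m * ipc u a := by
  simp [ipc]; ring

lemma side_comb (e l m : ℝ) (q u a z : ℂ) (hz : z = (l : ℂ) * q + (m : ℂ) * u)
    (hn : ipc z z = l * ipc q q) (hl : 0 ≤ l) (hm : 0 ≤ m)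
    (hq : e * (ipc q q - 2 * ipc q a) ≤ 0) (hu : 0 ≤ e * ipc u a) :
    e * (ipc z z - 2 * ipc z a) ≤ 0 := by
  rw [hn, hz, ipc_comb]
  nlinarith [mul_nonneg hm hu, mul_nonneg hl (sub_nonneg.2 hq)]

lemma ball_comb (k l m : ℝ) (q u o z : ℂ) (hz : z = (l : ℂ) * q + (m : ℂ) * u)
    (hn : ipc z z = l * ipc q q) (hl : 0 ≤ l) (hm : 0 ≤ m) (hk : 0 < k)
    (hq : ipc q q - 2 * ipc q o = k) (hq0 : 0 < ipc q q)
    (hkey : 0 ≤ k * ipc q u + ipc q q * ipc u o) :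
    ipc z z - 2 * ipc z o ≤ k := by
  rcases hl.eq_or_lt with h0 | h0
  · have hz0 : ipc z z = 0 := by rw [hn, ← h0]; ring
    have h1 : z.re = 0 := by
      simp only [ipc] at hz0; nlinarith [sq_nonneg z.re, sq_nonneg z.im]
    have h2 : z.im = 0 := by
      simp only [ipc] at hz0; nlinarith [sq_nonneg z.re, sq_nonneg z.im]
    simp [ipc, h1, h2, hk.le]
  · have hexp : ipc z z = l ^ 2 * ipc q q + 2 * l * m * ipc q u + m ^ 2 * ipc u u := by
      rw [hz]; simp [ipc]; ring
    have hzo : ipc z o = l * ipc q o + m * ipc u o := by rw [hz, ipc_comb]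
    have hu : 0 ≤ ipc u u := by simp only [ipc]; nlinarith [sq_nonneg u.re, sq_nonneg u.im]
    have h : 0 ≤ (k - (ipc z z - 2 * ipc z o)) * (l * ipc q q) := by
      have : (k - (ipc z z - 2 * ipc z o)) * (l * ipc q q) =
        2 * (l * m) * (k * ipc q u + ipc q q * ipc u o) + k * m ^ 2 * ipc u u := by
        rw [hzo, hn]
        have := hexp
        rw [hn] at this
        linear_combination k * this - l^2 * ipc q q * hq
      rw [this]; positivity
    have := nonneg_of_mul_nonneg_left h (by positivity)
    linarith

lemma expI_half (x : ℝ) : -Complex.I * (Complex.exp (Complex.I * ((2 * x : ℝ) : ℂ)) - 1) =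
    ((2 * Real.sin x : ℝ) : ℂ) * Complex.exp (Complex.I * (x : ℂ)) := by
  rw [mul_comm Complex.I, mul_comm Complex.I, Complex.exp_mul_I, Complex.exp_mul_I]
  rw [← Complex.ofReal_cos, ← Complex.ofReal_sin, ← Complex.ofReal_cos, ← Complex.ofReal_sin]
  have := Real.sin_sq_add_cos_sq x
  rw [Real.sin_two_mul, Real.cos_two_mul]
  generalize Real.sin x = s at *
  generalize Real.cos x = c at *
  apply Complex.ext
  · simp only [Complex.mul_re, Complex.mul_im, Complex.add_re, Complex.add_im, Complex.sub_re,
      Complex.sub_im, Complex.neg_re, Complex.neg_im, Complex.I_re, Complex.I_im,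
      Complex.ofReal_re, Complex.ofReal_im, Complex.one_re, Complex.one_im]
    ring
  · simp only [Complex.mul_re, Complex.mul_im, Complex.add_re, Complex.add_im, Complex.sub_re,
      Complex.sub_im, Complex.neg_re, Complex.neg_im, Complex.I_re, Complex.I_im,
      Complex.ofReal_re, Complex.ofReal_im, Complex.one_re, Complex.one_im]
    linear_combination -2 * this

lemma dir_eq (v : ℂ) (θ : ℝ) (h : dirAngle v = (θ : Real.Angle)) :
    v = (‖v‖ : ℂ) * Complex.exp (Complex.I * (θ : ℂ)) := by
  have h1 : Complex.exp (Complex.I * (θ : ℂ)) = Complex.exp (Complex.arg v * Complex.I) := by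
    rw [mul_comm]
    unfold dirAngle at h
    have hc : Real.cos (Complex.arg v) = Real.cos θ := by
      rw [← Real.Angle.cos_coe, ← Real.Angle.cos_coe, h]
    have hs : Real.sin (Complex.arg v) = Real.sin θ := by
      rw [← Real.Angle.sin_coe, ← Real.Angle.sin_coe, h]
    rw [Complex.exp_mul_I, Complex.exp_mul_I, ← Complex.ofReal_cos, ← Complex.ofReal_sin,
      ← Complex.ofReal_cos, ← Complex.ofReal_sin, hc, hs]
  rw [h1, Complex.norm_mul_exp_arg_mul_I]

lemma dir_of_pos (x θ : ℝ) (hx : 0 < x) :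
    dirAngle ((x : ℂ) * Complex.exp (Complex.I * (θ : ℂ))) = (θ : Real.Angle) := by
  unfold dirAngle
  rw [mul_comm Complex.I, Complex.exp_mul_I]
  simpa using Complex.arg_mul_cos_add_sin_mul_I_coe_angle hx (θ : Real.Angle)

lemma arc_form (c p : ℂ) (r θ₀ θ₁ θ : ℝ) (hn : (Piece.arc c r θ₀ θ₁).Nondeg)
    (hs : (Piece.arc c r θ₀ θ₁).source = p)
    (hd : dirAngle ((Piece.arc c r θ₀ θ₁).tangent 0) = (θ : Real.Angle)) :
    ∃ ρ ψ : ℝ, 0 < ρ * ψ ∧ ∀ t : ℝ, (Piece.arc c r θ₀ θ₁).toFun t =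
      p + ((2 * ρ * Real.sin (ψ * t) : ℝ) : ℂ) * Complex.exp (Complex.I * ((ψ * t : ℝ) : ℂ))
        * Complex.exp (Complex.I * (θ : ℂ)) := by
  obtain ⟨hr, hθ⟩ := hn
  have hφ : θ₁ - θ₀ ≠ 0 := sub_ne_zero.2 (Ne.symm hθ)
  have hv := dir_eq _ _ hd
  simp only [Piece.tangent, zero_mul, add_zero, Piece.source, Piece.toFun] at hv hs
  set E := Complex.exp (Complex.I * (θ₀ : ℂ)) with hE
  set U := Complex.exp (Complex.I * (θ : ℂ)) with hU
  set N := ‖(r : ℂ) * ((θ₁ - θ₀ : ℝ) : ℂ) * Complex.I * E‖ with hN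
  have hNpos : 0 < N := by
    rw [hN]
    apply norm_pos_iff.2
    have : ((θ₁ - θ₀ : ℝ) : ℂ) ≠ 0 := by exact_mod_cast hφ
    have h2 : (r : ℂ) ≠ 0 := by exact_mod_cast hr
    exact mul_ne_zero (mul_ne_zero (mul_ne_zero h2 this) Complex.I_ne_zero) (Complex.exp_ne_zero _)
  have hφ' : ((θ₁ - θ₀ : ℝ) : ℂ) ≠ 0 := by exact_mod_cast hφ
  refine ⟨N / (θ₁ - θ₀), (θ₁ - θ₀) / 2, ?_, ?_⟩
  · have : N / (θ₁ - θ₀) * ((θ₁ - θ₀) / 2) = N / 2 := by field_simp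
    rw [this]; positivity
  · intro t
    have hrE : (r : ℂ) * E = -Complex.I * ((N / (θ₁ - θ₀) : ℝ) : ℂ) * U := by
      have h3 : ((N / (θ₁ - θ₀) : ℝ) : ℂ) * ((θ₁ - θ₀ : ℝ) : ℂ) = (N : ℂ) := by
        rw [← Complex.ofReal_mul]; congr 1; field_simp
      apply mul_right_cancel₀ hφ'
      have hI := Complex.I_sq
      linear_combination (-Complex.I) * hv + (r : ℂ) * ((θ₁ - θ₀ : ℝ) : ℂ) * E * hI
        + Complex.I * U * h3
    have he := expI_half ((θ₁ - θ₀) / 2 * t)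
    have h2 : 2 * ((θ₁ - θ₀) / 2 * t) = t * (θ₁ - θ₀) := by ring
    rw [h2] at he
    simp only [Piece.toFun]
    have h4 : Complex.exp (Complex.I * ((θ₀ + t * (θ₁ - θ₀) : ℝ) : ℂ)) =
        E * Complex.exp (Complex.I * ((t * (θ₁ - θ₀) : ℝ) : ℂ)) := by
      rw [hE, ← Complex.exp_add]; congr 1; push_cast; ring
    rw [h4]
    have h5 : ((2 * (N / (θ₁ - θ₀)) * Real.sin ((θ₁ - θ₀) / 2 * t) : ℝ) : ℂ) =
      ((N / (θ₁ - θ₀) : ℝ) : ℂ) * ((2 * Real.sin ((θ₁ - θ₀) / 2 * t) : ℝ) : ℂ) := by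
      rw [← Complex.ofReal_mul]; congr 1; ring
    rw [h5]
    linear_combination hs + (Complex.exp (Complex.I * ((t * (θ₁ - θ₀) : ℝ) : ℂ)) - 1) * hrE
      + ((N / (θ₁ - θ₀) : ℝ) : ℂ) * U * he

/-- Canonical parameterization. -/
def canon (p q : ℂ) (θ : ℝ) (t : ℝ) : ℂ :=
  let U := Complex.exp (Complex.I * (θ : ℂ))
  let α := Complex.arg ((q - p) / U)
  if α = 0 then p + (t : ℂ) * (q - p) else
    p + ((‖(q - p) / U‖ / Real.sin α * Real.sin (α * t) : ℝ) : ℂ)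
      * Complex.exp (Complex.I * ((α * t : ℝ) : ℂ)) * U

lemma arc_canon (p q : ℂ) (θ ρ ψ : ℝ) (hρ : 0 < ρ * ψ) (h1 : -Real.pi < ψ) (h2 : ψ < Real.pi)
    (hq : q = p + ((2 * ρ * Real.sin ψ : ℝ) : ℂ) * Complex.exp (Complex.I * (ψ : ℂ))
        * Complex.exp (Complex.I * (θ : ℂ))) (t : ℝ) :
    p + ((2 * ρ * Real.sin (ψ * t) : ℝ) : ℂ) * Complex.exp (Complex.I * ((ψ * t : ℝ) : ℂ))
        * Complex.exp (Complex.I * (θ : ℂ)) = canon p q θ t := by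
  have hU : Complex.exp (Complex.I * (θ : ℂ)) ≠ 0 := Complex.exp_ne_zero _
  have hψ0 : ψ ≠ 0 := by rintro rfl; simp at hρ
  have hpos : 0 < 2 * ρ * Real.sin ψ := by
    rcases lt_or_gt_of_ne hψ0 with h | h
    · have hr : ρ < 0 := by nlinarith
      nlinarith [Real.sin_neg_of_neg_of_neg_pi_lt h h1]
    · have hr : 0 < ρ := by nlinarith
      have := Real.sin_pos_of_pos_of_lt_pi h h2
      positivity
  have hζ : (q - p) / Complex.exp (Complex.I * (θ : ℂ)) =
      ((2 * ρ * Real.sin ψ : ℝ) : ℂ) * Complex.exp (Complex.I * (ψ : ℂ)) := by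
    rw [div_eq_iff hU, hq]; ring
  have harg : Complex.arg ((q - p) / Complex.exp (Complex.I * (θ : ℂ))) = ψ := by
    rw [hζ, mul_comm Complex.I, Complex.exp_mul_I,
      Complex.arg_mul_cos_add_sin_mul_I hpos ⟨h1, h2.le⟩]
  have hnorm : ‖(q - p) / Complex.exp (Complex.I * (θ : ℂ))‖ = 2 * ρ * Real.sin ψ := by
    rw [hζ, norm_mul, mul_comm Complex.I, Complex.norm_exp_ofReal_mul_I, mul_one,
      Complex.norm_real, Real.norm_of_nonneg hpos.le]
  have hs : Real.sin ψ ≠ 0 := by intro h; rw [h] at hpos; simp at hpos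
  simp only [canon, harg, hnorm, if_neg hψ0]
  rw [mul_div_cancel_right₀ _ hs]

lemma canon_exists (p q : ℂ) (θ : ℝ) (hqp : q ≠ p)
    (hα : Complex.arg ((q - p) / Complex.exp (Complex.I * (θ : ℂ))) ≠ Real.pi) :
    ∃ P : Piece, P.Nondeg ∧ P.source = p ∧ P.target = q ∧
      dirAngle (P.tangent 0) = (θ : Real.Angle) ∧ ∀ t, P.toFun t = canon p q θ t := by
  have hU : Complex.exp (Complex.I * (θ : ℂ)) ≠ 0 := Complex.exp_ne_zero _
  set U := Complex.exp (Complex.I * (θ : ℂ)) with hUd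
  set ζ := (q - p) / U with hζ
  set α := Complex.arg ζ with hαd
  have hζ0 : ζ ≠ 0 := div_ne_zero (sub_ne_zero.2 hqp) hU
  have hn0 : 0 < ‖ζ‖ := norm_pos_iff.2 hζ0
  have hq : q = p + (‖ζ‖ : ℂ) * Complex.exp (Complex.I * (α : ℂ)) * U := by
    rw [mul_comm Complex.I, hαd, Complex.norm_mul_exp_arg_mul_I, hζ, div_mul_cancel₀ _ hU]; ring
  by_cases h0 : α = 0
  · refine ⟨Piece.seg p q, Ne.symm hqp, by simp [Piece.source, Piece.toFun],
      by simp [Piece.target, Piece.toFun], ?_, ?_⟩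
    · have : q - p = (‖ζ‖ : ℂ) * U := by rw [h0] at hq; simp at hq; linear_combination hq
      simp only [Piece.tangent]
      rw [this]
      exact dir_of_pos _ _ hn0
    · intro t
      simp only [Piece.toFun, canon, ← hUd, ← hζ, ← hαd, if_pos h0]
  · have h1 : -Real.pi < α := Complex.neg_pi_lt_arg _
    have h2 : α < Real.pi := lt_of_le_of_ne (Complex.arg_le_pi _) hα
    have hsα : 0 < Real.sin α * α := by
      rcases lt_or_gt_of_ne h0 with h | h
      · exact mul_pos_of_neg_of_neg (Real.sin_neg_of_neg_of_neg_pi_lt h h1) h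
      · exact mul_pos (Real.sin_pos_of_pos_of_lt_pi h h2) h
    have hs : Real.sin α ≠ 0 := by intro h; rw [h] at hsα; simp at hsα
    set ρ := ‖ζ‖ / (2 * Real.sin α) with hρ
    have hρα : 0 < ρ * α := by
      have : ρ * α = ‖ζ‖ * (Real.sin α * α) / (2 * Real.sin α ^ 2) := by
        rw [hρ]; field_simp
      rw [this]; positivity
    have hρ0 : ρ ≠ 0 := by intro h; rw [h] at hρα; simp at hρα
    have hE : Complex.I * Complex.exp (Complex.I * ((θ - Real.pi / 2 : ℝ) : ℂ)) = U := by
      have e1 : Complex.exp (Complex.I * (θ : ℂ)) =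
          Complex.exp (Real.pi / 2 * Complex.I) *
            Complex.exp (Complex.I * ((θ - Real.pi / 2 : ℝ) : ℂ)) := by
        rw [← Complex.exp_add]; congr 1; push_cast; ring
      rw [hUd, e1, Complex.exp_pi_div_two_mul_I]
    have hnd : (Piece.arc (p - ρ * Complex.exp (Complex.I * ((θ - Real.pi / 2 : ℝ) : ℂ))) ρ
        (θ - Real.pi / 2) (θ - Real.pi / 2 + 2 * α)).Nondeg := by
      refine ⟨hρ0, ?_⟩
      intro h; apply h0; linarith
    have hsrc : (Piece.arc (p - ρ * Complex.exp (Complex.I * ((θ - Real.pi / 2 : ℝ) : ℂ))) ρ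
        (θ - Real.pi / 2) (θ - Real.pi / 2 + 2 * α)).source = p := by
      simp [Piece.source, Piece.toFun]
    have hform : ∀ t : ℝ, (Piece.arc (p - ρ * Complex.exp
        (Complex.I * ((θ - Real.pi / 2 : ℝ) : ℂ))) ρ
        (θ - Real.pi / 2) (θ - Real.pi / 2 + 2 * α)).toFun t = 
        p + ((2 * ρ * Real.sin (α * t) : ℝ) : ℂ) * Complex.exp (Complex.I * ((α * t : ℝ) : ℂ))
        * U := by
      intro t
      simp only [Piece.toFun]
      have h4 : Complex.exp (Complex.I * ((θ - Real.pi / 2 +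
            t * (θ - Real.pi / 2 + 2 * α - (θ - Real.pi / 2)) : ℝ) : ℂ)) =
          Complex.exp (Complex.I * ((θ - Real.pi / 2 : ℝ) : ℂ)) *
            Complex.exp (Complex.I * ((2 * (α * t) : ℝ) : ℂ)) := by
        rw [← Complex.exp_add]; congr 1; push_cast; ring
      rw [h4]
      have he := expI_half (α * t)
      have h5 : ((2 * ρ * Real.sin (α * t) : ℝ) : ℂ) =
        (ρ : ℂ) * ((2 * Real.sin (α * t) : ℝ) : ℂ) := by
        rw [← Complex.ofReal_mul]; congr 1; ring
      rw [h5, ← hE]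
      have hI := Complex.I_sq
      set E := Complex.exp (Complex.I * ((θ - Real.pi / 2 : ℝ) : ℂ))
      set F := Complex.exp (Complex.I * ((2 * (α * t) : ℝ) : ℂ))
      linear_combination (ρ : ℂ) * (Complex.I * E) * he + ρ * E * (F - 1) * hI
    have h2ρ : 2 * ρ * Real.sin α = ‖ζ‖ := by rw [hρ]; field_simp
    have hcan : ∀ t : ℝ, (Piece.arc (p - ρ * Complex.exp
        (Complex.I * ((θ - Real.pi / 2 : ℝ) : ℂ))) ρ
        (θ - Real.pi / 2) (θ - Real.pi / 2 + 2 * α)).toFun t = canon p q θ t := by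
      intro t
      rw [hform t]
      apply arc_canon p q θ ρ α hρα h1 h2
      rw [h2ρ]; exact hq
    refine ⟨_, hnd, hsrc, ?_, ?_, hcan⟩
    · rw [Piece.target, hform 1, mul_one, h2ρ, ← hq]
    · have : (Piece.arc (p - ρ * Complex.exp (Complex.I * ((θ - Real.pi / 2 : ℝ) : ℂ))) ρ
        (θ - Real.pi / 2) (θ - Real.pi / 2 + 2 * α)).tangent 0 = ((2 * (ρ * α) : ℝ) : ℂ) * U := by
        simp only [Piece.tangent, zero_mul, add_zero]
        rw [← hE]; push_cast; ring
      rw [this]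
      exact dir_of_pos _ _ (by positivity)

lemma canon_comb (p q : ℂ) (θ t : ℝ) (hqp : q ≠ p)
    (hα : Complex.arg ((q - p) / Complex.exp (Complex.I * (θ : ℂ))) ≠ Real.pi)
    (ht : t ∈ Set.Icc (0 : ℝ) 1) :
    ∃ l m : ℝ, 0 ≤ l ∧ 0 ≤ m ∧
      canon p q θ t - p = (l : ℂ) * (q - p) + (m : ℂ) * Complex.exp (Complex.I * (θ : ℂ)) ∧
      ipc (canon p q θ t - p) (canon p q θ t - p) = l * ipc (q - p) (q - p) := by
  obtain ⟨ht0, ht1⟩ := ht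
  have hU : Complex.exp (Complex.I * (θ : ℂ)) ≠ 0 := Complex.exp_ne_zero _
  have hUn : ‖Complex.exp (Complex.I * (θ : ℂ))‖ = 1 := by
    rw [mul_comm, Complex.norm_exp_ofReal_mul_I]
  set U := Complex.exp (Complex.I * (θ : ℂ)) with hUd
  set ζ := (q - p) / U with hζ
  set α := Complex.arg ζ with hαd
  have hζ0 : ζ ≠ 0 := div_ne_zero (sub_ne_zero.2 hqp) hU
  have hn0 : 0 < ‖ζ‖ := norm_pos_iff.2 hζ0
  have hq : q - p = (‖ζ‖ : ℂ) * Complex.exp (Complex.I * (α : ℂ)) * U := by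
    rw [mul_comm Complex.I, hαd, Complex.norm_mul_exp_arg_mul_I, hζ, div_mul_cancel₀ _ hU]
  have hqn : ipc (q - p) (q - p) = ‖ζ‖ ^ 2 := by
    rw [← norm_sq_ipc, hζ, norm_div, hUn, div_one]
  by_cases h0 : α = 0
  · have hc : canon p q θ t - p = (t : ℂ) * (q - p) := by
      simp only [canon, ← hUd, ← hζ, ← hαd, if_pos h0]; ring
    refine ⟨t ^ 2, t * (1 - t) * ‖ζ‖, by positivity,
      mul_nonneg (mul_nonneg ht0 (by linarith)) hn0.le, ?_, ?_⟩
    · rw [hc]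
      have : q - p = (‖ζ‖ : ℂ) * U := by rw [h0] at hq; simpa using hq
      rw [this]; push_cast; ring
    · rw [hc]; simp [ipc]; ring
  · have h1 : -Real.pi < α := Complex.neg_pi_lt_arg _
    have h2 : α < Real.pi := lt_of_le_of_ne (Complex.arg_le_pi _) hα
    have hs : Real.sin α ≠ 0 := by
      rcases lt_or_gt_of_ne h0 with h | h
      · exact (Real.sin_neg_of_neg_of_neg_pi_lt h h1).ne
      · exact (Real.sin_pos_of_pos_of_lt_pi h h2).ne'
    have hss : 0 ≤ Real.sin (α * t) * Real.sin (α * (1 - t)) := by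
      rcases lt_or_gt_of_ne h0 with h | h
      · apply mul_nonneg_of_nonpos_of_nonpos
        · apply Real.sin_nonpos_of_nonpos_of_neg_pi_le <;> nlinarith
        · apply Real.sin_nonpos_of_nonpos_of_neg_pi_le <;> nlinarith
      · apply mul_nonneg
        · apply Real.sin_nonneg_of_nonneg_of_le_pi <;> nlinarith
        · apply Real.sin_nonneg_of_nonneg_of_le_pi <;> nlinarith
    have hc : canon p q θ t - p = ((‖ζ‖ / Real.sin α * Real.sin (α * t) : ℝ) : ℂ)
      * Complex.exp (Complex.I * ((α * t : ℝ) : ℂ)) * U := by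
      simp only [canon, ← hUd, ← hζ, ← hαd, if_neg h0]; ring
    refine ⟨(Real.sin (α * t) / Real.sin α) ^ 2,
      ‖ζ‖ * (Real.sin (α * t) * Real.sin (α * (1 - t))) / Real.sin α ^ 2,
      by positivity, by positivity, ?_, ?_⟩
    · rw [hc, hq]
      have hid : (Real.sin α : ℂ) * Complex.exp (Complex.I * ((α * t : ℝ) : ℂ)) =
          Real.sin (α * t) * Complex.exp (Complex.I * (α : ℂ)) + Real.sin (α * (1 - t)) := by
        have e : α * (1 - t) = α - α * t := by ring
        rw [e, Real.sin_sub, mul_comm Complex.I, mul_comm Complex.I, Complex.exp_mul_I,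
          Complex.exp_mul_I, ← Complex.ofReal_cos, ← Complex.ofReal_sin,
          ← Complex.ofReal_cos, ← Complex.ofReal_sin]
        push_cast; ring
      have hs' : (Real.sin α : ℂ) ≠ 0 := by exact_mod_cast hs
      generalize Complex.exp (Complex.I * ((α * t : ℝ) : ℂ)) = X at *
      generalize Complex.exp (Complex.I * (α : ℂ)) = Y at *
      rw [Complex.ofReal_mul, Complex.ofReal_div, Complex.ofReal_pow, Complex.ofReal_div,
        Complex.ofReal_div, Complex.ofReal_mul, Complex.ofReal_mul, Complex.ofReal_pow]
      generalize (Real.sin α : ℂ) = S at *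
      generalize (Real.sin (α * t) : ℂ) = S1 at *
      generalize (Real.sin (α * (1 - t)) : ℂ) = S2 at *
      field_simp
      linear_combination (‖ζ‖ : ℂ) * S1 * hid
    · rw [hqn, hc, ← norm_sq_ipc, norm_mul, norm_mul, hUn, mul_comm Complex.I,
        Complex.norm_exp_ofReal_mul_I, Complex.norm_real, Real.norm_eq_abs, mul_one, mul_one,
        sq_abs]
      field_simp

lemma back_limit (κ s e : ℝ) (U a : ℂ) (hκ : 0 < κ)
    (h : ∀ ε ∈ Set.Ioo 0 Real.pi, ∀ z : ℂ,
      z = -((2 * κ * Real.sin ε : ℝ) : ℂ) * (Complex.exp (Complex.I * ((-(s * ε) : ℝ) : ℂ)) * U) →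
      e * (ipc z z - 2 * ipc z a) ≤ 0) : e * ipc U a ≤ 0 := by
  have hlim := lim_le (fun ε => e * (2 * κ * Real.sin ε *
      ipc (Complex.exp (Complex.I * ((-(s * ε) : ℝ) : ℂ)) * U)
        (Complex.exp (Complex.I * ((-(s * ε) : ℝ) : ℂ)) * U) +
      2 * ipc (Complex.exp (Complex.I * ((-(s * ε) : ℝ) : ℂ)) * U) a)) ?_ Real.pi Real.pi_pos ?_
  · simp at hlim; linarith
  · unfold ipc
    fun_prop
  · intro ε hε
    have hy : 0 < 2 * κ * Real.sin ε := by
      have := Real.sin_pos_of_pos_of_lt_pi hε.1 hε.2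
      positivity
    have h1 := h ε hε _ rfl
    generalize 2 * κ * Real.sin ε = y at *
    generalize Complex.exp (Complex.I * ((-(s * ε) : ℝ) : ℂ)) * U = V at *
    have h2 : ipc (-(y : ℂ) * V) (-(y : ℂ) * V) = y ^ 2 * ipc V V := by simp [ipc]; ring
    have h3 : ipc (-(y : ℂ) * V) a = - y * ipc V a := by simp [ipc]; ring
    rw [h2, h3] at h1
    by_contra hc
    push Not at hc
    nlinarith [mul_pos hy hc]

lemma dir_side (e : ℝ) (U a : ℂ) (ε : ℝ) (hε : 0 < ε)
    (h : ∀ t ∈ Set.Ioo (0 : ℝ) ε,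
      e * (ipc ((t : ℂ) * U) ((t : ℂ) * U) - 2 * ipc ((t : ℂ) * U) a) ≤ 0) :
    0 ≤ e * ipc U a := by
  have hlim := lim_le (fun t => e * (t * ipc U U - 2 * ipc U a)) (by fun_prop) ε hε ?_
  · simp at hlim; linarith
  · intro t ht
    have h1 := h t ht
    have h2 : ipc ((t : ℂ) * U) ((t : ℂ) * U) = t ^ 2 * ipc U U := by simp [ipc]; ring
    have h3 : ipc ((t : ℂ) * U) a = t * ipc U a := by simp [ipc]; ring
    rw [h2, h3] at h1
    by_contra hc
    push Not at hc
    nlinarith [mul_pos ht.1 hc]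

lemma long_form (ρ ψ ε : ℝ) (U : ℂ) (hψ : Real.pi ≤ |ψ|) (hρ : 0 < ρ * ψ)
    (hε : ε ∈ Set.Ioo 0 Real.pi) :
    ∃ t ∈ Set.Icc (0 : ℝ) 1, ((2 * ρ * Real.sin (ψ * t) : ℝ) : ℂ)
        * Complex.exp (Complex.I * ((ψ * t : ℝ) : ℂ)) * U =
      -((2 * |ρ| * Real.sin ε : ℝ) : ℂ) *
        (Complex.exp (Complex.I * ((-((ψ / |ψ|) * ε) : ℝ) : ℂ)) * U) := by
  obtain ⟨h1, h2⟩ := hε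
  have hpi := Real.pi_pos
  have hpos : 0 < |ψ| := by linarith
  refine ⟨(Real.pi - ε) / |ψ|, ⟨div_nonneg (by linarith) hpos.le,
    (div_le_one hpos).2 (by linarith)⟩, ?_⟩
  have hψ0 : ψ ≠ 0 := abs_pos.1 hpos
  rcases lt_or_gt_of_ne hψ0 with h | h
  · have hr : ρ < 0 := by nlinarith
    have e1 : ψ * ((Real.pi - ε) / |ψ|) = ε - Real.pi := by
      rw [abs_of_neg h]; field_simp; ring
    have e2 : ψ / |ψ| = -1 := by rw [abs_of_neg h]; field_simp
    rw [e1, e2, abs_of_neg hr, Real.sin_sub_pi]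
    have e3 : Complex.exp (Complex.I * ((ε - Real.pi : ℝ) : ℂ)) =
        - Complex.exp (Complex.I * ((-(-1 * ε) : ℝ) : ℂ)) := by
      have : Complex.I * ((ε - Real.pi : ℝ) : ℂ) =
        Complex.I * ((-(-1 * ε) : ℝ) : ℂ) - Real.pi * Complex.I := by push_cast; ring
      rw [this, Complex.exp_sub, Complex.exp_pi_mul_I, div_neg, div_one]
    rw [e3]; push_cast; ring
  · have hr : 0 < ρ := by nlinarith
    have e1 : ψ * ((Real.pi - ε) / |ψ|) = Real.pi - ε := by
      rw [abs_of_pos h]; field_simp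
    have e2 : ψ / |ψ| = 1 := by rw [abs_of_pos h]; field_simp
    rw [e1, e2, abs_of_pos hr, Real.sin_pi_sub]
    have e3 : Complex.exp (Complex.I * ((Real.pi - ε : ℝ) : ℂ)) =
        - Complex.exp (Complex.I * ((-(1 * ε) : ℝ) : ℂ)) := by
      have : Complex.I * ((Real.pi - ε : ℝ) : ℂ) =
        Complex.I * ((-(1 * ε) : ℝ) : ℂ) + Real.pi * Complex.I := by push_cast; ring
      rw [this, Complex.exp_add, Complex.exp_pi_mul_I]; simp
    rw [e3]; push_cast; ring

lemma sgb_sq (s : Bool) : sgb s * sgb s = 1 := by cases s <;> simp [sgb]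

/-- Given a circle `C` (center `o`, radius `R`), a point `p` inside `C` at
the crossing of two circles `A`, `B` perpendicular to each other and to `C`, a point `q` of
`C` strictly inside the chosen quadrant, and a prescribed tangent direction `θ` at `p`
pointing strictly into the quadrant, there is a circular arc (or segment) from `p` to `q`
with tangent direction `θ` at `p` lying entirely within the closed quadrant, and it is unique
(any two such have the same trace). -/
theorem unique_arc_in_quadrant
    (o A B p : ℂ) (R rA rB : ℝ) (hR : 0 < R) (hrA : 0 < rA) (hrB : 0 < rB)
    (hAC : dist A o ^ 2 = rA ^ 2 + R ^ 2)
    (hBC : dist B o ^ 2 = rB ^ 2 + R ^ 2)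
    (hAB : dist A B ^ 2 = rA ^ 2 + rB ^ 2)
    (hpA : dist p A = rA) (hpB : dist p B = rB) (hpo : dist p o < R)
    (sA sB : Bool)
    (q : ℂ) (hqC : dist q o = R)
    (hqA : q ∈ (if sA then Metric.ball A rA else (Metric.closedBall A rA)ᶜ))
    (hqB : q ∈ (if sB then Metric.ball B rB else (Metric.closedBall B rB)ᶜ))
    (θ : ℝ)
    (hdir : ∃ ε > (0 : ℝ), ∀ t ∈ Set.Ioo (0 : ℝ) ε,
      p + (t : ℂ) * Complex.exp (Complex.I * (θ : ℂ)) ∈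
        interior (quadrant o A B R rA rB sA sB)) :
    ∃ P : Piece, P.Nondeg ∧ P.source = p ∧ P.target = q ∧
      dirAngle (P.tangent 0) = (θ : Real.Angle) ∧
      P.image ⊆ quadrant o A B R rA rB sA sB ∧
      ∀ P' : Piece, P'.Nondeg → P'.source = p → P'.target = q →
        dirAngle (P'.tangent 0) = (θ : Real.Angle) →
        P'.image ⊆ quadrant o A B R rA rB sA sB →
        P'.image = P.image := by
  obtain ⟨ε, hε, hdir⟩ := hdir
  have hUn : ‖Complex.exp (Complex.I * (θ : ℂ))‖ = 1 := by
    rw [mul_comm, Complex.norm_exp_ofReal_mul_I]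
  have hmem : ∀ z : ℂ, z ∈ quadrant o A B R rA rB sA sB ↔
      (ipc (z - p) (z - p) - 2 * ipc (z - p) (o - p) ≤ R ^ 2 - dist p o ^ 2 ∧
      sgb sA * (ipc (z - p) (z - p) - 2 * ipc (z - p) (A - p)) ≤ 0) ∧
      sgb sB * (ipc (z - p) (z - p) - 2 * ipc (z - p) (B - p)) ≤ 0 := by
    intro z
    unfold quadrant
    rw [mem_inter_iff, mem_inter_iff, side_mem z p A rA hrA hpA, side_mem z p B rB hrB hpB,
      ← dist_sq_rel z p o, Metric.mem_closedBall]
    have : dist z o ≤ R ↔ dist z o ^ 2 - dist p o ^ 2 ≤ R ^ 2 - dist p o ^ 2 := by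
      rw [sub_le_sub_iff_right]
      exact (pow_le_pow_iff_left₀ dist_nonneg hR.le two_ne_zero).symm
    rw [this]
  have hqa := side_mem_strict q p A rA hrA hpA sA hqA
  have hqb := side_mem_strict q p B rB hrB hpB sB hqB
  have hk : 0 < R ^ 2 - dist p o ^ 2 := by
    have : 0 ≤ dist p o := dist_nonneg
    nlinarith
  have hqo : ipc (q - p) (q - p) - 2 * ipc (q - p) (o - p) = R ^ 2 - dist p o ^ 2 := by
    rw [← dist_sq_rel, hqC]
  set U := Complex.exp (Complex.I * (θ : ℂ)) with hU
  have hUU : ipc U U = 1 := by rw [← norm_sq_ipc, hUn]; norm_num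
  have hua : 0 ≤ sgb sA * ipc U (A - p) := by
    refine dir_side _ _ _ ε hε fun t ht => ?_
    have := ((hmem _).1 (interior_subset (hdir t ht))).1.2
    simpa using this
  have hub : 0 ≤ sgb sB * ipc U (B - p) := by
    refine dir_side _ _ _ ε hε fun t ht => ?_
    have := ((hmem _).1 (interior_subset (hdir t ht))).2
    simpa using this
  have haa : ipc (A - p) (A - p) = rA ^ 2 := by rw [← dist_sq_ipc, dist_comm, hpA]
  have hbb : ipc (B - p) (B - p) = rB ^ 2 := by rw [← dist_sq_ipc, dist_comm, hpB]
  have hab : ipc (A - p) (B - p) = 0 := by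
    have h := dist_sq_rel A p B
    rw [hAB, hpB, haa] at h; linarith
  have hoa : 2 * ipc (o - p) (A - p) = -(R ^ 2 - dist p o ^ 2) := by
    have h := dist_sq_rel A p o
    rw [hAC, haa] at h
    have h' : ipc (A - p) (o - p) = ipc (o - p) (A - p) := by unfold ipc; ring
    rw [h'] at h; linarith
  have hob : 2 * ipc (o - p) (B - p) = -(R ^ 2 - dist p o ^ 2) := by
    have h := dist_sq_rel B p o
    rw [hBC, hbb] at h
    have h' : ipc (B - p) (o - p) = ipc (o - p) (B - p) := by unfold ipc; ring
    rw [h'] at h; linarith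
  have hkey := key_nonneg (A - p) (B - p) (o - p) (q - p) U _ _ _ hk (sgb_sq sA) (sgb_sq sB)
    hab (by rw [haa]; positivity) (by rw [hbb]; positivity) hoa hob hqa hqb hua hub
  have hqp : q ≠ p := by rintro rfl; exact absurd hqC hpo.ne
  have hqq : 0 < ipc (q - p) (q - p) := by
    rw [← norm_sq_ipc]
    have := norm_pos_iff.2 (sub_ne_zero.2 hqp)
    positivity
  have hα : Complex.arg ((q - p) / U) ≠ Real.pi := by
    intro h
    have h1 := Complex.norm_mul_exp_arg_mul_I ((q - p) / U)
    have hb : 0 < ‖(q - p) / U‖ :=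
      norm_pos_iff.2 (div_ne_zero (sub_ne_zero.2 hqp) (Complex.exp_ne_zero _))
    rw [h, Complex.exp_pi_mul_I, eq_div_iff (Complex.exp_ne_zero _)] at h1
    generalize ‖(q - p) / U‖ = b at *
    have h2 : ∀ x, ipc (q - p) x = -b * ipc U x := by
      intro x; rw [← h1]; simp [ipc]; ring
    have h3 : ipc (q - p) (q - p) = b ^ 2 * ipc U U := by rw [← h1]; simp [ipc]; ring
    rw [h2 (o - p), h3, hUU] at hqo
    rw [h2 U, h3, hUU] at hkey
    generalize R ^ 2 - dist p o ^ 2 = k at *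
    generalize ipc U (o - p) = x at *
    have : 0 ≤ b * (b * x - k) := by linarith
    have := nonneg_of_mul_nonneg_right this hb
    nlinarith
  obtain ⟨P, hP1, hP2, hP3, hP4, hP5⟩ := canon_exists p q θ hqp hα
  refine ⟨P, hP1, hP2, hP3, hP4, ?_, ?_⟩
  · rintro _ ⟨t, ht, rfl⟩
    rw [hP5 t, hmem]
    obtain ⟨l, m, hl, hm, hz, hn⟩ := canon_comb p q θ t hqp hα ht
    exact ⟨⟨ball_comb _ l m (q - p) U (o - p) _ hz hn hl hm hk hqo hqq hkey,
      side_comb _ l m (q - p) U _ _ hz hn hl hm hqa hua⟩,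
      side_comb _ l m (q - p) U _ _ hz hn hl hm hqb hub⟩
  · intro P' hn hs ht hd him
    have hcan : ∀ t, P'.toFun t = canon p q θ t := by
      cases P' with
      | seg p' q' =>
        have e1 : p' = p := by simpa [Piece.source, Piece.toFun] using hs
        have e2 : q' = q := by simpa [Piece.target, Piece.toFun] using ht
        subst e1 e2
        have h := dir_eq _ _ hd
        simp only [Piece.tangent] at h
        have h0 : Complex.arg ((q' - p') / U) = 0 := by
          have : (q' - p') / U = (‖q' - p'‖ : ℂ) :=
            (div_eq_iff (Complex.exp_ne_zero _)).2 h
          rw [this]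
          exact Complex.arg_ofReal_of_nonneg (norm_nonneg _)
        intro t
        simp only [Piece.toFun, canon, ← hU, if_pos h0]
      | arc c r θ₀ θ₁ =>
        obtain ⟨ρ, ψ, hρψ, hform⟩ := arc_form c p r θ₀ θ₁ θ hn hs hd
        have hlt : |ψ| < Real.pi := by
          by_contra hge
          push Not at hge
          have hρ0 : 0 < |ρ| := abs_pos.2 (by rintro rfl; simp at hρψ)
          have hin : ∀ ε ∈ Set.Ioo 0 Real.pi, ∀ z : ℂ,
              z = -((2 * |ρ| * Real.sin ε : ℝ) : ℂ) *
                (Complex.exp (Complex.I * ((-((ψ / |ψ|) * ε) : ℝ) : ℂ)) * U) →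
              p + z ∈ quadrant o A B R rA rB sA sB := by
            intro ε hε z hz
            obtain ⟨t, ht, he⟩ := long_form ρ ψ ε U hge hρψ hε
            rw [hz, ← he, ← hform t]
            exact him ⟨t, ht, rfl⟩
          have ha := back_limit |ρ| (ψ / |ψ|) (sgb sA) U (A - p) hρ0 fun ε hε z hz => by
            have := ((hmem _).1 (hin ε hε z hz)).1.2
            simpa using this
          have hb := back_limit |ρ| (ψ / |ψ|) (sgb sB) U (B - p) hρ0 fun ε hε z hz => by
            have := ((hmem _).1 (hin ε hε z hz)).2
            simpa using this
          have ha0 : ipc U (A - p) = 0 := by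
            have h1 : sgb sA * ipc U (A - p) = 0 := le_antisymm ha hua
            linear_combination sgb sA * h1 - ipc U (A - p) * sgb_sq sA
          have hb0 : ipc U (B - p) = 0 := by
            have h1 : sgb sB * ipc U (B - p) = 0 := le_antisymm hb hub
            linear_combination sgb sB * h1 - ipc U (B - p) * sgb_sq sB
          have := parseval (A - p) (B - p) U U hab
          rw [ha0, hb0, hUU, haa, hbb] at this
          have h9 : 0 < rA ^ 2 * rB ^ 2 := by positivity
          linarith
        intro t
        rw [hform t]
        apply arc_canon p q θ ρ ψ hρψ (abs_lt.1 hlt).1 (abs_lt.1 hlt).2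
        rw [← ht, Piece.target, hform 1, mul_one]
    have : P'.toFun = P.toFun := by
      funext t; rw [hcan, hP5]
    unfold Piece.image
    rw [this]
end
end
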